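/- Let n ≥ 6 and define f(n) = 1 + ⌊√(n−3)⌋ if n is even; f(n) = ⌊3/2 + √(n−3)⌋ if n is odd and n = p² − p + 3 for some natural number p; and f(n) = ⌊1/2 + √(n−3)⌋ if n is odd and cannot be written in that form. Then: (i) the sequence of double stars T(⌈(n−2)/2⌉+k, ⌊(n−2)/2⌋−k) for k = 0, 1, …, f(n)−1 has strictly decreasing Laplacian energy; and (ii) every tree on n vertices that is not isomorphic to the star on n vertices nor to any of these f(n) double stars has Laplacian energy strictly smaller than LE(T(⌈(n−2)/2⌉+f(n)−1, ⌊(n−2)/2⌋−f(n)+1)). In other words, among all trees with n vertices, the trees with second through (f(n)+1)-st largest Laplacian energy are, respectively, the trees T(⌈(n−2)/2⌉+k, ⌊(n−2)/2⌋−k) for 0 ≤ k ≤ f(n)−1. -/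

import Mathlib

open Polynomial

namespace LapPaper

variable {V : Type} [Fintype V] [DecidableEq V]

/-- The multiset of Laplacian eigenvalues of `G` (with multiplicity), given as the
real roots of the characteristic polynomial of the Laplacian matrix `L = D - A`. -/
noncomputable def lapSpectrum (G : SimpleGraph V) [DecidableRel G.Adj] : Multiset ℝ :=
  (G.lapMatrix ℝ).charpoly.roots

/-- The average degree `d̄ = 2|E|/n` of a graph. -/
noncomputable def avgDeg (G : SimpleGraph V) [DecidableRel G.Adj] : ℝ :=
  2 * G.edgeFinset.card / Fintype.card V

/-- The Laplacian energy `LE(G) = ∑_i |μ_i - d̄|`. -/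
noncomputable def LE (G : SimpleGraph V) [DecidableRel G.Adj] : ℝ :=
  ((lapSpectrum G).map (fun x => |x - avgDeg G|)).sum

/-- `Sk G k` is the sum of the `k` largest Laplacian eigenvalues `μ_1 + ⋯ + μ_k` of `G`. -/
noncomputable def Sk (G : SimpleGraph V) [DecidableRel G.Adj] (k : ℕ) : ℝ :=
  ((((lapSpectrum G).sort (· ≤ ·)).reverse).take k).sum

/-- The number `σ` of Laplacian eigenvalues of `G` strictly larger than the average degree. -/
noncomputable def sigma (G : SimpleGraph V) [DecidableRel G.Adj] : ℕ :=
  Multiset.card ((lapSpectrum G).filter (fun x => avgDeg G < x))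

/-- The double star `T(a,b)` on `a + b + 2` vertices: vertex `0` is adjacent to vertex `1`
and to the `a` leaves `2, …, a+1`; vertex `1` is adjacent to the `b` leaves `a+2, …, a+b+1`. -/
def doubleStar (a b : ℕ) : SimpleGraph (Fin (a + b + 2)) :=
  SimpleGraph.fromRel (fun u v =>
    (u.1 = 0 ∧ v.1 = 1) ∨ (u.1 = 0 ∧ 2 ≤ v.1 ∧ v.1 < a + 2) ∨ (u.1 = 1 ∧ a + 2 ≤ v.1))

noncomputable instance (a b : ℕ) : DecidableRel (doubleStar a b).Adj := Classical.decRel _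

/-- The star on `n` vertices: vertex `0` is adjacent to all other vertices. -/
def starGraph (n : ℕ) : SimpleGraph (Fin n) :=
  SimpleGraph.fromRel (fun u _ => u.1 = 0)

noncomputable instance (n : ℕ) : DecidableRel (starGraph n).Adj := Classical.decRel _

end LapPaper

namespace LapPaper

open Classical in
/-- The function `f(n)` of Theorem 1.2. -/
noncomputable def f (n : ℕ) : ℕ :=
  if Even n then 1 + ⌊Real.sqrt ((n : ℝ) - 3)⌋₊
  else if ∃ p : ℕ, n = p ^ 2 - p + 3 then ⌊3 / 2 + Real.sqrt ((n : ℝ) - 3)⌋₊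
  else ⌊1 / 2 + Real.sqrt ((n : ℝ) - 3)⌋₊

/-! ### The Laplacian quadratic form -/

open Finset Matrix

section Spectral

variable {V : Type} [Fintype V] [DecidableEq V] (G : SimpleGraph V) [DecidableRel G.Adj]

/-- The Laplacian quadratic form `x ↦ xᵀ L x`. -/
noncomputable def energy (x : V → ℝ) : ℝ := x ⬝ᵥ (G.lapMatrix ℝ *ᵥ x)

theorem energy_eq (x : V → ℝ) :
    energy G x = (∑ i : V, ∑ j : V, if G.Adj i j then (x i - x j) ^ 2 else 0) / 2 := by
  rw [← SimpleGraph.lapMatrix_toLinearMap₂', toLinearMap₂'_apply', energy]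

theorem energy_nonneg (x : V → ℝ) : 0 ≤ energy G x := by
  rw [energy_eq]; positivity

/-- A family of distinct edges bounds the Laplacian form from below. -/
theorem sum_edges_le_energy {κ : Type*} [Fintype κ] (a b : κ → V)
    (hadj : ∀ k, G.Adj (a k) (b k)) (hinj : Function.Injective fun k => s(a k, b k))
    (x : V → ℝ) : ∑ k, (x (a k) - x (b k)) ^ 2 ≤ energy G x := by
  classical
  rw [energy_eq, le_div_iff₀ two_pos, ← Finset.sum_product']
  let φ : κ ⊕ κ → V × V := Sum.elim (fun k => (a k, b k)) (fun k => (b k, a k))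
  have hφ : Function.Injective φ := by
    rintro (k | k) (l | l) h <;> simp only [φ, Sum.elim_inl, Sum.elim_inr, Prod.mk.injEq] at h
    · exact congrArg _ (hinj (by simp [h.1, h.2]))
    · have : k = l := hinj (by simp [h.1, h.2, Sym2.eq_swap])
      subst this
      exact absurd h.1 (hadj k).ne
    · have : k = l := hinj (by simp [h.1, h.2, Sym2.eq_swap])
      subst this
      exact absurd h.2 (hadj k).ne
    · exact congrArg _ (hinj (by simp [h.1, h.2]))
  have hsum : ∑ p ∈ univ.image φ, (if G.Adj p.1 p.2 then (x p.1 - x p.2) ^ 2 else 0)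
      = (∑ k, (x (a k) - x (b k)) ^ 2) * 2 := by
    rw [Finset.sum_image (fun i _ j _ h => hφ h), Fintype.sum_sum_type, mul_two]
    congr 1
    · exact Finset.sum_congr rfl fun k _ => by simp [φ, hadj k]
    · exact Finset.sum_congr rfl fun k _ => by
        simp only [φ, Sum.elim_inr, (hadj k).symm, if_true]; ring
  rw [← hsum]
  refine Finset.sum_le_sum_of_subset_of_nonneg (fun p _ => by simp) fun p _ _ => ?_
  split_ifs <;> positivity

/-- Orthonormal diagonalization of the Laplacian. -/
theorem exists_lap_eigenbasis : ∃ (μ : V → ℝ) (v : V → V → ℝ),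
    lapSpectrum G = univ.val.map μ ∧
    (∀ i, G.lapMatrix ℝ *ᵥ v i = μ i • v i) ∧
    (∀ i j, v i ⬝ᵥ v j = if i = j then 1 else 0) ∧
    (∀ x : V → ℝ, x = ∑ i, (v i ⬝ᵥ x) • v i) := by
  have hA := G.isHermitian_lapMatrix ℝ
  refine ⟨hA.eigenvalues, fun i => ⇑(hA.eigenvectorBasis i), ?_, fun i => ?_, fun i j => ?_,
    fun x => ?_⟩
  · rw [lapSpectrum, hA.roots_charpoly_eq_eigenvalues]
    rfl
  · exact hA.mulVec_eigenvectorBasis i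
  · have := orthonormal_iff_ite.1 hA.eigenvectorBasis.orthonormal j i
    rw [EuclideanSpace.inner_eq_star_dotProduct] at this
    simpa [eq_comm] using! this
  · have := hA.eigenvectorBasis.sum_repr' (WithLp.toLp 2 x)
    have h2 := congrArg (WithLp.ofLp) this
    simp only [WithLp.ofLp_sum, WithLp.ofLp_smul] at h2
    conv_lhs => rw [← h2]
    refine Finset.sum_congr rfl fun i _ => ?_
    rw [EuclideanSpace.inner_eq_star_dotProduct]
    simp [dotProduct_comm]

variable {G}

theorem energy_sum_eigen {μ : V → ℝ} {v : V → V → ℝ}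
    (hL : ∀ i, G.lapMatrix ℝ *ᵥ v i = μ i • v i)
    (ho : ∀ i j, v i ⬝ᵥ v j = if i = j then 1 else 0) (a : V → ℝ) :
    energy G (∑ i, a i • v i) = ∑ i, μ i * a i ^ 2 := by
  simp only [energy, mulVec_sum, mulVec_smul, hL, sum_dotProduct, dotProduct_sum, smul_dotProduct,
    dotProduct_smul, ho, smul_eq_mul, mul_ite, mul_one, mul_zero, Finset.sum_ite_eq', mem_univ,
    if_true]
  exact Finset.sum_congr rfl fun i _ => by ring

theorem sq_sum_eigen {v : V → V → ℝ}
    (ho : ∀ i j, v i ⬝ᵥ v j = if i = j then 1 else 0) (a : V → ℝ) :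
    (∑ i, a i • v i) ⬝ᵥ (∑ i, a i • v i) = ∑ i, a i ^ 2 := by
  simp only [sum_dotProduct, dotProduct_sum, smul_dotProduct,
    dotProduct_smul, ho, smul_eq_mul, mul_ite, mul_one, mul_zero, Finset.sum_ite_eq', mem_univ,
    if_true]
  exact Finset.sum_congr rfl fun i _ => by ring

variable (G)

/-- `Lev G j y`: at most `j` linear constraints force the Laplacian form to be at least `y`;
equivalently at most `j` Laplacian eigenvalues are smaller than `y`. -/
def Lev (j : ℕ) (y : ℝ) : Prop :=
  ∃ (K : Finset V) (F : V → (V → ℝ) →ₗ[ℝ] ℝ), #K ≤ j ∧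
    ∀ x : V → ℝ, (∀ k ∈ K, F k x = 0) → y * (x ⬝ᵥ x) ≤ energy G x

variable {G}

theorem Lev.mono {j j' : ℕ} {y y' : ℝ} (h : Lev G j y) (hj : j ≤ j') (hy : y' ≤ y) :
    Lev G j' y' := by
  obtain ⟨K, F, hK, hF⟩ := h
  refine ⟨K, F, hK.trans hj, fun x hx => le_trans ?_ (hF x hx)⟩
  exact mul_le_mul_of_nonneg_right hy (Finset.sum_nonneg fun i _ => mul_self_nonneg _)

theorem Lev.card_lt_le {μ : V → ℝ} {v : V → V → ℝ}
    (hL : ∀ i, G.lapMatrix ℝ *ᵥ v i = μ i • v i)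
    (ho : ∀ i j, v i ⬝ᵥ v j = if i = j then 1 else 0)
    {j : ℕ} {y : ℝ} (h : Lev G j y) : #{i | μ i < y} ≤ j := by
  obtain ⟨K, F, hK, hF⟩ := h
  refine le_trans ?_ hK
  by_contra! hlt
  let I : Finset V := {i | μ i < y}
  let ext : (I → ℝ) →ₗ[ℝ] (V → ℝ) :=
    { toFun := fun a i => if h : i ∈ I then a ⟨i, h⟩ else 0
      map_add' := fun a b => by ext i; simp only [Pi.add_apply]; split_ifs <;> simp
      map_smul' := fun r a => by
        ext i; simp only [Pi.smul_apply, RingHom.id_apply]; split_ifs <;> simp }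
  let comb : (V → ℝ) →ₗ[ℝ] (V → ℝ) :=
    { toFun := fun a => ∑ i, a i • v i
      map_add' := fun a b => by simp [add_smul, Finset.sum_add_distrib]
      map_smul' := fun r a => by simp [mul_smul, Finset.smul_sum] }
  let Φ : (I → ℝ) →ₗ[ℝ] (K → ℝ) := LinearMap.pi fun k => (F k).comp (comb.comp ext)
  have hker : LinearMap.ker Φ ≠ ⊥ := by
    apply LinearMap.ker_ne_bot_of_finrank_lt
    rw [Module.finrank_fintype_fun_eq_card, Module.finrank_fintype_fun_eq_card, Fintype.card_coe,
      Fintype.card_coe]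
    exact hlt
  obtain ⟨a, ha, ha0⟩ := (Submodule.ne_bot_iff _).1 hker
  have hv : ∀ k ∈ K, F k (comb (ext a)) = 0 := fun k hk => by
    have := congrFun (LinearMap.mem_ker.1 ha) ⟨k, hk⟩
    simpa [Φ] using! this
  have h1 := hF _ hv
  have h2 : energy G (comb (ext a)) = ∑ i, μ i * ext a i ^ 2 := energy_sum_eigen hL ho _
  have h3 : comb (ext a) ⬝ᵥ comb (ext a) = ∑ i, ext a i ^ 2 := sq_sum_eigen ho _
  rw [h2, h3, Finset.mul_sum] at h1
  obtain ⟨i, hi⟩ := Function.ne_iff.1 ha0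
  have hi' : ext a i.1 ≠ 0 := by simpa [ext] using hi
  refine absurd h1 (not_le.2 (Finset.sum_lt_sum (fun l _ => ?_) ⟨i.1, mem_univ _, ?_⟩))
  · by_cases hl : l ∈ I
    · exact mul_le_mul_of_nonneg_right (Finset.mem_filter.1 hl).2.le (sq_nonneg _)
    · simp [ext, hl]
  · exact mul_lt_mul_of_pos_right (Finset.mem_filter.1 i.2).2 (by positivity)

/-- Layer-cake comparison of two finite families through their counting functions. -/
theorem sum_max_le_of_card_lt {ι κ : Type*} [Fintype ι] [Fintype κ] {c : ℝ} (hc : 0 ≤ c)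
    (μ : ι → ℝ) (z : κ → ℝ) (hμ : ∀ i, 0 ≤ μ i) (hz : ∀ k, 0 ≤ z k ∧ z k ≤ c)
    (h : ∀ y, 0 < y → y ≤ c → #{i | μ i < y} ≤ #{k | z k < y}) :
    ∑ i, max (c - μ i) 0 ≤ ∑ k, (c - z k) := by
  classical
  have key : ∀ m : ℝ, 0 ≤ m →
      ∫ y in (0 : ℝ)..c, (if m < y then (1 : ℝ) else 0) = max (c - m) 0 := by
    intro m hm
    have h1 : (fun y : ℝ => if m < y then (1 : ℝ) else 0) =
        Set.indicator (Set.Ioi m) (fun _ => (1 : ℝ)) := by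
      ext y; simp [Set.indicator]
    rw [h1, intervalIntegral.integral_of_le hc, MeasureTheory.integral_indicator measurableSet_Ioi,
      MeasureTheory.Measure.restrict_restrict measurableSet_Ioi,
      show Set.Ioi m ∩ Set.Ioc 0 c = Set.Ioc m c by
        ext y; simp only [Set.mem_inter_iff, Set.mem_Ioi, Set.mem_Ioc]
        exact ⟨fun h => ⟨h.1, h.2.2⟩, fun h => ⟨h.1, hm.trans_lt h.1, h.2⟩⟩]
    simp [MeasureTheory.measureReal_def, ENNReal.toReal_ofReal']
  have hii : ∀ m : ℝ, IntervalIntegrable (fun y : ℝ => if m < y then (1 : ℝ) else 0)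
      MeasureTheory.volume 0 c := by
    intro m
    refine Monotone.intervalIntegrable fun a b hab => ?_
    split_ifs with h1 h2 <;> linarith
  have hl : ∑ i, max (c - μ i) 0 =
      ∫ y in (0 : ℝ)..c, ∑ i, (if μ i < y then (1 : ℝ) else 0) := by
    rw [intervalIntegral.integral_finsetSum fun i _ => hii _]
    exact Finset.sum_congr rfl fun i _ => (key _ (hμ i)).symm
  have hr : ∑ k, (c - z k) = ∫ y in (0 : ℝ)..c, ∑ k, (if z k < y then (1 : ℝ) else 0) := by
    rw [intervalIntegral.integral_finsetSum fun i _ => hii _]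
    refine Finset.sum_congr rfl fun k _ => ?_
    rw [key _ (hz k).1, max_eq_left (sub_nonneg.2 (hz k).2)]
  rw [hl, hr]
  refine intervalIntegral.integral_mono_on_of_le_Ioo hc ?_ ?_ fun y hy => ?_
  · exact (IntervalIntegrable.sum univ fun i _ => hii (μ i)).congr fun y _ => by
      simp only [Finset.sum_apply]
  · exact (IntervalIntegrable.sum univ fun i _ => hii (z i)).congr fun y _ => by
      simp only [Finset.sum_apply]
  · rw [Finset.sum_boole, Finset.sum_boole]
    exact_mod_cast h y hy.1 hy.2.le

variable (G)

/-- A certificate that the positive part of `c - L` has trace at most `t`: a family of vectors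
`g` of total squared norm at most `t` with `c ≤ L + ∑ g gᵀ`. -/
def Cert (c t : ℝ) : Prop :=
  ∃ (ι : Type) (_ : Fintype ι) (g : ι → V → ℝ), ∑ k, g k ⬝ᵥ g k ≤ t ∧
    ∀ x : V → ℝ, c * (x ⬝ᵥ x) ≤ energy G x + ∑ k, (g k ⬝ᵥ x) ^ 2

variable {G}

theorem Cert.mono {c t t' : ℝ} (h : Cert G c t) (ht : t ≤ t') : Cert G c t' := by
  obtain ⟨ι, _, g, h1, h2⟩ := h
  exact ⟨ι, _, g, h1.trans ht, h2⟩

theorem cert_eigen {μ : V → ℝ} {v : V → V → ℝ}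
    (hL : ∀ i, G.lapMatrix ℝ *ᵥ v i = μ i • v i)
    (ho : ∀ i j, v i ⬝ᵥ v j = if i = j then 1 else 0)
    (hx : ∀ x : V → ℝ, x = ∑ i, (v i ⬝ᵥ x) • v i) (c : ℝ) :
    Cert G c (∑ i, max (c - μ i) 0) := by
  refine ⟨V, inferInstance, fun i => √(max (c - μ i) 0) • v i, ?_, fun x => ?_⟩
  · refine Finset.sum_le_sum fun i _ => ?_
    rw [smul_dotProduct, dotProduct_smul, ho, if_pos rfl, smul_eq_mul, smul_eq_mul, mul_one,
      Real.mul_self_sqrt (le_max_right _ _)]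
  · have h1 : energy G x = ∑ i, μ i * (v i ⬝ᵥ x) ^ 2 := by
      conv_lhs => rw [hx x]
      exact energy_sum_eigen hL ho _
    have h2 : x ⬝ᵥ x = ∑ i, (v i ⬝ᵥ x) ^ 2 := by
      conv_lhs => rw [hx x]
      exact sq_sum_eigen ho _
    rw [h1, h2, Finset.mul_sum, ← Finset.sum_add_distrib]
    refine Finset.sum_le_sum fun i _ => ?_
    rw [smul_dotProduct, smul_eq_mul, mul_pow, Real.sq_sqrt (le_max_right _ _)]
    nlinarith [le_max_left (c - μ i) 0, sq_nonneg (v i ⬝ᵥ x)]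

theorem Cert.sum_max_le {c t : ℝ} (h : Cert G c t) {μ : V → ℝ} {v : V → V → ℝ}
    (hL : ∀ i, G.lapMatrix ℝ *ᵥ v i = μ i • v i)
    (ho : ∀ i j, v i ⬝ᵥ v j = if i = j then 1 else 0)
    (hx : ∀ x : V → ℝ, x = ∑ i, (v i ⬝ᵥ x) • v i) :
    ∑ i, max (c - μ i) 0 ≤ t := by
  obtain ⟨ι, _, g, h1, h2⟩ := h
  refine le_trans ?_ h1
  have h3 : ∀ i, max (c - μ i) 0 ≤ ∑ k, (g k ⬝ᵥ v i) ^ 2 := by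
    intro i
    refine max_le ?_ (by positivity)
    have := h2 (v i)
    rw [energy, hL, dotProduct_smul, ho, if_pos rfl, smul_eq_mul] at this
    linarith
  have h4 : ∀ k, g k ⬝ᵥ g k = ∑ i, (g k ⬝ᵥ v i) ^ 2 := by
    intro k
    conv_lhs => rw [hx (g k)]
    rw [sq_sum_eigen ho]
    simp only [dotProduct_comm (g k)]
  rw [Finset.sum_congr rfl fun k _ => h4 k, Finset.sum_comm]
  exact Finset.sum_le_sum fun i _ => h3 i

theorem cert_of_lev {κ : Type*} [Fintype κ] {c : ℝ} (hc : 0 ≤ c) (z : κ → ℝ)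
    (hz : ∀ k, 0 ≤ z k ∧ z k ≤ c) (h : ∀ y, 0 < y → y ≤ c → Lev G #{k | z k < y} y) :
    Cert G c (∑ k, (c - z k)) := by
  obtain ⟨μ, v, -, hL, ho, hx⟩ := exists_lap_eigenbasis G
  refine (cert_eigen hL ho hx c).mono (sum_max_le_of_card_lt hc μ z (fun i => ?_) hz ?_)
  · have := energy_nonneg G (v i)
    rwa [energy, hL, dotProduct_smul, ho, if_pos rfl, smul_eq_mul, mul_one] at this
  · exact fun y h0 h1 => (h y h0 h1).card_lt_le hL ho

theorem sum_eigen_eq {μ : V → ℝ} (hs : lapSpectrum G = univ.val.map μ) :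
    ∑ i, μ i = 2 * #G.edgeFinset := by
  have hA := G.isHermitian_lapMatrix ℝ
  have h1 : (G.lapMatrix ℝ).trace = ∑ i, μ i := by
    rw [hA.trace_eq_sum_eigenvalues]
    have : Multiset.map hA.eigenvalues univ.val = univ.val.map μ := by
      rw [← hs, lapSpectrum, hA.roots_charpoly_eq_eigenvalues]
      rfl
    have := congrArg Multiset.sum this
    simpa using! this
  rw [← h1]
  have : (G.lapMatrix ℝ).trace = ∑ i, (G.degree i : ℝ) := by
    simp [Matrix.trace, SimpleGraph.lapMatrix, SimpleGraph.degMatrix]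
  rw [this]
  exact_mod_cast G.sum_degrees_eq_twice_card_edges

/-- The Laplacian energy is twice the trace of the positive part of `d̄ - L`. -/
theorem LE_eq [Nonempty V] {μ : V → ℝ} (hs : lapSpectrum G = univ.val.map μ) :
    LE G = 2 * ∑ i, max (avgDeg G - μ i) 0 := by
  have h1 : LE G = ∑ i, |μ i - avgDeg G| := by
    rw [LE, hs, Multiset.map_map]; rfl
  have h2 : ∑ i, (avgDeg G - μ i) = 0 := by
    rw [Finset.sum_sub_distrib, sum_eigen_eq hs, Finset.sum_const, card_univ, avgDeg,
      nsmul_eq_mul]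
    have : (Fintype.card V : ℝ) ≠ 0 := by exact_mod_cast Fintype.card_ne_zero
    field_simp
    ring
  have h3 : ∀ i, |μ i - avgDeg G| = 2 * max (avgDeg G - μ i) 0 - (avgDeg G - μ i) := by
    intro i
    rcases le_total (avgDeg G - μ i) 0 with h | h
    · rw [max_eq_right h, abs_of_nonneg (by linarith)]; ring
    · rw [max_eq_left h, abs_of_nonpos (by linarith)]; ring
  rw [h1, Finset.sum_congr rfl fun i _ => h3 i, Finset.sum_sub_distrib, h2, ← Finset.mul_sum,
    sub_zero]

theorem Cert.LE_le [Nonempty V] {t : ℝ} (h : Cert G (avgDeg G) t) : LE G ≤ 2 * t := by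
  obtain ⟨μ, v, hs, hL, ho, hx⟩ := exists_lap_eigenbasis G
  rw [LE_eq hs]
  linarith [h.sum_max_le hL ho hx]

end Spectral

section Certificates

variable {V : Type} [Fintype V] [DecidableEq V] {G : SimpleGraph V} [DecidableRel G.Adj]

theorem cert_base {ι : Type*} [Fintype ι] {z : ι → ℝ} (hz : ∀ u, 0 ≤ z u ∧ z u ≤ 1)
    {k q e : ℕ} {ε m : ℝ} (hm1 : 1 ≤ m) (hm2 : m ≤ 2 - ε) (hε : ε ≤ 1) (hε0 : 0 ≤ ε)
    (hn : Fintype.card V = k + (1 + Fintype.card ι + q + e))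
    (hK : ∀ y, 0 < y → y ≤ 1 → Lev G (1 + #{u | z u < y}) y)
    (hmid : Lev G (1 + Fintype.card ι + q) m)
    (htop : Lev G (1 + Fintype.card ι + q + e) 2)
    (hineq : 1 + Fintype.card ι + k * ε ≤ k + e * (m - 1) + ∑ u, z u) :
    Cert G (2 - ε) (Fintype.card V * (1 - ε)) := by
  let Z : Unit ⊕ ι ⊕ Fin q ⊕ Fin e → ℝ :=
    Sum.elim (fun _ => 0) (Sum.elim z (Sum.elim (fun _ => 1) (fun _ => m)))
  have hcount : ∀ y, #{k | Z k < y} = (if 0 < y then 1 else 0) + (#{u | z u < y} +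
      ((if 1 < y then q else 0) + (if m < y then e else 0))) := by
    intro y
    simp only [Finset.card_filter, Fintype.sum_sum_type, Z, Sum.elim_inl, Sum.elim_inr]
    congr 1
    by_cases h1 : 1 < y <;> by_cases h2 : m < y <;> simp [h1, h2] <;>
      exact (Finset.card_filter _ _).symm
  have := cert_of_lev (G := G) (c := 2 - ε) (by linarith) Z ?_ ?_
  · refine this.mono ?_
    simp only [Fintype.sum_sum_type, Z, Sum.elim_inl, Sum.elim_inr, Finset.sum_const, card_univ,
      Finset.sum_sub_distrib, nsmul_eq_mul, Fintype.card_fin, Fintype.card_unit, Fintype.card_sum]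
    rw [hn]
    push_cast
    nlinarith
  · rintro (_ | u | _ | _) <;> simp only [Z, Sum.elim_inl, Sum.elim_inr]
    · constructor <;> linarith
    · exact ⟨(hz u).1, by linarith [(hz u).2]⟩
    · constructor <;> linarith
    · constructor <;> linarith
  · intro y h0 h1
    rw [hcount, if_pos h0]
    rcases le_or_gt y 1 with hy1 | hy1
    · exact (hK y h0 hy1).mono (by omega) le_rfl
    have hall : #{u | z u < y} = Fintype.card ι := by
      rw [Finset.filter_true_of_mem fun u _ => (hz u).2.trans_lt hy1, card_univ]
    rw [hall, if_pos hy1]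
    rcases le_or_gt y m with hym | hym
    · exact hmid.mono (by omega) hym
    · rw [if_pos hym]
      exact htop.mono (by omega) (by linarith)

theorem cert_no_mid {ι : Type*} [Fintype ι] {z : ι → ℝ} (hz : ∀ u, 0 ≤ z u ∧ z u ≤ 1)
    {k : ℕ} {ε : ℝ} (hε : ε ≤ 1 / 3) (hε0 : 0 ≤ ε)
    (hn : k + (1 + Fintype.card ι) ≤ Fintype.card V)
    (hK : ∀ y, 0 < y → y ≤ 1 → Lev G (1 + #{u | z u < y}) y)
    (htop : Lev G (Fintype.card V - k) 2)
    (hineq : 1 + Fintype.card ι + k * ε ≤ k + ∑ u, z u) :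
    Cert G (2 - ε) (Fintype.card V * (1 - ε)) := by
  obtain ⟨q, hq⟩ := Nat.exists_eq_add_of_le hn
  have h1 : Fintype.card V - k = 1 + Fintype.card ι + q := by omega
  rw [h1] at htop
  exact cert_base (k := k) (q := q) (e := 0) (m := 1) hz le_rfl (by linarith) (by linarith) hε0
    (by omega) hK (htop.mono le_rfl (by norm_num)) htop (by push_cast; linarith)

theorem cert_mid {ι : Type*} [Fintype ι] {z : ι → ℝ} (hz : ∀ u, 0 ≤ z u ∧ z u ≤ 1)
    {k : ℕ} {ε : ℝ} (hε : ε ≤ 1 / 3) (hε0 : 0 ≤ ε)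
    (hn : k + (2 + Fintype.card ι) ≤ Fintype.card V)
    (hK : ∀ y, 0 < y → y ≤ 1 → Lev G (1 + #{u | z u < y}) y)
    (hmid : Lev G (Fintype.card V - k - 1) (11 / 8))
    (htop : Lev G (Fintype.card V - k) 2)
    (hineq : 1 + Fintype.card ι + k * ε ≤ k + 3 / 8 + ∑ u, z u) :
    Cert G (2 - ε) (Fintype.card V * (1 - ε)) := by
  obtain ⟨q, hq⟩ := Nat.exists_eq_add_of_le hn
  have h1 : Fintype.card V - k = 1 + Fintype.card ι + q + 1 := by omega
  rw [h1] at htop hmid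
  exact cert_base (k := k) (q := q) (e := 1) (m := 11 / 8) hz (by norm_num) (by linarith)
    (by linarith) hε0 (by omega) hK hmid htop (by push_cast; linarith)

theorem dotProduct_self_eq (x : V → ℝ) : x ⬝ᵥ x = ∑ v, x v ^ 2 := by
  simp [dotProduct, sq]

/-- The coordinate functional `x ↦ x v`. -/
def ev (v : V) : (V → ℝ) →ₗ[ℝ] ℝ := LinearMap.proj v

@[simp] theorem ev_apply (v : V) (x : V → ℝ) : ev v x = x v := rfl

/-- Certificates of the two parts of a vertex partition combine. -/
theorem Cert.glue {s : Set V} [Fintype s] [Fintype ↥sᶜ] [DecidableEq s] [DecidableEq ↥sᶜ]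
    [DecidableRel (G.induce s).Adj] [DecidableRel (G.induce sᶜ).Adj] {c t t' : ℝ}
    (h : Cert (G.induce s) c t) (h' : Cert (G.induce sᶜ) c t') : Cert G c (t + t') := by
  classical
  obtain ⟨ι, _, g, h1, h2⟩ := h
  obtain ⟨ι', _, g', h1', h2'⟩ := h'
  have hsplit : ∀ φ : V → ℝ, ∑ v, φ v = ∑ v : s, φ v + ∑ v : ↥sᶜ, φ v := by
    intro φ
    have h1 : ∑ v ∈ s.toFinset, φ v = ∑ v : s, φ v :=
      Finset.sum_subtype (p := (· ∈ s)) _ (fun v => Set.mem_toFinset) φ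
    have h2 : ∑ v ∈ sᶜ.toFinset, φ v = ∑ v : ↥sᶜ, φ v :=
      Finset.sum_subtype (p := (· ∈ sᶜ)) _ (fun v => Set.mem_toFinset) φ
    rw [← Finset.sum_add_sum_compl s.toFinset, ← Set.toFinset_compl, h1, h2]
  let E : (s → ℝ) → V → ℝ := fun a v => if h : v ∈ s then a ⟨v, h⟩ else 0
  let E' : (↥sᶜ → ℝ) → V → ℝ := fun a v => if h : v ∈ sᶜ then a ⟨v, h⟩ else 0
  have hE : ∀ a x, E a ⬝ᵥ x = a ⬝ᵥ fun v : s => x v := by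
    intro a x
    simp only [dotProduct, hsplit]
    rw [Finset.sum_eq_zero (s := (univ : Finset ↥sᶜ)), add_zero]
    · exact Finset.sum_congr rfl fun v _ => by simp [E]
    · intro v _
      have : (v : V) ∉ s := v.2
      simp [E, this]
  have hE' : ∀ a x, E' a ⬝ᵥ x = a ⬝ᵥ fun v : ↥sᶜ => x v := by
    intro a x
    simp only [dotProduct, hsplit]
    rw [Finset.sum_eq_zero (s := (univ : Finset ↥s)), zero_add]
    · refine Finset.sum_congr rfl fun v _ => ?_
      have : (v : V) ∉ s := v.2
      simp [E', this]
    · intro v _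
      simp [E']
  have hen : ∀ x, energy (G.induce s) (fun v => x v) + energy (G.induce sᶜ) (fun v => x v)
      ≤ energy G x := by
    intro x
    simp only [energy_eq, hsplit, Finset.sum_add_distrib, SimpleGraph.comap_adj,
      Function.Embedding.subtype_apply]
    have p1 : 0 ≤ ∑ v : s, ∑ w : ↥sᶜ, if G.Adj v w then (x v - x w) ^ 2 else 0 := by
      positivity
    have p2 : 0 ≤ ∑ v : ↥sᶜ, ∑ w : s, if G.Adj v w then (x v - x w) ^ 2 else 0 := by
      positivity
    linarith
  refine ⟨ι ⊕ ι', inferInstance, Sum.elim (fun k => E (g k)) (fun k => E' (g' k)), ?_, ?_⟩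
  · rw [Fintype.sum_sum_type]
    simp only [Sum.elim_inl, Sum.elim_inr, hE, hE']
    refine add_le_add (le_trans (le_of_eq ?_) h1) (le_trans (le_of_eq ?_) h1')
    · exact Finset.sum_congr rfl fun k _ => by congr 1; ext v; simp [E]
    · refine Finset.sum_congr rfl fun k _ => ?_
      congr 1; ext v
      have : (v : V) ∉ s := v.2
      simp [E', this]
  · intro x
    have q1 := h2 fun v => x v
    have q2 := h2' fun v => x v
    have q3 := hen x
    have q4 : x ⬝ᵥ x = (fun v : s => x v) ⬝ᵥ (fun v : s => x v) +
      (fun v : ↥sᶜ => x v) ⬝ᵥ (fun v : ↥sᶜ => x v) := hsplit _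
    rw [Fintype.sum_sum_type, q4]
    simp only [Sum.elim_inl, Sum.elim_inr, hE, hE']
    linarith

/-- `R` is matched into its complement by `l`. -/
structure Matched (G : SimpleGraph V) (R : Finset V) (l : V → V) : Prop where
  adj : ∀ v ∈ R, G.Adj v (l v)
  inj : Set.InjOn l R
  notMem : ∀ v ∈ R, l v ∉ R

theorem Matched.card_compl {R : Finset V} {l : V → V} (h : Matched G R l) :
    #(univ \ R.image l) = Fintype.card V - #R := by
  rw [Finset.card_sdiff_of_subset (Finset.subset_univ _), Finset.card_image_of_injOn h.inj,
    Finset.card_univ]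

theorem Matched.disjoint {R : Finset V} {l : V → V} (h : Matched G R l) :
    Disjoint R (R.image l) := by
  rw [Finset.disjoint_right]
  intro v hv
  obtain ⟨u, hu, rfl⟩ := Finset.mem_image.1 hv
  exact h.notMem u hu

theorem Matched.lev {R : Finset V} {l : V → V} (h : Matched G R l) :
    Lev G (Fintype.card V - #R) 2 := by
  refine ⟨univ \ R.image l, fun v => if v ∈ R then ev v + ev (l v)
    else ev v, h.card_compl.le, fun x hx => ?_⟩
  have hR : ∀ v ∈ R, x (l v) = -x v := fun v hv => by
    have := hx v (by simp [Finset.disjoint_left.1 h.disjoint hv])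
    simp only [if_pos hv, LinearMap.add_apply, ev_apply] at this
    linarith
  have h0 : ∀ v, v ∉ R ∪ R.image l → x v = 0 := fun v hv => by
    rw [Finset.mem_union, not_or] at hv
    have := hx v (by simpa using hv.2)
    simpa only [if_neg hv.1, ev_apply] using this
  have he := sum_edges_le_energy G (κ := R) (fun v => v) (fun v => l v) (fun v => h.adj v v.2)
    (fun u v huv => by
      simp only [Sym2.eq_iff] at huv
      rcases huv with huv | huv
      · exact Subtype.ext huv.1
      · exact absurd (huv.1 ▸ u.2) (h.notMem v v.2)) x
  refine le_trans (le_of_eq ?_) he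
  rw [dotProduct_self_eq, ← Finset.sum_subset (Finset.subset_univ (R ∪ R.image l))
    fun v _ hv => by rw [h0 v hv]; ring, Finset.sum_union h.disjoint, Finset.sum_image h.inj,
    Finset.sum_coe_sort R fun v => (x v - x (l v)) ^ 2, ← Finset.sum_add_distrib, Finset.mul_sum]
  exact Finset.sum_congr rfl fun v hv => by rw [hR v hv]; ring

theorem Matched.lev_mid {R : Finset V} {l : V → V} (h : Matched G R l) {b c o : V}
    (hb : b ∈ R) (hc : c ∈ R) (hbc : b ≠ c) (ho : o ∉ R) (ho' : o ∉ R.image l)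
    (hob : G.Adj o b) (hoc : G.Adj o c) :
    Lev G (Fintype.card V - #R - 1) (11 / 8) := by
  refine ⟨(univ \ R.image l).erase o, fun v =>
    if v = b then ev (l b) + ev b + ev o + ev c +
      ev (l c)
    else if v = c then ev b - ev c +
      (2 : ℝ) • (ev (l b) - ev (l c))
    else if v ∈ R then ev v + ev (l v)
    else ev v, ?_, fun x hx => ?_⟩
  · rw [Finset.card_erase_of_mem (by simpa using ho'), h.card_compl]
  have hmem : ∀ v ∈ R, v ∈ (univ \ R.image l).erase o := fun v hv => by
    rw [Finset.mem_erase]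
    exact ⟨fun e => ho (e ▸ hv), by simp [Finset.disjoint_left.1 h.disjoint hv]⟩
  have hR : ∀ v ∈ R, v ≠ b → v ≠ c → x (l v) = -x v := fun v hv hvb hvc => by
    have := hx v (hmem v hv)
    simp only [if_neg hvb, if_neg hvc, if_pos hv, LinearMap.add_apply, ev_apply] at this
    linarith
  have eb : x (l b) + x b + x o + x c + x (l c) = 0 := by
    simpa using! hx b (hmem b hb)
  have ec : x b - x c + 2 * (x (l b) - x (l c)) = 0 := by
    simpa [hbc.symm] using! hx c (hmem c hc)
  have h0 : ∀ v, v ∉ R ∪ R.image l → v ≠ o → x v = 0 := fun v hv hvo => by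
    rw [Finset.mem_union, not_or] at hv
    have := hx v (by simpa [hvo] using hv.2)
    have h1 : v ≠ b := fun e => hv.1 (e ▸ hb)
    have h2 : v ≠ c := fun e => hv.1 (e ▸ hc)
    simpa only [if_neg h1, if_neg h2, if_neg hv.1, ev_apply] using this
  have he := sum_edges_le_energy G (κ := R ⊕ Bool) (Sum.elim (fun v => v) (fun _ => o))
    (Sum.elim (fun v => l v) (fun t => if t then b else c))
    (by
      rintro (v | _ | _)
      · exact h.adj v v.2
      · exact hoc
      · exact hob)
    (by
      have key : ∀ (v : R) (t : Bool), s((v : V), l v) ≠ s(o, if t then b else c) := by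
        intro v t e
        have : o ∈ s((v : V), l v) := by rw [e]; exact Sym2.mem_mk_left _ _
        rcases Sym2.mem_iff.1 this with e | e
        · exact ho (e ▸ v.2)
        · exact ho' (e ▸ Finset.mem_image_of_mem l v.2)
      rintro (u | t) (v | t') huv
      · simp only [Sum.elim_inl, Sym2.eq_iff] at huv
        rcases huv with huv | huv
        · exact congrArg _ (Subtype.ext huv.1)
        · exact absurd (huv.1 ▸ u.2) (h.notMem v v.2)
      · exact absurd huv (key u t')
      · exact absurd huv.symm (key v t)
      · simp only [Sum.elim_inr, Sym2.congr_right] at huv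
        cases t <;> cases t' <;> simp_all) x
  refine le_trans ?_ he
  rw [Fintype.sum_sum_type]
  simp only [Sum.elim_inl, Sum.elim_inr, Fintype.sum_bool, if_true, Bool.false_eq_true, if_false]
  have hou : o ∉ R ∪ R.image l := by simp only [Finset.mem_union, ho, ho', or_self, not_false_eq_true]
  rw [dotProduct_self_eq, ← Finset.sum_subset (Finset.subset_univ (insert o (R ∪ R.image l)))
    fun v _ hv => by
      rw [Finset.mem_insert, not_or] at hv
      rw [h0 v hv.2 hv.1]; ring,
    Finset.sum_insert hou, Finset.sum_union h.disjoint, Finset.sum_image h.inj,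
    Finset.sum_coe_sort R fun v => (x v - x (l v)) ^ 2, ← Finset.sum_add_distrib]
  have hcb : c ∈ R.erase b := Finset.mem_erase.2 ⟨hbc.symm, hc⟩
  rw [← Finset.add_sum_erase R _ hb, ← Finset.add_sum_erase _ _ hcb,
    ← Finset.add_sum_erase R (fun v => (x v - x (l v)) ^ 2) hb,
    ← Finset.add_sum_erase _ (fun v => (x v - x (l v)) ^ 2) hcb]
  have hrest : 11 / 8 * ∑ v ∈ (R.erase b).erase c, (x v ^ 2 + x (l v) ^ 2) ≤
      ∑ v ∈ (R.erase b).erase c, (x v - x (l v)) ^ 2 := by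
    rw [Finset.mul_sum]
    refine Finset.sum_le_sum fun v hv => ?_
    rw [Finset.mem_erase, Finset.mem_erase] at hv
    rw [hR v hv.2.2 hv.2.1 hv.1]
    nlinarith [sq_nonneg (x v)]
  have hcore : 11 / 8 * (x o ^ 2 + (x b ^ 2 + x (l b) ^ 2) + (x c ^ 2 + x (l c) ^ 2)) ≤
      (x b - x (l b)) ^ 2 + (x c - x (l c)) ^ 2 + (x o - x b) ^ 2 + (x o - x c) ^ 2 := by
    obtain ⟨s, hs⟩ : ∃ s, s = x (l b) + x (l c) := ⟨_, rfl⟩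
    obtain ⟨d, hd⟩ : ∃ d, d = x (l b) - x (l c) := ⟨_, rfl⟩
    obtain ⟨t, ht⟩ : ∃ t, t = x b + x c := ⟨_, rfl⟩
    have e1 : x (l b) = (s + d) / 2 := by linarith
    have e2 : x (l c) = (s - d) / 2 := by linarith
    have e3 : x b = t / 2 - d := by linarith
    have e4 : x c = t / 2 + d := by linarith
    have e5 : x o = -s - t := by linarith
    rw [e1, e2, e3, e4, e5]
    nlinarith [sq_nonneg d, sq_nonneg t, sq_nonneg (7 * s + 18 * t)]
  linarith

end Certificates

section Spiders

variable {V : Type} [Fintype V] [DecidableEq V] {G : SimpleGraph V} [DecidableRel G.Adj]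

theorem star_sum_le {ι : Type*} (s : Finset ι) (x : ι → ℝ) (t : ℝ) {y : ℝ} (hy : y < 1) :
    y * ∑ v ∈ s, x v ^ 2 - #s * (y / (1 - y)) * t ^ 2 ≤ ∑ v ∈ s, (x v - t) ^ 2 := by
  have hy' : 0 < 1 - y := by linarith
  have h : ∀ v ∈ s, y * x v ^ 2 - y / (1 - y) * t ^ 2 ≤ (x v - t) ^ 2 := by
    intro v _
    have : (x v - t) ^ 2 - (y * x v ^ 2 - y / (1 - y) * t ^ 2) =
        ((1 - y) * x v - t) ^ 2 / (1 - y) := by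
      field_simp
      ring
    have h2 : 0 ≤ ((1 - y) * x v - t) ^ 2 / (1 - y) := by positivity
    linarith
  have := Finset.sum_le_sum h
  rw [Finset.sum_sub_distrib, ← Finset.mul_sum, Finset.sum_const, nsmul_eq_mul] at this
  linarith

/-- A tree all of whose branches at `w` are stars: `b v` is the neighbour of `w` in the branch
of `v`, and `r u` is the centre of the branch at `u`. -/
structure Spider (G : SimpleGraph V) (w : V) (b r : V → V) : Prop where
  adj_b : ∀ v, v ≠ w → G.Adj w (b v)
  b_self : ∀ u, G.Adj w u → b u = u
  r_ne : ∀ u, G.Adj w u → r u ≠ w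
  b_r : ∀ u, G.Adj w u → b (r u) = u
  adj_r : ∀ v, v ≠ w → v ≠ r (b v) → G.Adj v (r (b v))
  third : ∀ u, G.Adj w u → r u ≠ u → ∃ v, v ≠ w ∧ b v = u ∧ v ≠ u ∧ v ≠ r u

/-- The branch of `w` labelled `u`. -/
def branch (w : V) (b : V → V) (u : V) : Finset V := {v | v ≠ w ∧ b v = u}

/-- The edges of a branch, including the edge to `w`. -/
def branchEnergy (w : V) (b r : V → V) (x : V → ℝ) (u : V) : ℝ :=
  (x u - x w) ^ 2 + ∑ v ∈ (branch w b u).erase (r u), (x v - x (r u)) ^ 2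

namespace Spider

variable {w : V} {b r : V → V}

theorem mem_branch {u v : V} : v ∈ branch w b u ↔ v ≠ w ∧ b v = u := by simp [branch]

theorem sum_branches (h : Spider G w b r) (φ : V → ℝ) :
    ∑ v, φ v = φ w + ∑ u ∈ G.neighborFinset w, ∑ v ∈ branch w b u, φ v := by
  rw [← Finset.add_sum_erase _ _ (Finset.mem_univ w)]
  congr 1
  rw [← Finset.sum_fiberwise_of_maps_to (s := univ.erase w) (t := G.neighborFinset w) (g := b)]
  · refine Finset.sum_congr rfl fun u _ => Finset.sum_congr ?_ fun _ _ => rfl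
    ext v
    simp [branch]
  · intro v hv
    rw [SimpleGraph.mem_neighborFinset]
    exact h.adj_b v (Finset.ne_of_mem_erase hv)

theorem r_mem (h : Spider G w b r) {u : V} (hu : G.Adj w u) : r u ∈ branch w b u :=
  mem_branch.2 ⟨h.r_ne u hu, h.b_r u hu⟩

theorem u_mem (h : Spider G w b r) {u : V} (hu : G.Adj w u) : u ∈ branch w b u :=
  mem_branch.2 ⟨hu.ne', h.b_self u hu⟩

theorem card_pos (h : Spider G w b r) {u : V} (hu : G.Adj w u) : 1 ≤ #(branch w b u) :=
  Finset.card_pos.2 ⟨u, h.u_mem hu⟩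

theorem card_ge_three (h : Spider G w b r) {u : V} (hu : G.Adj w u) (hr : r u ≠ u) :
    3 ≤ #(branch w b u) := by
  obtain ⟨v, h1, h2, h3, h4⟩ := h.third u hu hr
  calc 3 = #{u, r u, v} := by
        rw [Finset.card_eq_three.2 ⟨u, r u, v, hr.symm, h3.symm, h4.symm, rfl⟩]
    _ ≤ _ := Finset.card_le_card (by
        intro x hx
        simp only [Finset.mem_insert, Finset.mem_singleton] at hx
        rcases hx with rfl | rfl | rfl
        · exact h.u_mem hu
        · exact h.r_mem hu
        · exact mem_branch.2 ⟨h1, h2⟩)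

theorem card_eq (h : Spider G w b r) :
    Fintype.card V = 1 + ∑ u ∈ G.neighborFinset w, #(branch w b u) := by
  have := h.sum_branches fun _ => 1
  simp only [Finset.sum_const, nsmul_eq_mul, mul_one, Finset.card_univ] at this
  exact_mod_cast this

theorem sum_branchEnergy_le (h : Spider G w b r) (x : V → ℝ) :
    ∑ u ∈ G.neighborFinset w, branchEnergy w b r x u ≤ energy G x := by
  have he := sum_edges_le_energy G (κ := {v // v ≠ w})
    (fun v => if v.1 = r (b v) then b v else v) (fun v => if v.1 = r (b v) then w else r (b v))
    (by
      rintro ⟨v, hv⟩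
      dsimp only
      split_ifs with h1
      · exact (h.adj_b v hv).symm
      · exact h.adj_r v hv h1)
    (by
      rintro ⟨v, hv⟩ ⟨v', hv'⟩ e
      have hb := h.adj_b v hv
      have hb' := h.adj_b v' hv'
      simp only [Sym2.eq_iff] at e
      refine Subtype.ext ?_
      split_ifs at e with h1 h2 h2
      · rcases e with ⟨e, -⟩ | ⟨e, -⟩
        · dsimp only
          rw [h1, h2, e]
        · exact absurd e hb.ne'
      · rcases e with ⟨-, e⟩ | ⟨-, e⟩
        · exact absurd e.symm (h.r_ne _ hb')
        · exact absurd e.symm hv'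
      · rcases e with ⟨-, e⟩ | ⟨e, -⟩
        · exact absurd e (h.r_ne _ hb)
        · exact absurd e hv
      · rcases e with ⟨e, -⟩ | ⟨e, -⟩
        · exact e
        · exact absurd (by rw [e, h.b_r _ hb']) h1) x
  refine le_trans (le_of_eq ?_) he
  let φ : V → ℝ := fun v => if v = w then 0 else
    (x (if v = r (b v) then b v else v) - x (if v = r (b v) then w else r (b v))) ^ 2
  have h1 : ∑ v : {v // v ≠ w}, (x (if v.1 = r (b v) then b v else v) -
      x (if v.1 = r (b v) then w else r (b v))) ^ 2 = ∑ v, φ v := by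
    rw [← Finset.add_sum_erase _ _ (Finset.mem_univ w),
      ← Finset.sum_subtype (univ.erase w) (p := (· ≠ w)) (by simp)
        (fun v => (x (if v = r (b v) then b v else v) - x (if v = r (b v) then w else r (b v))) ^ 2)]
    simp only [φ, if_true, zero_add]
    exact Finset.sum_congr rfl fun v hv => (if_neg (Finset.ne_of_mem_erase hv)).symm
  rw [h1, h.sum_branches]
  simp only [φ, if_true, zero_add]
  refine Finset.sum_congr rfl fun u hu => ?_
  rw [SimpleGraph.mem_neighborFinset] at hu
  rw [← Finset.add_sum_erase _ _ (h.r_mem hu), branchEnergy]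
  congr 1
  · simp [h.r_ne u hu, h.b_r u hu]
  · refine Finset.sum_congr rfl fun v hv => ?_
    obtain ⟨h2, h3⟩ := Finset.mem_erase.1 hv
    obtain ⟨h4, h5⟩ := mem_branch.1 h3
    simp [h4, h5, h2]

theorem sum_branch (h : Spider G w b r) {u : V} (hu : G.Adj w u) (φ : V → ℝ) :
    ∑ v ∈ branch w b u, φ v = φ (r u) + ∑ v ∈ (branch w b u).erase (r u), φ v :=
  (Finset.add_sum_erase _ _ (h.r_mem hu)).symm

theorem branch_killed (h : Spider G w b r) {u : V} (hu : G.Adj w u) {x : V → ℝ}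
    (hr : x (r u) = 0) {y : ℝ} (hy : y ≤ 1) :
    y * ∑ v ∈ branch w b u, x v ^ 2 ≤ branchEnergy w b r x u := by
  have h1 : y * ∑ v ∈ branch w b u, x v ^ 2 ≤ 1 * ∑ v ∈ branch w b u, x v ^ 2 :=
    mul_le_mul_of_nonneg_right hy (by positivity)
  refine h1.trans ?_
  rw [one_mul, h.sum_branch hu, branchEnergy, hr]
  have : 0 ≤ (x u - x w) ^ 2 := by positivity
  simpa using this

theorem branch_pendant (h : Spider G w b r) {u : V} (hu : G.Adj w u) {x : V → ℝ}
    (hw : x w = 0) (hm : #(branch w b u) = 1) {y : ℝ} (hy : y ≤ 1) :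
    y * ∑ v ∈ branch w b u, x v ^ 2 ≤ branchEnergy w b r x u := by
  obtain ⟨a, ha⟩ := Finset.card_eq_one.1 hm
  have h1 : u = a := by simpa [ha] using h.u_mem hu
  have h2 : r u = a := by simpa [ha] using h.r_mem hu
  subst h1
  rw [branchEnergy, ha, h2, hw]
  simp only [sum_singleton, erase_singleton, sum_empty, sub_zero, add_zero]
  nlinarith [sq_nonneg (x u)]

theorem branch_centred (h : Spider G w b r) {u : V} (hu : G.Adj w u) {x : V → ℝ}
    (hw : x w = 0) (hr : r u = u) {y : ℝ} (h0 : 0 < y) (hy : y ≤ 1 / (#(branch w b u) + 1)) :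
    y * ∑ v ∈ branch w b u, x v ^ 2 ≤ branchEnergy w b r x u := by
  have hm : (1 : ℝ) ≤ #(branch w b u) := by exact_mod_cast h.card_pos hu
  have hc : (#((branch w b u).erase (r u)) : ℝ) = #(branch w b u) - 1 := by
    rw [Finset.card_erase_of_mem (h.r_mem hu), Nat.cast_pred (h.card_pos hu)]
  generalize hM : (#(branch w b u) : ℝ) = m at *
  have hy2 : y * (m + 1) ≤ 1 := by rwa [le_div_iff₀ (by linarith)] at hy
  have hy1 : y < 1 := by nlinarith
  have hs := star_sum_le ((branch w b u).erase (r u)) x (x (r u)) hy1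
  rw [h.sum_branch hu, branchEnergy]
  rw [hr] at *
  rw [hc] at hs
  rw [hw, sub_zero]
  have key : y + (m - 1) * (y / (1 - y)) ≤ 1 := by
    have : (m - 1) * (y / (1 - y)) = (m - 1) * y / (1 - y) := by ring
    rw [this, ← le_sub_iff_add_le', div_le_iff₀ (by linarith)]
    nlinarith
  nlinarith [sq_nonneg (x u)]

theorem branch_offset (h : Spider G w b r) {u : V} (hu : G.Adj w u) {x : V → ℝ}
    (hw : x w = 0) (hr : r u ≠ u) {y : ℝ} (h0 : 0 < y) (hy : y ≤ 1 / (2 * #(branch w b u))) :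
    y * ∑ v ∈ branch w b u, x v ^ 2 ≤ branchEnergy w b r x u := by
  have hm : (3 : ℝ) ≤ #(branch w b u) := by exact_mod_cast h.card_ge_three hu hr
  have hu' : u ∈ (branch w b u).erase (r u) := Finset.mem_erase.2 ⟨hr.symm, h.u_mem hu⟩
  have hc : (#(((branch w b u).erase (r u)).erase u) : ℝ) = #(branch w b u) - 2 := by
    have h3 := h.card_ge_three hu hr
    rw [Finset.card_erase_of_mem hu', Finset.card_erase_of_mem (h.r_mem hu), Nat.sub_sub,
      Nat.cast_sub (by omega)]
    norm_num
  generalize hM : (#(branch w b u) : ℝ) = m at *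
  have hy2 : y * (2 * m) ≤ 1 := by rwa [le_div_iff₀ (by linarith)] at hy
  have hy1 : y < 1 := by nlinarith
  have hs := star_sum_le (((branch w b u).erase (r u)).erase u) x (x (r u)) hy1
  rw [h.sum_branch hu, branchEnergy, ← Finset.add_sum_erase _ _ hu',
    ← Finset.add_sum_erase _ (fun v => (x v - x (r u)) ^ 2) hu']
  rw [hc] at hs
  rw [hw, sub_zero]
  have e1 : (1 - y) / (2 - y) * x (r u) ^ 2 ≤ x u ^ 2 + (x u - x (r u)) ^ 2 - y * x u ^ 2 := by
    have h2y : (2 - y) ≠ 0 := by linarith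
    have : x u ^ 2 + (x u - x (r u)) ^ 2 - y * x u ^ 2 - (1 - y) / (2 - y) * x (r u) ^ 2 =
        ((2 - y) * x u - x (r u)) ^ 2 / (2 - y) := by
      field_simp
      ring
    have h2 : 0 ≤ ((2 - y) * x u - x (r u)) ^ 2 / (2 - y) := by
      apply div_nonneg (by positivity); linarith
    linarith
  have key : y + (m - 2) * (y / (1 - y)) ≤ (1 - y) / (2 - y) := by
    have h1 : y + (m - 2) * (y / (1 - y)) = (y * (m - 1 - y)) / (1 - y) := by
      have : 1 - y ≠ 0 := by linarith
      field_simp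
      ring
    rw [h1, div_le_div_iff₀ (by linarith) (by linarith)]
    have h3 : y * m ≤ 1 / 2 := by linarith
    have h4 : y * (m - 1 - y) ≤ 1 / 2 - y - y ^ 2 := by nlinarith
    nlinarith
  have := mul_le_mul_of_nonneg_right key (sq_nonneg (x (r u)))
  linarith

theorem lev_kill (h : Spider G w b r) {y : ℝ} (h0 : 0 < y) (h1 : y ≤ 1) (K : Finset V)
    (hK : ∀ u, G.Adj w u → u ∈ K ∨ #(branch w b u) = 1 ∨
      (r u = u ∧ y ≤ 1 / (#(branch w b u) + 1)) ∨ (r u ≠ u ∧ y ≤ 1 / (2 * #(branch w b u)))) :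
    Lev G (1 + #K) y := by
  refine ⟨insert w (K.image r), ev, ?_, fun x hx => ?_⟩
  · refine (Finset.card_insert_le _ _).trans ?_
    have := Finset.card_image_le (s := K) (f := r)
    omega
  have hw : x w = 0 := hx w (Finset.mem_insert_self _ _)
  refine le_trans ?_ (h.sum_branchEnergy_le x)
  rw [dotProduct_self_eq, h.sum_branches, hw, zero_pow two_ne_zero, zero_add, Finset.mul_sum]
  refine Finset.sum_le_sum fun u hu => ?_
  rw [SimpleGraph.mem_neighborFinset] at hu
  rcases hK u hu with h2 | h2 | ⟨h2, h3⟩ | ⟨h2, h3⟩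
  · exact h.branch_killed hu
      (hx _ (Finset.mem_insert_of_mem (Finset.mem_image_of_mem r h2))) h1
  · exact h.branch_pendant hu hw h2 h1
  · exact h.branch_centred hu hw h2 h0 h3
  · exact h.branch_offset hu hw h2 h0 h3

end Spider

end Spiders

section SpiderCertificates

variable {V : Type} [Fintype V] [DecidableEq V] {G : SimpleGraph V} [DecidableRel G.Adj]

/-- The neighbours of `w` whose branch is not a single vertex. -/
def bigBranches (G : SimpleGraph V) [DecidableRel G.Adj] (w : V) (b : V → V) : Finset V :=
  {u ∈ G.neighborFinset w | 2 ≤ #(branch w b u)}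

/-- The largest `y` for which a branch need not be killed. -/
noncomputable def branchLevel (w : V) (b r : V → V) (u : V) : ℝ :=
  if r u = u then 1 / (#(branch w b u) + 1) else 1 / (2 * #(branch w b u))

namespace Spider

variable {w : V} {b r : V → V}

theorem mem_big {u : V} : u ∈ bigBranches G w b ↔ G.Adj w u ∧ 2 ≤ #(branch w b u) := by
  simp [bigBranches]

theorem level_mem (h : Spider G w b r) {u : V} (hu : G.Adj w u) :
    0 ≤ branchLevel w b r u ∧ branchLevel w b r u ≤ 1 := by
  have hm : (1 : ℝ) ≤ #(branch w b u) := by exact_mod_cast h.card_pos hu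
  rw [branchLevel]
  split_ifs
  · exact ⟨by positivity, by rw [div_le_one (by linarith)]; linarith⟩
  · exact ⟨by positivity, by rw [div_le_one (by linarith)]; linarith⟩

theorem le_level (h : Spider G w b r) {u : V} (hu : G.Adj w u) :
    1 / (2 * (#(branch w b u) : ℝ)) ≤ branchLevel w b r u := by
  have hm : (1 : ℝ) ≤ #(branch w b u) := by exact_mod_cast h.card_pos hu
  rw [branchLevel]
  split_ifs
  · exact one_div_le_one_div_of_le (by linarith) (by linarith)
  · exact le_rfl

theorem lev_level (h : Spider G w b r) {D : Finset V} {y : ℝ} (h0 : 0 < y) (h1 : y ≤ 1)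
    (hD : ∀ u, G.Adj w u → u ∈ D ∨ #(branch w b u) = 1 ∨ y ≤ branchLevel w b r u) :
    Lev G (1 + #{u : D | branchLevel w b r u < y}) y := by
  have hcard : #(D.filter fun u => branchLevel w b r u < y) =
      #{u : D | branchLevel w b r u < y} := by
    rw [← Finset.card_map (Function.Embedding.subtype (· ∈ D))]
    congr 1
    ext u
    simp [and_comm]
  rw [← hcard]
  refine h.lev_kill h0 h1 _ fun u hu => ?_
  by_cases hy : y ≤ branchLevel w b r u
  · right; right
    rw [branchLevel] at hy
    split_ifs at hy with hr
    · exact Or.inl ⟨hr, hy⟩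
    · exact Or.inr ⟨hr, hy⟩
  · rcases hD u hu with h2 | h2 | h2
    · exact Or.inl (Finset.mem_filter.2 ⟨h2, not_le.1 hy⟩)
    · exact Or.inr (Or.inl h2)
    · exact absurd h2 hy

theorem lev_level_big (h : Spider G w b r) {y : ℝ} (h0 : 0 < y) (h1 : y ≤ 1) :
    Lev G (1 + #{u : bigBranches G w b | branchLevel w b r u < y}) y := by
  refine h.lev_level h0 h1 fun u hu => ?_
  by_cases h2 : 2 ≤ #(branch w b u)
  · exact Or.inl (mem_big.2 ⟨hu, h2⟩)
  · have := h.card_pos hu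
    exact Or.inr (Or.inl (by omega))

theorem lev_centres (h : Spider G w b r) {a : V} (ha : G.Adj w a) (har : r a = a) :
    Lev G #(G.neighborFinset w) 1 := by
  refine ⟨(G.neighborFinset w).image r, ev, Finset.card_image_le, fun x hx => ?_⟩
  have hx0 : ∀ u, G.Adj w u → x (r u) = 0 := fun u hu =>
    hx _ (Finset.mem_image_of_mem r ((SimpleGraph.mem_neighborFinset _ _ _).2 hu))
  refine le_trans ?_ (h.sum_branchEnergy_le x)
  have hmem := (SimpleGraph.mem_neighborFinset _ _ _).2 ha
  rw [one_mul, dotProduct_self_eq, h.sum_branches, ← Finset.add_sum_erase _ _ hmem,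
    ← Finset.add_sum_erase _ (fun u => branchEnergy w b r x u) hmem, ← add_assoc]
  refine add_le_add ?_ (Finset.sum_le_sum fun u hu => ?_)
  · have h0 := hx0 a ha
    rw [h.sum_branch ha, branchEnergy, h0]
    rw [har] at *
    simp [h0]
  · have hu := (SimpleGraph.mem_neighborFinset _ _ _).1 (Finset.mem_of_mem_erase hu)
    have := h.branch_killed hu (hx0 u hu) le_rfl
    rwa [one_mul] at this

theorem exists_leaves (h : Spider G w b r) : ∃ l : V → V, ∀ u ∈ bigBranches G w b,
    l u ∈ branch w b u ∧ l u ≠ u ∧ l u ≠ r u := by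
  have : ∀ u, ∃ l, u ∈ bigBranches G w b → l ∈ branch w b u ∧ l ≠ u ∧ l ≠ r u := by
    intro u
    by_cases hu : u ∈ bigBranches G w b
    · obtain ⟨h1, h2⟩ := mem_big.1 hu
      by_cases hr : r u = u
      · obtain ⟨v, hv, hvu⟩ := Finset.exists_mem_ne h2 u
        exact ⟨v, fun _ => ⟨hv, hvu, by rwa [hr]⟩⟩
      · obtain ⟨v, h3, h4, h5, h6⟩ := h.third u h1 hr
        exact ⟨v, fun _ => ⟨mem_branch.2 ⟨h3, h4⟩, h5, h6⟩⟩
    · exact ⟨u, fun h => absurd h hu⟩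
  choose l hl using this
  exact ⟨l, hl⟩

theorem matched_big (h : Spider G w b r) {l : V → V} (hl : ∀ u ∈ bigBranches G w b,
    l u ∈ branch w b u ∧ l u ≠ u ∧ l u ≠ r u) :
    Matched G ((bigBranches G w b).image r) (fun v => l (b v)) where
  adj := by
    intro v hv
    obtain ⟨u, hu, rfl⟩ := Finset.mem_image.1 hv
    have hu' := mem_big.1 hu
    obtain ⟨h1, h2, h3⟩ := hl u hu
    obtain ⟨h4, h5⟩ := mem_branch.1 h1
    rw [h.b_r u hu'.1]
    have := h.adj_r (l u) h4 (by rwa [h5])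
    rw [h5] at this
    exact this.symm
  inj := by
    intro v hv v' hv' e
    obtain ⟨u, hu, rfl⟩ := Finset.mem_image.1 (Finset.mem_coe.1 hv)
    obtain ⟨u', hu', rfl⟩ := Finset.mem_image.1 (Finset.mem_coe.1 hv')
    simp only [h.b_r u (mem_big.1 hu).1, h.b_r u' (mem_big.1 hu').1] at e
    have h1 := (mem_branch.1 (hl u hu).1).2
    have h2 := (mem_branch.1 (hl u' hu').1).2
    rw [← h1, e, h2]
  notMem := by
    intro v hv hv'
    obtain ⟨u, hu, rfl⟩ := Finset.mem_image.1 hv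
    obtain ⟨u', hu', e⟩ := Finset.mem_image.1 hv'
    rw [h.b_r u (mem_big.1 hu).1] at e
    have h1 := (mem_branch.1 (hl u hu).1).2
    rw [← e, h.b_r u' (mem_big.1 hu').1] at h1
    rw [h1] at e
    exact (hl u hu).2.2 e.symm

theorem card_image_big (h : Spider G w b r) :
    #((bigBranches G w b).image r) = #(bigBranches G w b) := by
  refine Finset.card_image_of_injOn fun u hu v hv e => ?_
  rw [← h.b_r u (mem_big.1 hu).1, e, h.b_r v (mem_big.1 hv).1]

theorem w_notMem_image (h : Spider G w b r) : w ∉ (bigBranches G w b).image r := by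
  intro hw
  obtain ⟨u, hu, e⟩ := Finset.mem_image.1 hw
  exact h.r_ne u (mem_big.1 hu).1 e

theorem matched_insert (h : Spider G w b r) {l : V → V} (hl : ∀ u ∈ bigBranches G w b,
    l u ∈ branch w b u ∧ l u ≠ u ∧ l u ≠ r u) {p : V} (hp : G.Adj w p)
    (hp' : #(branch w b p) = 1 ∨ r p ≠ p) :
    Matched G (insert w ((bigBranches G w b).image r))
      (fun v => if v = w then p else l (b v)) := by
  have hM := h.matched_big hl
  have hpR : p ∉ (bigBranches G w b).image r := by
    intro hp2
    obtain ⟨u, hu, e⟩ := Finset.mem_image.1 hp2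
    have h1 := h.b_r u (mem_big.1 hu).1
    rw [e, h.b_self p hp] at h1
    subst h1
    rcases hp' with h2 | h2
    · have := (mem_big.1 hu).2
      omega
    · exact h2 e
  have hpl : ∀ v ∈ (bigBranches G w b).image r, l (b v) ≠ p := by
    intro v hv e
    obtain ⟨u, hu, rfl⟩ := Finset.mem_image.1 hv
    rw [h.b_r u (mem_big.1 hu).1] at e
    have h1 := (mem_branch.1 (hl u hu).1).2
    rw [e, h.b_self p hp] at h1
    subst h1
    exact (hl p hu).2.1 e
  have hne : ∀ v ∈ (bigBranches G w b).image r, v ≠ w := fun v hv e =>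
    h.w_notMem_image (e ▸ hv)
  refine ⟨?_, ?_, ?_⟩
  · intro v hv
    rcases Finset.mem_insert.1 hv with rfl | hv
    · simpa using hp
    · simpa only [if_neg (hne v hv)] using hM.adj v hv
  · intro v hv v' hv' e
    rw [Finset.mem_coe] at hv hv'
    dsimp only at e
    rcases Finset.mem_insert.1 hv with rfl | hv <;> rcases Finset.mem_insert.1 hv' with rfl | hv'
    · rfl
    · rw [if_pos rfl, if_neg (hne v' hv')] at e
      exact absurd e.symm (hpl v' hv')
    · rw [if_pos rfl, if_neg (hne v hv)] at e
      exact absurd e (hpl v hv)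
    · rw [if_neg (hne v hv), if_neg (hne v' hv')] at e
      exact hM.inj hv hv' e
  · intro v hv
    rw [Finset.mem_insert, not_or]
    rcases Finset.mem_insert.1 hv with rfl | hv
    · simp only [if_true]
      exact ⟨hp.ne', hpR⟩
    · rw [if_neg (hne v hv)]
      refine ⟨fun e => ?_, hM.notMem v hv⟩
      obtain ⟨u, hu, rfl⟩ := Finset.mem_image.1 hv
      rw [h.b_r u (mem_big.1 hu).1] at e
      exact (mem_branch.1 (hl u hu).1).1 e

theorem card_insert_big (h : Spider G w b r) :
    #(insert w ((bigBranches G w b).image r)) = #(bigBranches G w b) + 1 := by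
  rw [Finset.card_insert_of_notMem h.w_notMem_image, h.card_image_big]

theorem lev_top (h : Spider G w b r) {p : V} (hp : G.Adj w p)
    (hp' : #(branch w b p) = 1 ∨ r p ≠ p) :
    Lev G (Fintype.card V - (#(bigBranches G w b) + 1)) 2 := by
  obtain ⟨l, hl⟩ := h.exists_leaves
  rw [← h.card_insert_big]
  exact (h.matched_insert hl hp hp').lev

theorem lev_middle (h : Spider G w b r) {p u : V} (hp : G.Adj w p)
    (hp' : #(branch w b p) = 1 ∨ r p ≠ p) (hu : G.Adj w u) (hur : r u ≠ u) (hup : u ≠ p) :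
    Lev G (Fintype.card V - (#(bigBranches G w b) + 1) - 1) (11 / 8) := by
  obtain ⟨l, hl⟩ := h.exists_leaves
  rw [← h.card_insert_big]
  have hu' : u ∈ bigBranches G w b :=
    mem_big.2 ⟨hu, by have := h.card_ge_three hu hur; omega⟩
  refine (h.matched_insert hl hp hp').lev_mid (b := w) (c := r u) (o := u)
    (Finset.mem_insert_self _ _)
    (Finset.mem_insert_of_mem (Finset.mem_image_of_mem r hu')) (h.r_ne u hu).symm ?_ ?_ hu.symm ?_
  · rw [Finset.mem_insert, not_or]
    refine ⟨hu.ne', fun hm => ?_⟩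
    obtain ⟨v, hv, e⟩ := Finset.mem_image.1 hm
    have h1 := h.b_r v (mem_big.1 hv).1
    rw [e, h.b_self u hu] at h1
    exact hur (h1 ▸ e)
  · intro hm
    obtain ⟨v, hv, e⟩ := Finset.mem_image.1 hm
    rcases Finset.mem_insert.1 hv with rfl | hv
    · rw [if_pos rfl] at e
      exact hup e.symm
    · have hvw : v ≠ w := fun e => h.w_notMem_image (e ▸ hv)
      rw [if_neg hvw] at e
      obtain ⟨t, ht, rfl⟩ := Finset.mem_image.1 hv
      rw [h.b_r t (mem_big.1 ht).1] at e
      have h1 := (mem_branch.1 (hl t ht).1).2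
      rw [e, h.b_self u hu] at h1
      subst h1
      exact (hl u ht).2.1 e
  · have := h.adj_r u hu.ne' (by rw [h.b_self u hu]; exact hur.symm)
    rwa [h.b_self u hu] at this

theorem sum_big_le (h : Spider G w b r) :
    1 + ∑ u ∈ bigBranches G w b, #(branch w b u) ≤ Fintype.card V := by
  rw [h.card_eq]
  have : ∑ u ∈ bigBranches G w b, #(branch w b u) ≤ ∑ u ∈ G.neighborFinset w, #(branch w b u) :=
    Finset.sum_le_sum_of_subset (Finset.filter_subset _ _)
  omega

theorem sum_big_add_one_le (h : Spider G w b r) {p : V} (hp : G.Adj w p)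
    (hp' : #(branch w b p) = 1) :
    2 + ∑ u ∈ bigBranches G w b, #(branch w b u) ≤ Fintype.card V := by
  rw [h.card_eq]
  have hpb : p ∉ bigBranches G w b := fun hm => by
    have := (mem_big.1 hm).2
    omega
  have : ∑ u ∈ insert p (bigBranches G w b), #(branch w b u) ≤
      ∑ u ∈ G.neighborFinset w, #(branch w b u) :=
    Finset.sum_le_sum_of_subset (by
      intro u hu
      rcases Finset.mem_insert.1 hu with rfl | hu
      · exact (SimpleGraph.mem_neighborFinset _ _ _).2 hp
      · exact Finset.filter_subset _ _ hu)
  rw [Finset.sum_insert hpb, hp'] at this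
  omega

theorem two_mul_card_big_le : 2 * #(bigBranches G w b) ≤ ∑ u ∈ bigBranches G w b, #(branch w b u) := by
  rw [mul_comm, ← smul_eq_mul, ← Finset.sum_const]
  exact Finset.sum_le_sum fun u hu => (mem_big.1 hu).2

theorem cert_insert_mid (h : Spider G w b r) {p u : V} (hp : G.Adj w p)
    (hp' : #(branch w b p) = 1 ∨ r p ≠ p) (hu : G.Adj w u) (hur : r u ≠ u) (hup : u ≠ p)
    (hn : 2 * #(bigBranches G w b) + 3 ≤ Fintype.card V)
    {ε : ℝ} (hε0 : 0 ≤ ε) (hε : ε ≤ 1 / 3)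
    (hineq : (#(bigBranches G w b) + 1) * ε ≤
      3 / 8 + ∑ v ∈ bigBranches G w b, branchLevel w b r v) :
    Cert G (2 - ε) (Fintype.card V * (1 - ε)) := by
  refine cert_mid (ι := bigBranches G w b) (z := fun v => branchLevel w b r v)
    (k := #(bigBranches G w b) + 1) (fun v => h.level_mem (mem_big.1 v.2).1) hε hε0 ?_
    (fun y => h.lev_level_big) (h.lev_middle hp hp' hu hur hup) (h.lev_top hp hp') ?_
  · rw [Fintype.card_coe]; omega
  · rw [Fintype.card_coe, Finset.sum_coe_sort _ fun v => branchLevel w b r v]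
    push_cast
    linarith

theorem cert_insert (h : Spider G w b r) {p : V} (hp : G.Adj w p)
    (hp' : #(branch w b p) = 1 ∨ r p ≠ p)
    (hn : 2 * #(bigBranches G w b) + 2 ≤ Fintype.card V)
    {ε : ℝ} (hε0 : 0 ≤ ε) (hε : ε ≤ 1 / 3)
    (hineq : (#(bigBranches G w b) + 1) * ε ≤ ∑ v ∈ bigBranches G w b, branchLevel w b r v) :
    Cert G (2 - ε) (Fintype.card V * (1 - ε)) := by
  refine cert_no_mid (ι := bigBranches G w b) (z := fun v => branchLevel w b r v)
    (k := #(bigBranches G w b) + 1) (fun v => h.level_mem (mem_big.1 v.2).1) hε hε0 ?_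
    (fun y => h.lev_level_big) (h.lev_top hp hp') ?_
  · rw [Fintype.card_coe]; omega
  · rw [Fintype.card_coe, Finset.sum_coe_sort _ fun v => branchLevel w b r v]
    push_cast
    linarith

theorem big_eq (hP : ∀ u, G.Adj w u → #(branch w b u) ≠ 1) (h : Spider G w b r) :
    bigBranches G w b = G.neighborFinset w := by
  refine Finset.filter_true_of_mem fun u hu => ?_
  have hu := (SimpleGraph.mem_neighborFinset _ _ _).1 hu
  have := h.card_pos hu
  have := hP u hu
  omega

theorem cert_mixed (h : Spider G w b r) (hP : ∀ u, G.Adj w u → #(branch w b u) ≠ 1)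
    {p a : V} (hp : G.Adj w p) (hp' : r p ≠ p) (ha : G.Adj w a) (ha' : r a = a)
    {ε : ℝ} (hε0 : 0 ≤ ε) (hε : ε ≤ 1 / 3) (hεn : ε * Fintype.card V ≤ 2) :
    Cert G (2 - ε) (Fintype.card V * (1 - ε)) := by
  have hN := h.big_eq hP
  have hpB : p ∈ bigBranches G w b :=
    mem_big.2 ⟨hp, by have := h.card_ge_three hp hp'; omega⟩
  have hd : 1 ≤ #(bigBranches G w b) := Finset.card_pos.2 ⟨p, hpB⟩
  have hn : 2 * #(bigBranches G w b) + 2 ≤ Fintype.card V := by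
    have h1 := h.sum_big_le
    rw [← Finset.add_sum_erase _ _ hpB] at h1
    have h2 : 2 * #((bigBranches G w b).erase p) ≤
        ∑ u ∈ (bigBranches G w b).erase p, #(branch w b u) := by
      rw [mul_comm, ← smul_eq_mul, ← Finset.sum_const]
      exact Finset.sum_le_sum fun u hu => (mem_big.1 (Finset.mem_of_mem_erase hu)).2
    rw [Finset.card_erase_of_mem hpB] at h2
    have := h.card_ge_three hp hp'
    omega
  have hlev := h.lev_centres ha ha'
  rw [← hN] at hlev
  refine cert_no_mid (ι := Fin (#(bigBranches G w b) - 1)) (z := fun _ => 0)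
    (k := #(bigBranches G w b) + 1) (fun _ => by norm_num) hε hε0 ?_
    (fun y h0 h1 => ?_) (h.lev_top hp (Or.inr hp')) ?_
  · rw [Fintype.card_fin]; omega
  · have : #{u : Fin (#(bigBranches G w b) - 1) | (0 : ℝ) < y} = #(bigBranches G w b) - 1 := by
      simp [h0]
    rw [this, Nat.add_sub_cancel' hd]
    exact hlev.mono le_rfl h1
  · have h3 : (2 : ℝ) * #(bigBranches G w b) + 2 ≤ Fintype.card V := by exact_mod_cast hn
    rw [Fintype.card_fin, Nat.cast_sub hd, Finset.sum_const_zero]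
    push_cast
    nlinarith

theorem lev_big_top (h : Spider G w b r) : Lev G (Fintype.card V - #(bigBranches G w b)) 2 := by
  obtain ⟨l, hl⟩ := h.exists_leaves
  rw [← h.card_image_big]
  exact (h.matched_big hl).lev

theorem lev_big_middle (h : Spider G w b r) (hA : ∀ u, G.Adj w u → r u = u) {u v : V}
    (hu : u ∈ bigBranches G w b) (hv : v ∈ bigBranches G w b) (huv : u ≠ v) :
    Lev G (Fintype.card V - #(bigBranches G w b) - 1) (11 / 8) := by
  obtain ⟨l, hl⟩ := h.exists_leaves
  rw [← h.card_image_big]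
  have hu' := (mem_big.1 hu).1
  have hv' := (mem_big.1 hv).1
  refine (h.matched_big hl).lev_mid (b := r u) (c := r v) (o := w)
    (Finset.mem_image_of_mem r hu) (Finset.mem_image_of_mem r hv)
    (by rwa [hA u hu', hA v hv']) h.w_notMem_image ?_ (by rwa [hA u hu']) (by rwa [hA v hv'])
  intro hm
  obtain ⟨s, hs, e⟩ := Finset.mem_image.1 hm
  obtain ⟨t, ht, rfl⟩ := Finset.mem_image.1 hs
  rw [h.b_r t (mem_big.1 ht).1] at e
  exact (mem_branch.1 (hl t ht).1).1 e

theorem cert_centred (h : Spider G w b r) (hP : ∀ u, G.Adj w u → #(branch w b u) ≠ 1)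
    (hA : ∀ u, G.Adj w u → r u = u) {i : V} (hi : i ∈ bigBranches G w b)
    (hmin : ∀ u ∈ bigBranches G w b, #(branch w b i) ≤ #(branch w b u))
    (hd : 2 ≤ #(bigBranches G w b)) {ε : ℝ} (hε0 : 0 ≤ ε) (hε : ε ≤ 1 / 3)
    (hineq : #(bigBranches G w b) * ε ≤
      3 / 8 + ∑ v ∈ (bigBranches G w b).erase i, branchLevel w b r v) :
    Cert G (2 - ε) (Fintype.card V * (1 - ε)) := by
  have hN := h.big_eq hP
  have hlev := h.lev_centres (mem_big.1 hi).1 (hA i (mem_big.1 hi).1)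
  rw [← hN] at hlev
  obtain ⟨j, hj, hji⟩ := Finset.exists_mem_ne hd i
  have hcard := Finset.card_erase_of_mem hi
  refine cert_mid (ι := (bigBranches G w b).erase i) (z := fun v => branchLevel w b r v)
    (k := #(bigBranches G w b))
    (fun v => h.level_mem (mem_big.1 (Finset.mem_of_mem_erase v.2)).1) hε hε0 ?_
    (fun y h0 h1 => ?_) (h.lev_big_middle hA hj hi hji) h.lev_big_top ?_
  · rw [Fintype.card_coe]
    have h1 := h.sum_big_le
    have h2 := two_mul_card_big_le (G := G) (w := w) (b := b)
    omega
  · by_cases hall : ∀ u : (bigBranches G w b).erase i, branchLevel w b r u < y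
    · rw [Finset.filter_true_of_mem fun u _ => hall u, card_univ, Fintype.card_coe, hcard]
      exact hlev.mono (by omega) h1
    · push Not at hall
      obtain ⟨⟨u, hu⟩, huy⟩ := hall
      refine h.lev_level h0 h1 fun v hv => ?_
      by_cases hvi : v = i
      · right; right
        subst hvi
        refine huy.trans ?_
        have hu' := Finset.mem_of_mem_erase hu
        rw [branchLevel, branchLevel, if_pos (hA v hv), if_pos (hA u (mem_big.1 hu').1)]
        have : (#(branch w b v) : ℝ) ≤ #(branch w b u) := by exact_mod_cast hmin u hu'
        exact one_div_le_one_div_of_le (by positivity) (by linarith)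
      · refine Or.inl (Finset.mem_erase.2 ⟨hvi, ?_⟩)
        rw [hN]
        exact (SimpleGraph.mem_neighborFinset _ _ _).2 hv
  · rw [Fintype.card_coe, Finset.sum_coe_sort _ fun v => branchLevel w b r v, hcard,
      Nat.cast_sub (by omega)]
    push_cast
    linarith

end Spider

end SpiderCertificates

section SpiderArithmetic

variable {V : Type} [Fintype V] [DecidableEq V] {G : SimpleGraph V} [DecidableRel G.Adj]

/-- Some vertex is adjacent to all others. -/
def IsStar (G : SimpleGraph V) : Prop := ∃ r, ∀ x, x ≠ r → G.Adj r x

/-- Two adjacent vertices, neither of them a leaf, dominate the graph. -/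
def IsDoubleStar (G : SimpleGraph V) : Prop :=
  ∃ w r, G.Adj w r ∧ (∃ p, p ≠ r ∧ G.Adj w p) ∧ (∃ q, q ≠ w ∧ G.Adj r q) ∧
    ∀ x, x ≠ w → x ≠ r → G.Adj w x ∨ G.Adj r x

theorem mul_le_two_mul_div {ε n k : ℝ} (hn : 0 < n) (hk : 0 ≤ k) (h : ε * n ≤ 2) :
    k * ε ≤ 2 * k / n := by
  rw [le_div_iff₀ hn]
  nlinarith

namespace Spider

variable {w : V} {b r : V → V}

theorem sum_level_ge (h : Spider G w b r) {S : Finset V} (hS : S ⊆ bigBranches G w b) {M : ℝ}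
    (hM : ∑ u ∈ S, (#(branch w b u) : ℝ) ≤ M) (h0 : 0 < ∑ u ∈ S, (#(branch w b u) : ℝ)) :
    (#S : ℝ) ^ 2 / (2 * M) ≤ ∑ u ∈ S, branchLevel w b r u := by
  have h1 := Finset.sq_sum_div_le_sum_sq_div S (fun _ => (1 : ℝ))
    (g := fun u => 2 * (#(branch w b u) : ℝ)) (fun u hu => by
      have : 0 < #(branch w b u) := h.card_pos (mem_big.1 (hS hu)).1
      positivity)
  rw [← Finset.mul_sum] at h1
  simp only [Finset.sum_const, nsmul_eq_mul, mul_one, one_pow] at h1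
  calc _ ≤ (#S : ℝ) ^ 2 / (2 * ∑ u ∈ S, (#(branch w b u) : ℝ)) := by gcongr
    _ ≤ _ := h1.trans (Finset.sum_le_sum fun u hu => h.le_level (mem_big.1 (hS hu)).1)

theorem sum_level_ge_of_centred (h : Spider G w b r) (hA : ∀ u, G.Adj w u → r u = u) {M : ℝ}
    (hM : ∑ u ∈ bigBranches G w b, (#(branch w b u) : ℝ) ≤ M)
    (h0 : 0 < #(bigBranches G w b)) :
    (#(bigBranches G w b) : ℝ) ^ 2 / (M + #(bigBranches G w b)) ≤
      ∑ u ∈ bigBranches G w b, branchLevel w b r u := by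
  have h1 := Finset.sq_sum_div_le_sum_sq_div (bigBranches G w b) (fun _ => (1 : ℝ))
    (g := fun u => (#(branch w b u) : ℝ) + 1) (fun u hu => by positivity)
  simp only [Finset.sum_const, nsmul_eq_mul, mul_one, one_pow, Finset.sum_add_distrib] at h1
  have h2 : (0 : ℝ) < #(bigBranches G w b) := by exact_mod_cast h0
  calc _ ≤ (#(bigBranches G w b) : ℝ) ^ 2 /
        (∑ u ∈ bigBranches G w b, (#(branch w b u) : ℝ) + #(bigBranches G w b)) := by
        gcongr
    _ ≤ _ := h1.trans (Finset.sum_le_sum fun u hu => by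
        rw [branchLevel, if_pos (hA u (mem_big.1 hu).1)])

theorem centre_of_pendant (h : Spider G w b r) {p : V} (hp : G.Adj w p)
    (hp' : #(branch w b p) = 1) : r p = p := by
  by_contra hr
  have := h.card_ge_three hp hr
  omega

theorem eq_of_pendant (h : Spider G w b r) {v : V} (hv : v ≠ w)
    (hp' : #(branch w b (b v)) = 1) : v = b v := by
  have h1 : v ∈ branch w b (b v) := mem_branch.2 ⟨hv, rfl⟩
  have h2 := h.u_mem (h.adj_b v hv)
  exact Finset.card_le_one.1 hp'.le _ h1 _ h2

theorem mem_big_of_offset (h : Spider G w b r) {u : V} (hu : G.Adj w u) (hr : r u ≠ u) :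
    u ∈ bigBranches G w b :=
  mem_big.2 ⟨hu, by have := h.card_ge_three hu hr; omega⟩

theorem card_eq_one (h : Spider G w b r) {u : V} (hu : G.Adj w u)
    (hD : u ∉ bigBranches G w b) : #(branch w b u) = 1 := by
  have := h.card_pos hu
  by_contra h1
  exact hD (mem_big.2 ⟨hu, by omega⟩)

/-- Many branches, all nontrivial and attached at their centres. -/
theorem cert_of_all_centred (h : Spider G w b r) (hP : ∀ u, G.Adj w u → #(branch w b u) ≠ 1)
    (hA : ∀ u, G.Adj w u → r u = u) (hd : 3 ≤ #(bigBranches G w b)) {ε : ℝ} (hε0 : 0 ≤ ε)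
    (hε : ε ≤ 1 / 3) (hεn : ε * Fintype.card V ≤ 2) :
    Cert G (2 - ε) (Fintype.card V * (1 - ε)) := by
  obtain ⟨i, hi, hmin⟩ := Finset.exists_min_image (bigBranches G w b) (fun u => #(branch w b u))
    (Finset.card_pos.1 (by omega))
  have h1 := h.sum_big_le
  have hs := Finset.add_sum_erase _ (fun u => #(branch w b u)) hi
  have hc := Finset.card_erase_of_mem hi
  have h2 : #((bigBranches G w b).erase i) * 2 ≤
      ∑ u ∈ (bigBranches G w b).erase i, #(branch w b u) :=
    Finset.card_nsmul_le_sum _ _ _ fun u hu => (mem_big.1 (Finset.mem_of_mem_erase hu)).2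
  have h3 := (mem_big.1 hi).2
  have hdR : (3 : ℝ) ≤ #(bigBranches G w b) := by exact_mod_cast hd
  have hnd : 2 * (#(bigBranches G w b) : ℝ) + 1 ≤ Fintype.card V := by
    exact_mod_cast (show 2 * #(bigBranches G w b) + 1 ≤ Fintype.card V by omega)
  have h4 := h.sum_level_ge (S := (bigBranches G w b).erase i) (Finset.erase_subset _ _)
    (M := Fintype.card V - 3)
    (by
      have : 3 + ∑ u ∈ (bigBranches G w b).erase i, #(branch w b u) ≤ Fintype.card V := by omega
      have : 3 + ∑ u ∈ (bigBranches G w b).erase i, (#(branch w b u) : ℝ) ≤ Fintype.card V := by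
        exact_mod_cast this
      linarith)
    (by exact_mod_cast (show 0 < ∑ u ∈ (bigBranches G w b).erase i, #(branch w b u) by omega))
  rw [hc, Nat.cast_pred (by omega)] at h4
  refine h.cert_centred hP hA hi hmin (by omega) hε0 hε ?_
  generalize (#(bigBranches G w b) : ℝ) = d at *
  generalize (Fintype.card V : ℝ) = n at *
  refine (mul_le_two_mul_div (by linarith) (by linarith) hεn).trans (le_trans ?_
    (add_le_add_right h4 _))
  rw [div_add_div _ _ (by norm_num) (by linarith : (2 * (n - 3)) ≠ 0 ) , div_le_div_iff₀ (by linarith) (by linarith)]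
  have h5 : 0 ≤ (d - 3) * (4 * n * (d - 3) + 48) := by
    have : 0 ≤ n * (d - 3) := mul_nonneg (by linarith) (by linarith)
    exact mul_nonneg (by linarith) (by linarith)
  nlinarith [sq_nonneg (6 * n - 41)]

/-- Many branches attached at their centres, and a pendant vertex. -/
theorem cert_of_centred_pendant (h : Spider G w b r) {p : V} (hp : G.Adj w p)
    (hp' : #(branch w b p) = 1) (hA : ∀ u, G.Adj w u → r u = u)
    (hd : 3 ≤ #(bigBranches G w b)) {ε : ℝ} (hε0 : 0 ≤ ε)
    (hε : ε ≤ 1 / 3) (hεn : ε * Fintype.card V ≤ 2) :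
    Cert G (2 - ε) (Fintype.card V * (1 - ε)) := by
  have h1 := h.sum_big_add_one_le hp hp'
  have h2 := two_mul_card_big_le (G := G) (w := w) (b := b)
  have hdR : (3 : ℝ) ≤ #(bigBranches G w b) := by exact_mod_cast hd
  have hnd : 2 * (#(bigBranches G w b) : ℝ) + 2 ≤ Fintype.card V := by
    exact_mod_cast (show 2 * #(bigBranches G w b) + 2 ≤ Fintype.card V by omega)
  have h4 := h.sum_level_ge_of_centred hA (M := Fintype.card V - 2)
    (by
      have : 2 + ∑ u ∈ bigBranches G w b, (#(branch w b u) : ℝ) ≤ Fintype.card V := by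
        exact_mod_cast h1
      linarith) (by omega)
  refine h.cert_insert hp (Or.inl hp') (by omega) hε0 hε ?_
  generalize (#(bigBranches G w b) : ℝ) = d at *
  generalize (Fintype.card V : ℝ) = n at *
  refine (mul_le_two_mul_div (by linarith) (by linarith) hεn).trans (le_trans ?_ h4)
  rw [div_le_div_iff₀ (by linarith) (by linarith)]
  have h5 : 0 ≤ d * (d - 3) * n := by
    have : 0 ≤ d - 3 := by linarith
    have : 0 ≤ d := by linarith
    have : 0 ≤ n := by linarith
    positivity
  have h6 : 0 ≤ (d - 2) * (n - (2 * d + 2)) := mul_nonneg (by linarith) (by linarith)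
  nlinarith

/-- Many branches, one of them attached away from its centre. -/
theorem cert_of_offset (h : Spider G w b r) {p u : V} (hp : G.Adj w p)
    (hp' : #(branch w b p) = 1 ∨ r p ≠ p) (hu : G.Adj w u) (hur : r u ≠ u) (hup : u ≠ p)
    (hn : 2 * #(bigBranches G w b) + 3 ≤ Fintype.card V)
    (hd : 3 ≤ #(bigBranches G w b)) {ε : ℝ} (hε0 : 0 ≤ ε)
    (hε : ε ≤ 1 / 3) (hεn : ε * Fintype.card V ≤ 2) :
    Cert G (2 - ε) (Fintype.card V * (1 - ε)) := by
  have h1 := h.sum_big_le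
  have h2 := two_mul_card_big_le (G := G) (w := w) (b := b)
  have hdR : (3 : ℝ) ≤ #(bigBranches G w b) := by exact_mod_cast hd
  have hnd : 2 * (#(bigBranches G w b) : ℝ) + 3 ≤ Fintype.card V := by exact_mod_cast hn
  have h4 := h.sum_level_ge (S := bigBranches G w b) subset_rfl
    (M := Fintype.card V - 1)
    (by
      have : 1 + ∑ u ∈ bigBranches G w b, (#(branch w b u) : ℝ) ≤ Fintype.card V := by
        exact_mod_cast h1
      linarith)
    (by exact_mod_cast (show 0 < ∑ u ∈ bigBranches G w b, #(branch w b u) by omega))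
  refine h.cert_insert_mid hp hp' hu hur hup hn hε0 hε ?_
  generalize (#(bigBranches G w b) : ℝ) = d at *
  generalize (Fintype.card V : ℝ) = n at *
  refine (mul_le_two_mul_div (by linarith) (by linarith) hεn).trans (le_trans ?_
    (add_le_add_right h4 _))
  rw [div_add_div _ _ (by norm_num) (by linarith : (2 * (n - 1)) ≠ 0), div_le_div_iff₀ (by linarith) (by linarith)]
  have h5 : 0 ≤ (d - 3) * (4 * n * (d - 1) + 16) := by
    have : 0 ≤ n * (d - 1) := mul_nonneg (by linarith) (by linarith)
    exact mul_nonneg (by linarith) (by linarith)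
  nlinarith

/-- One branch attached at its centre, one away from it, and pendant vertices. -/
theorem cert_of_centred_offset (h : Spider G w b r) {p u v : V} (hp : G.Adj w p)
    (hp' : #(branch w b p) = 1) (hur : r u ≠ u) (hvr : r v = v) (huv : u ≠ v)
    (hD : bigBranches G w b = {u, v}) {ε : ℝ} (hε0 : 0 ≤ ε)
    (hε : ε ≤ 1 / 3) (hεn : ε * Fintype.card V ≤ 2) :
    Cert G (2 - ε) (Fintype.card V * (1 - ε)) := by
  have h1 := h.sum_big_add_one_le hp hp'
  have hu : u ∈ bigBranches G w b := by simp [hD]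
  have hv : v ∈ bigBranches G w b := by simp [hD]
  have hu' := (mem_big.1 hu).1
  have hm := h.card_ge_three hu' hur
  have hm' := (mem_big.1 hv).2
  have hc : #(bigBranches G w b) = 2 := by rw [hD, Finset.card_pair huv]
  rw [hD, Finset.sum_pair huv] at h1
  refine h.cert_insert_mid hp (Or.inl hp') hu' hur (fun e => ?_) (by omega) hε0 hε ?_
  · subst e; omega
  rw [hc, hD, Finset.sum_pair huv, branchLevel, branchLevel, if_neg hur, if_pos hvr]
  have h1R : 2 + ((#(branch w b u) : ℝ) + #(branch w b v)) ≤ Fintype.card V := by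
    exact_mod_cast h1
  have hmR : (3 : ℝ) ≤ #(branch w b u) := by exact_mod_cast hm
  have hmR' : (2 : ℝ) ≤ #(branch w b v) := by exact_mod_cast hm'
  generalize (#(branch w b u) : ℝ) = x at *
  generalize (#(branch w b v) : ℝ) = y at *
  generalize (Fintype.card V : ℝ) = n at *
  refine (mul_le_two_mul_div (by linarith) (by norm_num) hεn).trans ?_
  have h2 : 29 / 10 / (x + y + 1) ≤ 1 / (2 * x) + 1 / (y + 1) := by
    rw [div_add_div _ _ (by linarith) (by linarith), div_le_div_iff₀ (by linarith) (by nlinarith)]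
    nlinarith [sq_nonneg (y + 1 - 7 / 5 * x), sq_nonneg x]
  refine le_trans ?_ (add_le_add_right h2 _)
  calc 2 * (((2 : ℕ) : ℝ) + 1) / n ≤ 6 / (2 + (x + y)) := by
        push_cast
        norm_num
        exact div_le_div_of_nonneg_left (by norm_num) (by linarith) h1R
    _ ≤ _ := by
        rw [div_add_div _ _ (by norm_num) (by linarith), div_le_div_iff₀ (by linarith) (by linarith)]
        nlinarith [mul_nonneg (by linarith : (0 : ℝ) ≤ x + y + 1 - 6) (by linarith : (0 : ℝ) ≤ x + y + 1 - 6)]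

end Spider

end SpiderArithmetic

section SmallSpiders

variable {V : Type} [Fintype V] [DecidableEq V] {G : SimpleGraph V} [DecidableRel G.Adj]

theorem lev_one_threshold {y₁ : ℝ} (h1 : Lev G 1 y₁) (h2 : Lev G 2 1) (y : ℝ) (hy : y ≤ 1) :
    Lev G (1 + #{u : Unit | (fun _ => y₁) u < y}) y := by
  by_cases hy1 : y ≤ y₁
  · exact h1.mono (by omega) hy1
  · refine h2.mono ?_ hy
    simp [not_le.1 hy1]

theorem lev_pair_threshold {y₂ y₃ : ℝ} (h2 : Lev G 1 y₂) (h3 : Lev G 2 y₃) (h4 : Lev G 3 1)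
    (y : ℝ) (hy : y ≤ 1) :
    Lev G (1 + #{u : Bool | (fun u => bif u then y₂ else max y₂ y₃) u < y}) y := by
  by_cases hy2 : y ≤ y₂
  · exact h2.mono (by omega) hy2
  · rw [not_le] at hy2
    by_cases hy3 : y ≤ y₃
    · refine h3.mono ?_ hy3
      have : 0 < #{u : Bool | (fun u => bif u then y₂ else max y₂ y₃) u < y} :=
        Finset.card_pos.2 ⟨true, by simp [hy2]⟩
      omega
    · rw [not_le] at hy3
      refine h4.mono ?_ hy
      have : ({u : Bool | (fun u => bif u then y₂ else max y₂ y₃) u < y} : Finset Bool) = univ := by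
        ext u
        cases u <;> simp [hy2, hy3]
      rw [this]
      simp

theorem cert_pair {y₂ y₃ : ℝ} (h20 : 0 ≤ y₂) (h21 : y₂ ≤ 1) (h31 : y₃ ≤ 1)
    (h2 : Lev G 1 y₂) (h3 : Lev G 2 y₃) (h4 : Lev G 3 1) {k : ℕ} {ε : ℝ} (hε : ε ≤ 1 / 3)
    (hε0 : 0 ≤ ε) (hn : k + 3 ≤ Fintype.card V) (htop : Lev G (Fintype.card V - k) 2)
    (hineq : 3 + k * ε ≤ k + (y₂ + y₃)) : Cert G (2 - ε) (Fintype.card V * (1 - ε)) := by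
  refine cert_no_mid (ι := Bool) (z := fun u => bif u then y₂ else max y₂ y₃) ?_ hε hε0
    (by simpa using hn) (fun y _ hy => lev_pair_threshold h2 h3 h4 y hy) htop ?_
  · rintro (_ | _)
    · exact ⟨le_trans h20 (le_max_left _ _), max_le h21 h31⟩
    · exact ⟨h20, h21⟩
  · have := le_max_right y₂ y₃
    simp
    linarith

theorem cert_pair_mid {y₂ y₃ : ℝ} (h20 : 0 ≤ y₂) (h21 : y₂ ≤ 1) (h31 : y₃ ≤ 1)
    (h2 : Lev G 1 y₂) (h3 : Lev G 2 y₃) (h4 : Lev G 3 1) {k : ℕ} {ε : ℝ} (hε : ε ≤ 1 / 3)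
    (hε0 : 0 ≤ ε) (hn : k + 4 ≤ Fintype.card V)
    (hmid : Lev G (Fintype.card V - k - 1) (11 / 8)) (htop : Lev G (Fintype.card V - k) 2)
    (hineq : 3 + k * ε ≤ k + 3 / 8 + (y₂ + y₃)) : Cert G (2 - ε) (Fintype.card V * (1 - ε)) := by
  refine cert_mid (ι := Bool) (z := fun u => bif u then y₂ else max y₂ y₃) ?_ hε hε0
    (by simpa using hn) (fun y _ hy => lev_pair_threshold h2 h3 h4 y hy) hmid htop ?_
  · rintro (_ | _)
    · exact ⟨le_trans h20 (le_max_left _ _), max_le h21 h31⟩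
    · exact ⟨h20, h21⟩
  · have := le_max_right y₂ y₃
    simp
    linarith

theorem anchored_star_le {ι : Type*} (s : Finset ι) (x : ι → ℝ) (t : ℝ) {y : ℝ} (h0 : 0 < y)
    (hy : y ≤ 1 / (#s + 2)) :
    y * (t ^ 2 + ∑ v ∈ s, x v ^ 2) ≤ t ^ 2 + ∑ v ∈ s, (x v - t) ^ 2 := by
  rw [le_div_iff₀ (by positivity)] at hy
  have hs : (0 : ℝ) ≤ #s := by positivity
  have hy1 : y < 1 := by nlinarith
  have h1 := star_sum_le s x t hy1
  have h2 : #s * (y / (1 - y)) ≤ 1 - y := by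
    rw [mul_div_assoc', div_le_iff₀ (by linarith)]
    nlinarith
  nlinarith [mul_le_mul_of_nonneg_right h2 (sq_nonneg t)]

namespace Spider

variable {w : V} {b r : V → V}

theorem branch_eq_singleton (h : Spider G w b r) {p : V} (hp : G.Adj w p)
    (hp' : #(branch w b p) = 1) : branch w b p = {p} := by
  obtain ⟨v, hv⟩ := Finset.card_eq_one.1 hp'
  have := h.u_mem hp
  rw [hv, Finset.mem_singleton] at this
  rw [hv, this]

theorem branchEnergy_pendant (h : Spider G w b r) {p : V} (hp : G.Adj w p)
    (hp' : #(branch w b p) = 1) (x : V → ℝ) :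
    branchEnergy w b r x p = (x p - x w) ^ 2 := by
  rw [branchEnergy, h.branch_eq_singleton hp hp', h.centre_of_pendant hp hp']
  simp

/-- The pendant neighbours of `w`. -/
def pendants (G : SimpleGraph V) [DecidableRel G.Adj] (w : V) (b : V → V) : Finset V :=
  {u ∈ G.neighborFinset w | ¬ 2 ≤ #(branch w b u)}

theorem mem_pendants (h : Spider G w b r) {p : V} :
    p ∈ pendants G w b ↔ G.Adj w p ∧ #(branch w b p) = 1 := by
  simp only [pendants, Finset.mem_filter, SimpleGraph.mem_neighborFinset]
  refine and_congr_right fun hp => ?_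
  have := h.card_pos hp
  omega

theorem sum_pair (h : Spider G w b r) {u v : V} (huv : u ≠ v) (hD : bigBranches G w b = {u, v})
    (φ : V → ℝ) : ∑ a, φ a = φ w + (∑ a ∈ branch w b u, φ a + ∑ a ∈ branch w b v, φ a) +
      ∑ p ∈ pendants G w b, φ p := by
  rw [h.sum_branches, ← Finset.sum_filter_add_sum_filter_not _ fun u => 2 ≤ #(branch w b u)]
  rw [show ({u ∈ G.neighborFinset w | 2 ≤ #(branch w b u)} : Finset V) = {u, v} from hD,
    Finset.sum_pair huv, ← add_assoc]
  congr 1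
  refine Finset.sum_congr rfl fun p hp => ?_
  obtain ⟨h1, h2⟩ := h.mem_pendants.1 hp
  rw [h.branch_eq_singleton h1 h2, Finset.sum_singleton]

theorem card_pair (h : Spider G w b r) {u v : V} (huv : u ≠ v) (hD : bigBranches G w b = {u, v}) :
    Fintype.card V = 1 + (#(branch w b u) + #(branch w b v)) + #(pendants G w b) := by
  have := h.sum_pair huv hD fun _ => 1
  simp only [Finset.sum_const, nsmul_eq_mul, mul_one, Finset.card_univ] at this
  exact_mod_cast this

theorem energy_pair (h : Spider G w b r) {u v : V} (huv : u ≠ v) (hD : bigBranches G w b = {u, v})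
    (x : V → ℝ) : branchEnergy w b r x u + branchEnergy w b r x v +
      ∑ p ∈ pendants G w b, (x p - x w) ^ 2 ≤ energy G x := by
  refine le_trans (le_of_eq ?_) (h.sum_branchEnergy_le x)
  rw [← Finset.sum_filter_add_sum_filter_not (G.neighborFinset w) fun u => 2 ≤ #(branch w b u)]
  rw [show ({u ∈ G.neighborFinset w | 2 ≤ #(branch w b u)} : Finset V) = {u, v} from hD,
    Finset.sum_pair huv]
  congr 1
  refine Finset.sum_congr rfl fun p hp => ?_
  obtain ⟨h1, h2⟩ := h.mem_pendants.1 hp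
  rw [h.branchEnergy_pendant h1 h2]

theorem lev_three_pair (h : Spider G w b r) {u v : V} (hD : bigBranches G w b = {u, v}) :
    Lev G 3 1 := by
  refine (h.lev_kill one_pos le_rfl {u, v} fun a ha => ?_).mono ?_ le_rfl
  · by_cases h2 : a ∈ bigBranches G w b
    · exact Or.inl (hD ▸ h2)
    · exact Or.inr (Or.inl (h.card_eq_one ha h2))
  · have := Finset.card_le_two (a := u) (b := v)
    omega

theorem lev_one_pair (h : Spider G w b r) {u v : V} (hD : bigBranches G w b = {u, v}) {y : ℝ}
    (h0 : 0 < y) (h1 : y ≤ 1) (hu : y ≤ branchLevel w b r u) (hv : y ≤ branchLevel w b r v) :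
    Lev G 1 y := by
  have := h.lev_level (D := ∅) h0 h1 fun a ha => by
    by_cases h2 : a ∈ bigBranches G w b
    · rw [hD] at h2
      rcases Finset.mem_insert.1 h2 with rfl | h3
      · exact Or.inr (Or.inr hu)
      · rw [Finset.mem_singleton.1 h3]
        exact Or.inr (Or.inr hv)
    · exact Or.inr (Or.inl (h.card_eq_one ha h2))
  exact this.mono (by simp) le_rfl

theorem lev_two_centred (h : Spider G w b r) {u v : V} (huv : u ≠ v)
    (hD : bigBranches G w b = {u, v}) (hur : r u = u) (hvr : r v = v) {y : ℝ} (h0 : 0 < y)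
    (h1 : y < 1)
    (hy : (#(branch w b v) - 1 + #(pendants G w b)) * y ≤ (5 - 2 * y) * (1 - y)) :
    Lev G 2 y := by
  refine ⟨{u, v}, fun a => if a = u then ev u else ev w + ev v, Finset.card_le_two,
    fun x hx => ?_⟩
  have hu := hx u (by simp)
  have hv := hx v (by simp)
  beta_reduce at hu hv
  rw [if_pos rfl, ev_apply] at hu
  rw [if_neg huv.symm, LinearMap.add_apply, ev_apply, ev_apply] at hv
  have hu' : G.Adj w u := (mem_big.1 (by simp [hD] : u ∈ bigBranches G w b)).1
  have hv' : G.Adj w v := (mem_big.1 (by simp [hD] : v ∈ bigBranches G w b)).1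
  refine le_trans ?_ (h.energy_pair huv hD x)
  rw [dotProduct_self_eq, h.sum_pair huv hD, h.sum_branch hu', h.sum_branch hv', branchEnergy,
    branchEnergy, hur, hvr, hu]
  have e1 := star_sum_le ((branch w b v).erase v) x (x v) h1
  have e2 := star_sum_le (pendants G w b) x (x w) h1
  have e3 : #((branch w b v).erase v) = (#(branch w b v) - 1 : ℝ) := by
    rw [Finset.card_erase_of_mem (h.u_mem hv'), Nat.cast_pred (h.card_pos hv')]
  rw [e3] at e1
  have hw : x w = -x v := by linarith
  rw [hw] at e2 ⊢
  have e4 : 0 ≤ ∑ a ∈ (branch w b u).erase u, x a ^ 2 := by positivity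
  have e5 : (#(branch w b v) - 1 + #(pendants G w b)) * (y / (1 - y)) ≤ 5 - 2 * y := by
    rwa [mul_div_assoc', div_le_iff₀ (by linarith)]
  have e6 := mul_le_mul_of_nonneg_right e5 (sq_nonneg (x v))
  have e7 := mul_le_mul_of_nonneg_right h1.le e4
  simp only [sub_zero] at *
  nlinarith

theorem lev_two_centred_eq (h : Spider G w b r) {u v : V} (huv : u ≠ v)
    (hD : bigBranches G w b = {u, v}) (hur : r u = u) (hvr : r v = v) {y : ℝ} (h0 : 0 < y)
    (h1 : y < 1)
    (hy : (#(branch w b u) - 1 + (#(branch w b v) - 1) + 4 * #(pendants G w b)) * y ≤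
      (18 - 6 * y) * (1 - y)) :
    Lev G 2 y := by
  refine ⟨{u, v}, fun a => if a = u then ev u - ev v else ev w + (2 : ℝ) • ev u,
    Finset.card_le_two, fun x hx => ?_⟩
  have hu := hx u (by simp)
  have hv := hx v (by simp)
  beta_reduce at hu hv
  rw [if_pos rfl, LinearMap.sub_apply, ev_apply, ev_apply] at hu
  rw [if_neg huv.symm, LinearMap.add_apply, LinearMap.smul_apply, ev_apply, ev_apply,
    smul_eq_mul] at hv
  have hu' : G.Adj w u := (mem_big.1 (by simp [hD] : u ∈ bigBranches G w b)).1
  have hv' : G.Adj w v := (mem_big.1 (by simp [hD] : v ∈ bigBranches G w b)).1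
  refine le_trans ?_ (h.energy_pair huv hD x)
  rw [dotProduct_self_eq, h.sum_pair huv hD, h.sum_branch hu', h.sum_branch hv', branchEnergy,
    branchEnergy, hur, hvr]
  have e0 := star_sum_le ((branch w b u).erase u) x (x u) h1
  have e1 := star_sum_le ((branch w b v).erase v) x (x v) h1
  have e2 := star_sum_le (pendants G w b) x (x w) h1
  have e3 : #((branch w b v).erase v) = (#(branch w b v) - 1 : ℝ) := by
    rw [Finset.card_erase_of_mem (h.u_mem hv'), Nat.cast_pred (h.card_pos hv')]
  have e3' : #((branch w b u).erase u) = (#(branch w b u) - 1 : ℝ) := by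
    rw [Finset.card_erase_of_mem (h.u_mem hu'), Nat.cast_pred (h.card_pos hu')]
  rw [e3] at e1
  rw [e3'] at e0
  have hw : x w = -2 * x v := by linarith
  have hu2 : x u = x v := by linarith
  rw [hu2] at e0
  rw [hw] at e2
  rw [hw, hu2]
  have e5 : (#(branch w b u) - 1 + (#(branch w b v) - 1) + 4 * #(pendants G w b)) *
      (y / (1 - y)) ≤ 18 - 6 * y := by
    rwa [mul_div_assoc', div_le_iff₀ (by linarith)]
  have e6 := mul_le_mul_of_nonneg_right e5 (sq_nonneg (x v))
  nlinarith

theorem lev_two_offset (h : Spider G w b r) {u v : V} (huv : u ≠ v)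
    (hD : bigBranches G w b = {u, v}) (hur : r u ≠ u) (hvr : r v ≠ v) {y : ℝ} (h0 : 0 < y)
    (h1 : y ≤ 1 / (#(pendants G w b) + 3)) (h2 : y ≤ 1 / #(branch w b v)) :
    Lev G 2 y := by
  refine ⟨{u, v}, fun a => if a = u then ev (r u) else ev v, Finset.card_le_two,
    fun x hx => ?_⟩
  have hu := hx u (by simp)
  have hv := hx v (by simp)
  beta_reduce at hu hv
  rw [if_pos rfl, ev_apply] at hu
  rw [if_neg huv.symm, ev_apply] at hv
  have hu' : G.Adj w u := (mem_big.1 (by simp [hD] : u ∈ bigBranches G w b)).1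
  have hv' : G.Adj w v := (mem_big.1 (by simp [hD] : v ∈ bigBranches G w b)).1
  have hup : u ∉ pendants G w b := fun hm => by
    have := (h.mem_pendants.1 hm).2
    have := h.card_ge_three hu' hur
    omega
  have huM : u ∈ (branch w b u).erase (r u) := Finset.mem_erase.2 ⟨hur.symm, h.u_mem hu'⟩
  have hvM : v ∈ (branch w b v).erase (r v) := Finset.mem_erase.2 ⟨hvr.symm, h.u_mem hv'⟩
  have hv3 := h.card_ge_three hv' hvr
  refine le_trans ?_ (h.energy_pair huv hD x)
  rw [dotProduct_self_eq, h.sum_pair huv hD, h.sum_branch hu', h.sum_branch hv', branchEnergy,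
    branchEnergy, hu, hv, ← Finset.add_sum_erase _ _ huM, ← Finset.add_sum_erase _ _ hvM,
    ← Finset.add_sum_erase _ (fun a => (x a - 0) ^ 2) huM,
    ← Finset.add_sum_erase _ (fun a => (x a - x (r v)) ^ 2) hvM, hv]
  have e1 := anchored_star_le (insert u (pendants G w b)) x (x w) h0 (by
    rw [Finset.card_insert_of_notMem hup]
    push_cast
    convert h1 using 2
    ring)
  rw [Finset.sum_insert hup, Finset.sum_insert hup] at e1
  have e2 := anchored_star_le (((branch w b v).erase (r v)).erase v) x (x (r v)) h0 (by
    rw [Finset.card_erase_of_mem hvM, Finset.card_erase_of_mem (h.r_mem hv'), Nat.sub_sub,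
      Nat.cast_sub (by omega)]
    convert h2 using 2
    push_cast
    ring)
  have e4 : 0 ≤ ∑ a ∈ ((branch w b u).erase (r u)).erase u, x a ^ 2 := by positivity
  have h1' : y ≤ 1 := h2.trans (by
    rw [div_le_one (by positivity)]
    exact_mod_cast (show 1 ≤ #(branch w b v) by omega))
  have e7 := mul_le_mul_of_nonneg_right h1' e4
  simp only [sub_zero] at *
  nlinarith [sq_nonneg (x u)]

theorem lev_one_two_centred (h : Spider G w b r) {u v : V} (huv : u ≠ v)
    (hD : bigBranches G w b = {u, v}) (hP : pendants G w b = ∅) (hur : r u = u) (hvr : r v = v)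
    (hu3 : #(branch w b u) = 3) (hv2 : #(branch w b v) = 2) : Lev G 1 (3 / 10) := by
  refine ⟨{u}, fun _ => ev w + (1 / 10 : ℝ) • ev u, by simp, fun x hx => ?_⟩
  have hu := hx u (by simp)
  rw [LinearMap.add_apply, LinearMap.smul_apply, ev_apply, ev_apply, smul_eq_mul] at hu
  have hu' : G.Adj w u := (mem_big.1 (by simp [hD] : u ∈ bigBranches G w b)).1
  have hv' : G.Adj w v := (mem_big.1 (by simp [hD] : v ∈ bigBranches G w b)).1
  refine le_trans ?_ (h.energy_pair huv hD x)
  rw [dotProduct_self_eq, h.sum_pair huv hD, h.sum_branch hu', h.sum_branch hv', branchEnergy,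
    branchEnergy, hur, hvr, hP]
  have e0 := star_sum_le ((branch w b u).erase u) x (x u) (y := 3 / 10) (by norm_num)
  have e1 := star_sum_le ((branch w b v).erase v) x (x v) (y := 3 / 10) (by norm_num)
  rw [Finset.card_erase_of_mem (h.u_mem hv'), hv2] at e1
  rw [Finset.card_erase_of_mem (h.u_mem hu'), hu3] at e0
  have hw : x w = -1 / 10 * x u := by linarith
  rw [hw]
  norm_num at e0 e1 ⊢
  nlinarith [sq_nonneg (x v + 2 / 5 * x u), sq_nonneg (x u), sq_nonneg (x v)]

end Spider

end SmallSpiders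

section PairCertificates

variable {V : Type} [Fintype V] [DecidableEq V] {G : SimpleGraph V} [DecidableRel G.Adj]

namespace Spider

variable {w : V} {b r : V → V}

theorem cert_two_centred (h : Spider G w b r) {u v : V} (huv : u ≠ v)
    (hD : bigBranches G w b = {u, v}) (hP : ∀ u, G.Adj w u → #(branch w b u) ≠ 1)
    (hA : ∀ u, G.Adj w u → r u = u) {ε : ℝ} (hε0 : 0 ≤ ε)
    (hε : ε ≤ 1 / 3) (hεn : ε * Fintype.card V ≤ 2) :
    Cert G (2 - ε) (Fintype.card V * (1 - ε)) := by
  wlog hm : #(branch w b v) ≤ #(branch w b u) generalizing u v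
  · exact this huv.symm (by rw [hD, Finset.pair_comm]) (by omega)
  have hn := h.card_pair huv hD
  have hP0 : pendants G w b = ∅ := Finset.eq_empty_of_forall_notMem fun p hp =>
    hP p (h.mem_pendants.1 hp).1 (h.mem_pendants.1 hp).2
  have hu : u ∈ bigBranches G w b := by simp [hD]
  have hv : v ∈ bigBranches G w b := by simp [hD]
  obtain ⟨hu', hu2⟩ := mem_big.1 hu
  obtain ⟨hv', hv2⟩ := mem_big.1 hv
  have hc : #(bigBranches G w b) = 2 := by rw [hD, Finset.card_pair huv]
  rw [hP0, Finset.card_empty, add_zero] at hn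
  by_cases h6 : Fintype.card V = 6
  · have h1 := h.lev_one_two_centred huv hD hP0 (hA u hu') (hA v hv') (by omega) (by omega)
    have h2 := h.lev_centres hu' (hA u hu')
    rw [← h.big_eq hP, hc] at h2
    have htop := h.lev_big_top
    have hmid := h.lev_big_middle hA hu hv huv
    rw [hc] at htop hmid
    refine cert_mid (ι := Unit) (z := fun _ => 3 / 10) (k := 2) (fun _ => by norm_num) hε hε0
      (by simp [h6]) (fun y _ hy => lev_one_threshold h1 h2 y hy) hmid htop ?_
    rw [h6] at hεn
    norm_num at hεn ⊢
    linarith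
  · refine h.cert_centred hP hA hv ?_ (by omega) hε0 hε ?_
    · intro a ha
      rw [hD] at ha
      rcases Finset.mem_insert.1 ha with rfl | ha
      · exact hm
      · rw [Finset.mem_singleton.1 ha]
    · have he : (bigBranches G w b).erase v = {u} := by
        rw [hD]
        ext a
        simp only [Finset.mem_erase, Finset.mem_insert, Finset.mem_singleton]
        refine ⟨fun ⟨h1, h2⟩ => h2.resolve_right h1, fun e => ⟨e ▸ huv, Or.inl e⟩⟩
      rw [he, hc, Finset.sum_singleton, branchLevel, if_pos (hA u hu')]
      push_cast
      by_cases h5 : Fintype.card V = 5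
      · have : #(branch w b u) = 2 := by omega
        rw [this]
        norm_num
        linarith
      · have hn7 : (7 : ℝ) ≤ Fintype.card V := by
          exact_mod_cast (show 7 ≤ Fintype.card V by omega)
        have hnR : (#(branch w b u) : ℝ) + 3 ≤ Fintype.card V := by
          exact_mod_cast (show #(branch w b u) + 3 ≤ Fintype.card V by omega)
        have hm0 : (2 : ℝ) ≤ #(branch w b u) := by exact_mod_cast hu2
        refine (mul_le_two_mul_div (by linarith) (by norm_num) hεn).trans ?_
        generalize (#(branch w b u) : ℝ) = m at *
        generalize (Fintype.card V : ℝ) = n at *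
        have h1 : 1 / (n - 2) ≤ 1 / (m + 1) :=
          one_div_le_one_div_of_le (by linarith) (by linarith)
        refine le_trans ?_ (add_le_add_right h1 _)
        rw [div_add_div _ _ (by norm_num) (by linarith),
          div_le_div_iff₀ (by linarith) (by linarith)]
        nlinarith

theorem cert_pair_pendant (h : Spider G w b r) {p u v : V} (huv : u ≠ v)
    (hD : bigBranches G w b = {u, v}) (hp : G.Adj w p) (hp' : #(branch w b p) = 1)
    (hA : ∀ u, G.Adj w u → r u = u) {ε : ℝ} (hε0 : 0 ≤ ε)
    (hε : ε ≤ 1 / 3) (hεn : ε * Fintype.card V ≤ 2) :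
    Cert G (2 - ε) (Fintype.card V * (1 - ε)) := by
  wlog hm : #(branch w b v) ≤ #(branch w b u) generalizing u v
  · exact this huv.symm (by rw [hD, Finset.pair_comm]) (by omega)
  have hn := h.card_pair huv hD
  have hP0 : 0 < #(pendants G w b) := Finset.card_pos.2 ⟨p, h.mem_pendants.2 ⟨hp, hp'⟩⟩
  obtain ⟨hu', hu2⟩ := mem_big.1 (by simp [hD] : u ∈ bigBranches G w b)
  obtain ⟨hv', hv2⟩ := mem_big.1 (by simp [hD] : v ∈ bigBranches G w b)
  have hc : #(bigBranches G w b) = 2 := by rw [hD, Finset.card_pair huv]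
  have htop := h.lev_top hp (Or.inl hp')
  rw [hc] at htop
  have hu2R : (2 : ℝ) ≤ #(branch w b u) := by exact_mod_cast hu2
  have hv2R : (2 : ℝ) ≤ #(branch w b v) := by exact_mod_cast hv2
  have hmR : (#(branch w b v) : ℝ) ≤ #(branch w b u) := by exact_mod_cast hm
  have hPR : (1 : ℝ) ≤ #(pendants G w b) := by exact_mod_cast hP0
  have hnR : (Fintype.card V : ℝ) = 1 + (#(branch w b u) + #(branch w b v)) + #(pendants G w b) := by
    exact_mod_cast hn
  have h1 : Lev G 1 (1 / (#(branch w b u) + 1)) := by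
    refine h.lev_one_pair hD (by positivity) ?_ ?_ ?_
    · rw [div_le_one (by positivity)]; linarith
    · rw [branchLevel, if_pos (hA u hu')]
    · rw [branchLevel, if_pos (hA v hv')]
      exact one_div_le_one_div_of_le (by positivity) (by linarith)
  have key : ∀ y₃ : ℝ, y₃ ≤ 1 → Lev G 2 y₃ → 3 * ε ≤ 1 / (#(branch w b u) + 1) + y₃ →
      Cert G (2 - ε) (Fintype.card V * (1 - ε)) := fun y₃ h3 h4 h5 =>
    cert_pair (k := 3) (by positivity) (by rw [div_le_one (by positivity)]; linarith) h3 h1 h4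
      (h.lev_three_pair hD) hε hε0 (by omega) htop (by push_cast; linarith)
  have h2 : ∀ y : ℝ, 0 < y → y < 1 →
      (#(branch w b v) - 1 + #(pendants G w b)) * y ≤ (5 - 2 * y) * (1 - y) → Lev G 2 y :=
    fun y h0 h1 => h.lev_two_centred huv hD (hA u hu') (hA v hv') h0 h1
  by_cases h8 : 8 ≤ Fintype.card V
  · have h0 : (0 : ℝ) < #(branch w b v) + #(pendants G w b) + 6 := by positivity
    refine key (5 / (#(branch w b v) + #(pendants G w b) + 6)) ?_ (h2 _ (by positivity) ?_ ?_) ?_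
    · rw [div_le_one h0]; linarith
    · rw [div_lt_one h0]; linarith
    · have e : (#(branch w b v) + #(pendants G w b) + 6) *
          (5 / (#(branch w b v) + #(pendants G w b) + 6 : ℝ)) = 5 := by field_simp
      generalize 5 / (#(branch w b v) + #(pendants G w b) + 6 : ℝ) = y at *
      nlinarith [sq_nonneg y]
    · refine (mul_le_two_mul_div (by linarith) (by norm_num) hεn).trans ?_
      have h8R : (Fintype.card V : ℝ) = 8 ∨ 9 ≤ (Fintype.card V : ℝ) := by
        rcases h8.eq_or_lt with h | h
        · exact Or.inl (by exact_mod_cast h.symm)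
        · exact Or.inr (by exact_mod_cast h)
      rw [div_add_div _ _ (by positivity) h0.ne', div_le_div_iff₀ (by linarith) (by positivity)]
      rcases h8R with h8R | h8R
      · have : ((#(branch w b u) : ℝ) - 3) * (#(branch w b u) - 4) ≥ 0 := by
          rcases le_or_gt #(branch w b u) 3 with h | h
          · have : (#(branch w b u) : ℝ) ≤ 3 := by exact_mod_cast h
            nlinarith
          · have : (4 : ℝ) ≤ #(branch w b u) := by exact_mod_cast h
            nlinarith
        have e : (#(branch w b v) : ℝ) + #(pendants G w b) = 7 - #(branch w b u) := by linarith
        rw [e, h8R]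
        nlinarith
      · have e : (#(branch w b v) : ℝ) + #(pendants G w b) =
            Fintype.card V - 1 - #(branch w b u) := by linarith
        rw [e]
        generalize (#(branch w b u) : ℝ) = a at *
        generalize (Fintype.card V : ℝ) = n at *
        nlinarith [sq_nonneg (6 * a - (n + 12)), mul_nonneg (by linarith : 0 ≤ n - 9) (by linarith : 0 ≤ n - 9)]
  · by_cases h6 : Fintype.card V = 6
    · have hu6 : #(branch w b u) = 2 := by omega
      have hv6 : #(branch w b v) = 2 := by omega
      have hP6 : #(pendants G w b) = 1 := by omega
      refine key (2 / 3) (by norm_num) (h.lev_two_centred_eq huv hD (hA u hu') (hA v hv')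
        (by norm_num) (by norm_num) ?_) ?_
      · rw [hu6, hv6, hP6]; norm_num
      · rw [hu6]; norm_num; linarith
    · have h7 : Fintype.card V = 7 := by omega
      rw [h7] at hεn
      norm_num at hεn
      by_cases hu7 : #(branch w b u) = 3
      · have hv7 : #(branch w b v) = 2 := by omega
        have hP7 : #(pendants G w b) = 1 := by omega
        refine key (62 / 100) (by norm_num) (h2 _ (by norm_num) (by norm_num) ?_) ?_
        · rw [hv7, hP7]; norm_num
        · rw [hu7]; norm_num; linarith
      · have hu7 : #(branch w b u) = 2 := by omega
        have hv7 : #(branch w b v) = 2 := by omega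
        have hP7 : #(pendants G w b) = 2 := by omega
        refine key (55 / 100) (by norm_num) (h2 _ (by norm_num) (by norm_num) ?_) ?_
        · rw [hv7, hP7]; norm_num
        · rw [hu7]; norm_num; linarith

theorem cert_pair_offset (h : Spider G w b r) {u v : V} (huv : u ≠ v)
    (hD : bigBranches G w b = {u, v}) (hur : r u ≠ u) (hvr : r v ≠ v)
    (htop : Lev G (Fintype.card V - 3) 2) (hmid : Lev G (Fintype.card V - 3 - 1) (11 / 8))
    {ε : ℝ} (hε0 : 0 ≤ ε) (hε : ε ≤ 1 / 3) (hεn : ε * Fintype.card V ≤ 2) :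
    Cert G (2 - ε) (Fintype.card V * (1 - ε)) := by
  wlog hm : #(branch w b v) ≤ #(branch w b u) generalizing u v
  · exact this huv.symm (by rw [hD, Finset.pair_comm]) hvr hur (by omega)
  have hn := h.card_pair huv hD
  obtain ⟨hu', -⟩ := mem_big.1 (by simp [hD] : u ∈ bigBranches G w b)
  obtain ⟨hv', -⟩ := mem_big.1 (by simp [hD] : v ∈ bigBranches G w b)
  have hu3 := h.card_ge_three hu' hur
  have hv3 := h.card_ge_three hv' hvr
  have hu3R : (3 : ℝ) ≤ #(branch w b u) := by exact_mod_cast hu3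
  have hv3R : (3 : ℝ) ≤ #(branch w b v) := by exact_mod_cast hv3
  have hmR : (#(branch w b v) : ℝ) ≤ #(branch w b u) := by exact_mod_cast hm
  have hlu : branchLevel w b r u = 1 / (2 * #(branch w b u)) := by rw [branchLevel, if_neg hur]
  have hlv : branchLevel w b r v = 1 / (2 * #(branch w b v)) := by rw [branchLevel, if_neg hvr]
  have h1 : Lev G 1 (1 / (2 * #(branch w b u))) := by
    refine h.lev_one_pair hD (by positivity) ?_ hlu.ge ?_
    · rw [div_le_one (by positivity)]; linarith
    · rw [hlv]
      exact one_div_le_one_div_of_le (by positivity) (by linarith)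
  have key : ∀ y₃ : ℝ, y₃ ≤ 1 → Lev G 2 y₃ →
      3 * ε ≤ 3 / 8 + (1 / (2 * #(branch w b u)) + y₃) →
      Cert G (2 - ε) (Fintype.card V * (1 - ε)) := fun y₃ h3 h4 h5 =>
    cert_pair_mid (k := 3) (by positivity) (by rw [div_le_one (by positivity)]; linarith) h3 h1 h4
      (h.lev_three_pair hD) hε hε0 (by omega) hmid htop (by push_cast; linarith)
  have h2 : Lev G 2 (1 / (2 * #(branch w b v))) := by
    refine (h.lev_level (D := {u}) (by positivity) ?_ fun a ha => ?_).mono ?_ le_rfl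
    · rw [div_le_one (by positivity)]; linarith
    · by_cases h2 : a ∈ bigBranches G w b
      · rw [hD] at h2
        rcases Finset.mem_insert.1 h2 with rfl | h3
        · exact Or.inl (Finset.mem_singleton_self _)
        · rw [Finset.mem_singleton.1 h3]
          exact Or.inr (Or.inr hlv.ge)
      · exact Or.inr (Or.inl (h.card_eq_one ha h2))
    · have := Finset.card_le_univ
        ({a : ({u} : Finset V) | branchLevel w b r a < 1 / (2 * (#(branch w b v) : ℝ))})
      rw [Fintype.card_coe, Finset.card_singleton] at this
      omega
  have h3 : ∀ y : ℝ, 0 < y → y ≤ 1 / (#(pendants G w b) + 3) → y ≤ 1 / #(branch w b v) →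
      Lev G 2 y := fun y => h.lev_two_offset huv hD hur hvr
  have h21 : 1 / (2 * (#(branch w b v) : ℝ)) ≤ 1 := by
    rw [div_le_one (by positivity)]; linarith
  have hnR : (Fintype.card V : ℝ) = 1 + (#(branch w b u) + #(branch w b v)) + #(pendants G w b) := by
    exact_mod_cast hn
  by_cases h11 : 11 ≤ Fintype.card V
  · refine key _ h21 h2 ?_
    have h11R : (11 : ℝ) ≤ Fintype.card V := by exact_mod_cast h11
    have hP : (0 : ℝ) ≤ #(pendants G w b) := by positivity
    refine (mul_le_two_mul_div (by linarith) (by norm_num) hεn).trans ?_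
    generalize (#(branch w b u) : ℝ) = x at *
    generalize (#(branch w b v) : ℝ) = y at *
    generalize (Fintype.card V : ℝ) = n at *
    have e1 : 2 / (n - 1) ≤ 1 / (2 * x) + 1 / (2 * y) := by
      rw [div_add_div _ _ (by positivity) (by positivity),
        div_le_div_iff₀ (by linarith) (by positivity)]
      nlinarith [sq_nonneg (x - y), mul_nonneg (by linarith : 0 ≤ x + y) (by linarith : 0 ≤ n - 1 - (x + y))]
    refine le_trans ?_ (add_le_add_right e1 _)
    rw [div_add_div _ _ (by positivity) (by linarith), div_le_div_iff₀ (by linarith) (by linarith)]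
    nlinarith
  · generalize hgu : #(branch w b u) = x at *
    generalize hgv : #(branch w b v) = y at *
    generalize hgp : #(pendants G w b) = q at *
    rw [hn] at hεn
    have hx : x ≤ 6 := by omega
    have hy : y ≤ 4 := by omega
    have hq : q ≤ 3 := by omega
    interval_cases x <;> interval_cases y <;> first | omega | skip
    all_goals interval_cases q <;> first | omega | skip
    all_goals norm_num at hεn
    all_goals first
      | exact key _ h21 h2 (by norm_num; linarith)
      | exact key (1 / 4) (by norm_num) (h3 _ (by norm_num) (by norm_num) (by norm_num))
          (by norm_num; linarith)
      | exact key (1 / 3) (by norm_num) (h3 _ (by norm_num) (by norm_num) (by norm_num))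
          (by norm_num; linarith)

end Spider

end PairCertificates

section SpiderCert

variable {V : Type} [Fintype V] [DecidableEq V] {G : SimpleGraph V} [DecidableRel G.Adj]

namespace Spider

variable {w : V} {b r : V → V}

/-- A spider with a single nontrivial branch, attached away from its centre, can be re-rooted. -/
theorem reroot (h : Spider G w b r) (htri : ∀ x y z, G.Adj x y → G.Adj y z → ¬ G.Adj x z)
    {u : V} (hD : bigBranches G w b = {u}) (hur : r u ≠ u) :
    Spider G u (fun v => if v ≠ w ∧ b v = u then r u else w) id := by
  have hu : G.Adj w u := (mem_big.1 (by simp [hD] : u ∈ bigBranches G w b)).1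
  have hadj : G.Adj u (r u) := by
    have := h.adj_r u hu.ne' (by rw [h.b_self u hu]; exact hur.symm)
    rwa [h.b_self u hu] at this
  have hpend : ∀ v, v ≠ w → b v ≠ u → G.Adj w v := fun v hv hb => by
    have h1 := h.card_eq_one (h.adj_b v hv) (by rw [hD, Finset.mem_singleton]; exact hb)
    rw [h.eq_of_pendant hv h1]
    exact h.adj_b v hv
  refine ⟨?_, ?_, ?_, ?_, ?_, ?_⟩
  · intro v hv
    split_ifs
    · exact hadj
    · exact hu.symm
  · intro v hv
    split_ifs with h1
    · by_contra hne
      have := h.adj_r v h1.1 (by rw [h1.2]; exact fun e => hne e.symm)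
      rw [h1.2] at this
      exact htri _ _ _ hv this hadj
    · by_contra hne
      have hvw : v ≠ w := fun e => hne e.symm
      exact htri _ _ _ hu hv (hpend v hvw fun e => h1 ⟨hvw, e⟩)
  · intro v hv
    exact hv.ne'
  · intro v hv
    simp only [id]
    split_ifs with h1
    · by_contra hne
      have := h.adj_r v h1.1 (by rw [h1.2]; exact fun e => hne e.symm)
      rw [h1.2] at this
      exact htri _ _ _ hv this hadj
    · by_contra hne
      have hvw : v ≠ w := fun e => hne e.symm
      exact htri _ _ _ hu hv (hpend v hvw fun e => h1 ⟨hvw, e⟩)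
  · intro v hv hv'
    simp only [id] at hv' ⊢
    split_ifs at hv' ⊢ with h1
    · have := h.adj_r v h1.1 (by rw [h1.2]; exact hv')
      rwa [h1.2] at this
    · exact (hpend v hv' fun e => h1 ⟨hv', e⟩).symm
  · intro v hv h1
    exact absurd rfl h1

theorem cert (h : Spider G w b r) (htri : ∀ x y z, G.Adj x y → G.Adj y z → ¬ G.Adj x z)
    (hs : ¬ IsStar G) (hds : ¬ IsDoubleStar G) {ε : ℝ} (hε0 : 0 ≤ ε)
    (hε : ε ≤ 1 / 3) (hεn : ε * Fintype.card V ≤ 2) :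
    Cert G (2 - ε) (Fintype.card V * (1 - ε)) := by
  have hpend : ∀ v, v ≠ w → b v ∉ bigBranches G w b → G.Adj w v := fun v hv hb => by
    have h1 := h.card_eq_one (h.adj_b v hv) hb
    rw [h.eq_of_pendant hv h1]
    exact h.adj_b v hv
  have hD0 : bigBranches G w b ≠ ∅ := fun hD =>
    hs ⟨w, fun x hx => hpend x hx (by simp [hD])⟩
  by_cases hP : ∃ p, G.Adj w p ∧ #(branch w b p) = 1
  · obtain ⟨p, hp, hp'⟩ := hP
    by_cases hB : ∃ u, G.Adj w u ∧ r u ≠ u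
    · obtain ⟨u, hu, hur⟩ := hB
      have huD := h.mem_big_of_offset hu hur
      have hup : u ≠ p := by
        rintro rfl
        have := h.card_ge_three hu hur
        omega
      have hn : 2 * #(bigBranches G w b) + 3 ≤ Fintype.card V := by
        have h1 := h.sum_big_add_one_le hp hp'
        have h2 : #((bigBranches G w b).erase u) * 2 ≤
            ∑ v ∈ (bigBranches G w b).erase u, #(branch w b v) :=
          Finset.card_nsmul_le_sum _ _ _ fun v hv => (mem_big.1 (Finset.mem_of_mem_erase hv)).2
        rw [← Finset.add_sum_erase _ _ huD] at h1
        have h3 := h.card_ge_three hu hur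
        rw [Finset.card_erase_of_mem huD] at h2
        omega
      by_cases hd : 3 ≤ #(bigBranches G w b)
      · exact h.cert_of_offset hp (Or.inl hp') hu hur hup hn hd hε0 hε hεn
      by_cases hd2 : #(bigBranches G w b) = 2
      · obtain ⟨v, hv⟩ : ∃ v, (bigBranches G w b).erase u = {v} :=
          Finset.card_eq_one.1 (by rw [Finset.card_erase_of_mem huD]; omega)
        have hvu : u ≠ v := by
          rintro rfl
          exact Finset.notMem_erase _ _ (by rw [hv]; exact Finset.mem_singleton_self _)
        have hD : bigBranches G w b = {u, v} := by rw [← Finset.insert_erase huD, hv]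
        by_cases hvr : r v = v
        · exact h.cert_of_centred_offset hp hp' hur hvr hvu hD hε0 hε hεn
        · have h1 := h.lev_top hp (Or.inl hp')
          have h2 := h.lev_middle hp (Or.inl hp') hu hur hup
          rw [hd2] at h1 h2
          exact h.cert_pair_offset hvu hD hur hvr h1 h2 hε0 hε hεn
      · have hD : bigBranches G w b = {u} := by
          have := Finset.card_pos.2 ⟨u, huD⟩
          obtain ⟨v, hv⟩ := Finset.card_eq_one.1 (by omega : #(bigBranches G w b) = 1)
          rw [hv, Finset.mem_singleton] at huD
          rw [hv, huD]
        have h' := h.reroot htri hD hur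
        obtain ⟨t, ht, htb, htu, htr⟩ := h.third u hu hur
        have hadj : G.Adj u (r u) := by
          have := h.adj_r u hu.ne' (by rw [h.b_self u hu]; exact hur.symm)
          rwa [h.b_self u hu] at this
        have hnb : ∀ a, G.Adj u a → a = w ∨ a = r u := fun a ha => by
          have := h'.b_self a ha
          split_ifs at this
          · exact Or.inr this.symm
          · exact Or.inl this.symm
        have hbp : b p ≠ u := by rw [h.b_self p hp]; exact hup.symm
        have hrw := h.r_ne u hu
        have hw2 : 2 ≤ #(branch u (fun v => if v ≠ w ∧ b v = u then r u else w) w) := by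
          rw [← Finset.card_pair hp.ne]
          refine Finset.card_le_card fun a ha => mem_branch.2 ?_
          rcases Finset.mem_insert.1 ha with rfl | ha
          · exact ⟨hu.ne, by simp⟩
          · rw [Finset.mem_singleton.1 ha]
            exact ⟨hup.symm, by simp [hbp]⟩
        have hr2 : 2 ≤ #(branch u (fun v => if v ≠ w ∧ b v = u then r u else w) (r u)) := by
          rw [← Finset.card_pair htr]
          refine Finset.card_le_card fun a ha => mem_branch.2 ?_
          rcases Finset.mem_insert.1 ha with rfl | ha
          · exact ⟨htu, by simp [ht, htb]⟩
          · rw [Finset.mem_singleton.1 ha]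
            exact ⟨hur, by simp [hrw, h.b_r u hu]⟩
        refine h'.cert_two_centred (u := w) (v := r u) hrw.symm ?_ ?_ (fun _ _ => rfl) hε0 hε hεn
        · ext a
          rw [mem_big, Finset.mem_insert, Finset.mem_singleton]
          refine ⟨fun ha => hnb a ha.1, ?_⟩
          rintro (rfl | rfl)
          · exact ⟨hu.symm, hw2⟩
          · exact ⟨hadj, hr2⟩
        · intro a ha
          rcases hnb a ha with rfl | rfl
          · omega
          · omega
    · push Not at hB
      by_cases hd : 3 ≤ #(bigBranches G w b)
      · exact h.cert_of_centred_pendant hp hp' hB hd hε0 hε hεn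
      by_cases hd2 : #(bigBranches G w b) = 2
      · obtain ⟨u, v, huv, hD⟩ := Finset.card_eq_two.1 hd2
        exact h.cert_pair_pendant huv hD hp hp' hB hε0 hε hεn
      · exfalso
        have := Finset.card_pos.2 (Finset.nonempty_iff_ne_empty.2 hD0)
        obtain ⟨u, hD⟩ := Finset.card_eq_one.1 (by omega : #(bigBranches G w b) = 1)
        obtain ⟨hu, hu2⟩ := mem_big.1 (by simp [hD] : u ∈ bigBranches G w b)
        obtain ⟨q, hq, hqu⟩ := Finset.exists_mem_ne hu2 u
        obtain ⟨hq1, hq2⟩ := mem_branch.1 hq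
        have hbr : ∀ x, x ≠ w → x ≠ u → b x = u → G.Adj u x := fun x hx hxu hbx => by
          have := h.adj_r x hx (by rw [hbx, hB u hu]; exact hxu)
          rw [hbx, hB u hu] at this
          exact this.symm
        refine hds ⟨w, u, hu, ⟨p, ?_, hp⟩, ⟨q, hq1, hbr q hq1 hqu hq2⟩, fun x hx hxu => ?_⟩
        · rintro rfl
          omega
        · by_cases hbx : b x = u
          · exact Or.inr (hbr x hx hxu hbx)
          · exact Or.inl (hpend x hx (by rw [hD, Finset.mem_singleton]; exact hbx))
  · push Not at hP
    have hDN := big_eq hP h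
    by_cases hB : ∃ u, G.Adj w u ∧ r u ≠ u
    · obtain ⟨u, hu, hur⟩ := hB
      by_cases hA : ∃ a, G.Adj w a ∧ r a = a
      · obtain ⟨a, ha, har⟩ := hA
        exact h.cert_mixed hP hu hur ha har hε0 hε hεn
      push Not at hA
      have huD := h.mem_big_of_offset hu hur
      by_cases hd1 : #(bigBranches G w b) = 1
      · exfalso
        obtain ⟨v, hv⟩ := Finset.card_eq_one.1 hd1
        rw [hv, Finset.mem_singleton] at huD
        subst huD
        have hadj : G.Adj u (r u) := by
          have := h.adj_r u hu.ne' (by rw [h.b_self u hu]; exact hur.symm)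
          rwa [h.b_self u hu] at this
        obtain ⟨t, ht, htb, htu, htr⟩ := h.third u hu hur
        have hbu : ∀ x, x ≠ w → x ≠ r u → G.Adj (r u) x := fun x hx hxr => by
          have h1 : b x = u := by
            have := (SimpleGraph.mem_neighborFinset _ _ _).2 (h.adj_b x hx)
            rwa [← hDN, hv, Finset.mem_singleton] at this
          have := h.adj_r x hx (by rwa [h1])
          rw [h1] at this
          exact this.symm
        refine hds ⟨u, r u, hadj, ⟨w, (h.r_ne u hu).symm, hu.symm⟩, ⟨t, htu, hbu t ht htr⟩,
          fun x hx hxr => ?_⟩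
        by_cases hxw : x = w
        · exact Or.inl (hxw ▸ hu.symm)
        · exact Or.inr (hbu x hxw hxr)
      have hd2 : 2 ≤ #(bigBranches G w b) := by
        have := Finset.card_pos.2 ⟨u, huD⟩
        omega
      obtain ⟨p, hpD, hpu⟩ := Finset.exists_mem_ne hd2 u
      have hp := (mem_big.1 hpD).1
      have hn : 3 * #(bigBranches G w b) + 1 ≤ Fintype.card V := by
        have h1 := h.sum_big_le
        have h2 : #(bigBranches G w b) * 3 ≤ ∑ v ∈ bigBranches G w b, #(branch w b v) :=
          Finset.card_nsmul_le_sum _ _ _ fun v hv =>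
            h.card_ge_three (mem_big.1 hv).1 (hA v (mem_big.1 hv).1)
        omega
      by_cases hd : 3 ≤ #(bigBranches G w b)
      · exact h.cert_of_offset hp (Or.inr (hA p hp)) hu hur hpu.symm (by omega) hd hε0 hε hεn
      · have hd2 : #(bigBranches G w b) = 2 := by omega
        have hD : bigBranches G w b = {u, p} := by
          refine (Finset.eq_of_subset_of_card_le ?_ ?_).symm
          · intro a ha
            rcases Finset.mem_insert.1 ha with rfl | ha
            · exact huD
            · rwa [Finset.mem_singleton.1 ha]
          · rw [hd2, Finset.card_pair hpu.symm]
        have h1 := h.lev_top hp (Or.inr (hA p hp))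
        have h2 := h.lev_middle hp (Or.inr (hA p hp)) hu hur hpu.symm
        rw [hd2] at h1 h2
        exact h.cert_pair_offset hpu.symm hD hur (hA p hp) h1 h2 hε0 hε hεn
    · push Not at hB
      by_cases hd : 3 ≤ #(bigBranches G w b)
      · exact h.cert_of_all_centred hP hB hd hε0 hε hεn
      by_cases hd2 : #(bigBranches G w b) = 2
      · obtain ⟨u, v, huv, hD⟩ := Finset.card_eq_two.1 hd2
        exact h.cert_two_centred huv hD hP hB hε0 hε hεn
      · exfalso
        have := Finset.card_pos.2 (Finset.nonempty_iff_ne_empty.2 hD0)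
        obtain ⟨u, hD⟩ := Finset.card_eq_one.1 (by omega : #(bigBranches G w b) = 1)
        obtain ⟨hu, hu2⟩ := mem_big.1 (by simp [hD] : u ∈ bigBranches G w b)
        refine hs ⟨u, fun x hx => ?_⟩
        by_cases hxw : x = w
        · exact hxw ▸ hu.symm
        · have h1 : b x = u := by
            have := (SimpleGraph.mem_neighborFinset _ _ _).2 (h.adj_b x hxw)
            rwa [← hDN, hD, Finset.mem_singleton] at this
          have := h.adj_r x hxw (by rw [h1, hB u hu]; exact hx)
          rw [h1, hB u hu] at this
          exact this.symm

end Spider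

end SpiderCert

section TreeSides

variable {V : Type} {G : SimpleGraph V}

theorem exists_parent (hG : G.Connected) {x w : V} (hx : x ≠ w) :
    ∃ y, G.Adj x y ∧ G.dist x w = G.dist y w + 1 := by
  obtain ⟨p, hp⟩ := hG.exists_walk_length_eq_dist x w
  cases p with
  | nil => exact absurd rfl hx
  | cons h q =>
    refine ⟨_, h, ?_⟩
    have h1 := SimpleGraph.dist_le q
    have h2 := hG.dist_triangle (u := x) (v := _) (w := w) |>.trans
      (Nat.add_le_add_right (SimpleGraph.dist_eq_one_iff_adj.2 h).le _)
    rw [SimpleGraph.Walk.length_cons] at hp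
    omega

theorem parent_unique (hG : G.IsTree) {x y z w : V} (hy : G.Adj x y) (hz : G.Adj x z)
    (hyw : G.dist y w < G.dist x w) (hzw : G.dist z w < G.dist x w) : y = z := by
  have hd : ∀ u, G.Adj x u → G.dist u w < G.dist x w → ∃ q : G.Walk u w, ∀ h : G.Adj x u,
      (SimpleGraph.Walk.cons h q).IsPath := by
    intro u hu huw
    obtain ⟨q, hq⟩ := hG.connected.exists_walk_length_eq_dist u w
    refine ⟨q, fun h => SimpleGraph.Walk.isPath_of_length_eq_dist _ ?_⟩
    have := SimpleGraph.dist_le (SimpleGraph.Walk.cons h q)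
    rw [SimpleGraph.Walk.length_cons] at *
    omega
  obtain ⟨p, hp⟩ := hd y hy hyw
  obtain ⟨q, hq⟩ := hd z hz hzw
  have := (hG.isAcyclic.subsingleton_path x w).elim ⟨_, hp hy⟩ ⟨_, hq hz⟩
  have h2 := congrArg (fun p : G.Path x w => p.1.snd) this
  simpa using h2

theorem no_triangle (hG : G.IsTree) (x y z : V) (hxy : G.Adj x y) (hyz : G.Adj y z) :
    ¬ G.Adj x z := fun hxz => by
  refine hG.dist_ne_of_adj x hyz ?_
  rw [SimpleGraph.dist_eq_one_iff_adj.2 hxy, SimpleGraph.dist_eq_one_iff_adj.2 hxz]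

/-- The component containing `u` after deleting the edge `wu` of a tree. -/
def side (G : SimpleGraph V) (w u : V) : Set V := {x | G.dist x u < G.dist x w}

theorem dist_ne (hG : G.IsTree) {w u : V} (h : G.Adj w u) (x : V) :
    G.dist x w ≠ G.dist x u := hG.dist_ne_of_adj x h

theorem side_compl (hG : G.IsTree) {w u : V} (h : G.Adj w u) : (side G w u)ᶜ = side G u w := by
  ext x
  have := dist_ne hG h x
  simp only [side, Set.mem_compl_iff, Set.mem_ofPred_eq]
  omega

theorem self_mem_side {w u : V} (h : G.Adj w u) : u ∈ side G w u := by
  rw [side, Set.mem_ofPred_eq, SimpleGraph.dist_self, SimpleGraph.dist_comm,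
    SimpleGraph.dist_eq_one_iff_adj.2 h]
  exact one_pos

theorem notMem_side (w u : V) : w ∉ side G w u := by
  simp [side]

theorem dist_of_mem_side (hG : G.IsTree) {w u x : V} (h : G.Adj w u) (hx : x ∈ side G w u) :
    G.dist x w = G.dist x u + 1 := by
  have h1 := hG.connected.dist_triangle (u := x) (v := u) (w := w)
  rw [SimpleGraph.dist_comm (u := u), SimpleGraph.dist_eq_one_iff_adj.2 h] at h1
  rw [side, Set.mem_ofPred_eq] at hx
  omega

theorem side_isTree (hG : G.IsTree) {w u : V} (h : G.Adj w u) : (G.induce (side G w u)).IsTree := by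
  refine ⟨?_, hG.isAcyclic.induce _⟩
  rw [SimpleGraph.connected_iff_exists_forall_reachable]
  refine ⟨⟨u, self_mem_side h⟩, ?_⟩
  suffices ∀ k, ∀ x : side G w u, G.dist x u = k →
      (G.induce (side G w u)).Reachable ⟨u, self_mem_side h⟩ x from fun x => this _ x rfl
  intro k
  induction k with
  | zero =>
    intro x hx
    have := hG.connected.dist_eq_zero_iff.1 hx
    rw [show x = ⟨u, self_mem_side h⟩ from Subtype.ext this]
  | succ k ih =>
    intro x hx
    have hxu : (x : V) ≠ u := by
      intro e
      rw [e, SimpleGraph.dist_self] at hx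
      omega
    obtain ⟨y, hy, hyd⟩ := exists_parent hG.connected hxu
    have h1 := dist_of_mem_side hG h x.2
    have h2 := hG.connected.dist_triangle (u := (x : V)) (v := y) (w := w)
    rw [SimpleGraph.dist_eq_one_iff_adj.2 hy] at h2
    have hys : y ∈ side G w u := by
      rw [side, Set.mem_ofPred_eq]
      omega
    refine (ih ⟨y, hys⟩ (by change G.dist y u = k; omega)).trans (SimpleGraph.Adj.reachable ?_)
    exact hy.symm

theorem branch_unique (hG : G.IsTree) {w u v x : V} (hu : G.Adj w u) (hv : G.Adj w v)
    (hxu : x ∈ side G w u) (hxv : x ∈ side G w v) : u = v := by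
  rw [side, Set.mem_ofPred_eq, SimpleGraph.dist_comm, SimpleGraph.dist_comm (v := w)] at hxu hxv
  exact parent_unique hG hu hv hxu hxv

theorem side_subset (hG : G.IsTree) {w u v : V} (hu : G.Adj w u) (hv : G.Adj u v) (hvw : v ≠ w) :
    side G u v ⊆ side G w u := by
  intro x hx
  by_contra hx'
  rw [← Set.mem_compl_iff, side_compl hG hu] at hx'
  exact hvw (branch_unique hG hv hu.symm hx hx')

/-- A tree without an edge separating it into two parts that are not stars has a vertex all of
whose branches are stars. -/
theorem exists_root [Finite V] (hG : G.IsTree)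
    (h : ∀ w u, G.Adj w u → IsStar (G.induce (side G w u)) ∨ IsStar (G.induce (side G u w))) :
    ∃ w, ∀ u, G.Adj w u → IsStar (G.induce (side G w u)) := by
  by_contra! hcon
  have hne := hG.connected.nonempty
  suffices ∀ k, ∀ w u, G.Adj w u → ¬ IsStar (G.induce (side G w u)) →
      (side G w u).ncard ≠ k by
    obtain ⟨w⟩ := hne
    obtain ⟨u, hu, hu'⟩ := hcon w
    exact this _ w u hu hu' rfl
  intro k
  induction k using Nat.strong_induction_on with
  | _ k ih =>
    intro w u hu hs hk
    obtain ⟨v, hv, hvs⟩ := hcon u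
    by_cases hvw : v = w
    · subst hvw
      exact (h v u hu).elim hs hvs
    · refine ih _ ?_ u v hv hvs rfl
      rw [← hk]
      refine Set.ncard_lt_ncard ⟨side_subset hG hu hv hvw, fun hsub => ?_⟩ (Set.toFinite _)
      exact notMem_side u v (hsub (self_mem_side hu))

theorem exists_spider (hG : G.IsTree) {w : V}
    (h : ∀ u, G.Adj w u → IsStar (G.induce (side G w u))) : ∃ b r : V → V, Spider G w b r := by
  classical
  have hb : ∀ v, ∃ u, v ≠ w → G.Adj w u ∧ v ∈ side G w u := by
    intro v
    by_cases hv : v = w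
    · exact ⟨v, fun h => absurd hv h⟩
    · obtain ⟨u, hu, hd⟩ := exists_parent hG.connected (Ne.symm hv)
      refine ⟨u, fun _ => ⟨hu, ?_⟩⟩
      rw [side, Set.mem_ofPred_eq, SimpleGraph.dist_comm, SimpleGraph.dist_comm (v := w)]
      omega
  have hr : ∀ u, ∃ c, G.Adj w u → c ∈ side G w u ∧ (∀ x ∈ side G w u, x ≠ c → G.Adj c x) ∧
      (c ≠ u → ∃ v ∈ side G w u, v ≠ u ∧ v ≠ c) := by
    intro u
    by_cases hu : G.Adj w u
    · by_cases hc : ∀ x ∈ side G w u, x ≠ u → G.Adj u x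
      · exact ⟨u, fun _ => ⟨self_mem_side hu, hc, fun h => absurd rfl h⟩⟩
      · push Not at hc
        obtain ⟨v, hv, hvu, hva⟩ := hc
        obtain ⟨⟨c, hcs⟩, hcx⟩ := h u hu
        have hcx' : ∀ x ∈ side G w u, x ≠ c → G.Adj c x := fun x hx hxc =>
          hcx ⟨x, hx⟩ fun e => hxc (congrArg Subtype.val e)
        refine ⟨c, fun _ => ⟨hcs, hcx', fun hcu => ⟨v, hv, hvu, ?_⟩⟩⟩
        rintro rfl
        exact hva (hcx' u (self_mem_side hu) hcu.symm).symm
    · exact ⟨u, fun h => absurd h hu⟩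
  choose b hb using hb
  choose r hr using hr
  have hbu : ∀ u v, G.Adj w u → v ∈ side G w u → b v = u := fun u v hu hv => by
    have hvw : v ≠ w := fun e => notMem_side (G := G) w u (e ▸ hv)
    exact branch_unique hG (hb v hvw).1 hu (hb v hvw).2 hv
  refine ⟨b, r, fun v hv => (hb v hv).1, fun u hu => hbu u u hu (self_mem_side hu),
    fun u hu e => notMem_side (G := G) w u (e ▸ (hr u hu).1), fun u hu => hbu _ _ hu (hr u hu).1,
    fun v hv hvr => ?_, fun u hu hur => ?_⟩
  · obtain ⟨h1, h2⟩ := hb v hv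
    exact ((hr _ h1).2.1 v h2 hvr).symm
  · obtain ⟨v, hv, h1, h2⟩ := (hr u hu).2.2 hur
    exact ⟨v, fun e => notMem_side (G := G) w u (e ▸ hv), hbu u v hu hv, h1, h2⟩

theorem four_le_card [Fintype V] (hG : G.IsTree) (hs : ¬ IsStar G) : 4 ≤ Fintype.card V := by
  classical
  obtain ⟨w⟩ := hG.connected.nonempty
  simp only [IsStar, not_exists, not_forall] at hs
  obtain ⟨c, a, hac, hwa, hcw⟩ : ∃ c a, G.Adj a c ∧ G.Adj w a ∧ c ≠ w := by
    obtain ⟨x, hx, hxw⟩ := hs w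
    have hne : ∃ k, ∃ x, x ≠ w ∧ ¬ G.Adj w x ∧ G.dist x w = k := ⟨_, x, hx, hxw, rfl⟩
    obtain ⟨x, hx, hxw, hk⟩ := Nat.find_spec hne
    obtain ⟨y, hy, hyd⟩ := exists_parent hG.connected hx
    refine ⟨x, y, hy.symm, ?_, hx⟩
    by_contra hwy
    refine Nat.find_min hne (m := G.dist y w) (by omega) ⟨y, ?_, hwy, rfl⟩
    rintro rfl
    exact hxw hy.symm
  obtain ⟨y, hya, hay⟩ := hs a
  have hyw : y ≠ w := fun e => hay (e ▸ hwa.symm)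
  have hyc : y ≠ c := fun e => hay (e ▸ hac)
  calc 4 = #({w, a, c, y} : Finset V) := by
        rw [Finset.card_insert_of_notMem, Finset.card_insert_of_notMem, Finset.card_pair hyc.symm]
        · simp [hac.ne, hya.symm]
        · simp [hwa.ne, hcw.symm, hyw.symm]
    _ ≤ _ := Finset.card_le_univ _

end TreeSides

section DoubleStars

variable {V : Type} [Fintype V] [DecidableEq V] {G : SimpleGraph V} [DecidableRel G.Adj]

/-- Adjacent vertices `w` and `r`, with `w` joined to `A` and `r` joined to the rest. -/
structure Dominated (G : SimpleGraph V) (w r : V) (A : Finset V) : Prop where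
  adj : G.Adj w r
  w_notMem : w ∉ A
  r_notMem : r ∉ A
  adj_w : ∀ v ∈ A, G.Adj w v
  adj_r : ∀ v ∉ A, v ≠ w → v ≠ r → G.Adj r v

/-- The vertices outside `A`, `w` and `r`. -/
def outer (w r : V) (A : Finset V) : Finset V := {v | v ∉ A ∧ v ≠ w ∧ v ≠ r}

theorem IsDoubleStar.dominated (h : IsDoubleStar G)
    (htri : ∀ x y z, G.Adj x y → G.Adj y z → ¬ G.Adj x z) :
    ∃ w r A, Dominated G w r A ∧ (∃ p, p ∈ A) ∧ ∃ q, q ∈ outer w r A := by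
  obtain ⟨w, r, hwr, ⟨p, hp, hwp⟩, ⟨q, hq, hrq⟩, hd⟩ := h
  refine ⟨w, r, ({x | x ≠ r ∧ G.Adj w x} : Finset V), ⟨hwr, by simp, by simp, fun v hv => by simp_all,
    fun v hv h1 h2 => ?_⟩, ⟨p, by simp [hp, hwp]⟩, q, ?_⟩
  · simp only [Finset.mem_filter, mem_univ, true_and, not_and] at hv
    exact (hd v h1 h2).resolve_left (hv h2)
  · have := htri w r q hwr hrq
    simp [outer, hq, this, hrq.ne']

namespace Dominated

variable {w r : V} {A : Finset V}

omit [DecidableRel G.Adj] in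
theorem sum_eq (h : Dominated G w r A) (φ : V → ℝ) :
    ∑ v, φ v = φ w + φ r + ∑ v ∈ A, φ v + ∑ v ∈ outer w r A, φ v := by
  have h1 : (univ : Finset V) = insert w (insert r (A ∪ outer w r A)) := by
    ext v
    simp only [outer, mem_univ, Finset.mem_insert, Finset.mem_union, Finset.mem_filter, true_and,
      true_iff]
    tauto
  have h2 : Disjoint A (outer w r A) := by
    rw [Finset.disjoint_left]
    intro v hv
    simp [outer, hv]
  rw [h1, Finset.sum_insert, Finset.sum_insert, Finset.sum_union h2]
  · ring
  · simp [outer, h.r_notMem]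
  · simp [outer, h.w_notMem, h.adj.ne]

omit [DecidableRel G.Adj] in
theorem card_eq (h : Dominated G w r A) :
    (Fintype.card V : ℝ) = #A + #(outer w r A) + 2 := by
  have := h.sum_eq fun _ => 1
  simp only [Finset.sum_const, card_univ, nsmul_eq_mul, mul_one] at this
  linarith

theorem sum_le_energy (h : Dominated G w r A) (x : V → ℝ) :
    (x w - x r) ^ 2 + ∑ v ∈ A, (x v - x w) ^ 2 + ∑ v ∈ outer w r A, (x v - x r) ^ 2 ≤
      energy G x := by
  have hadj : ∀ v : {v // v ≠ w}, G.Adj v.1 (if v.1 ∈ A ∨ v.1 = r then w else r) := by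
    rintro ⟨v, hv⟩
    dsimp only
    split_ifs with h1
    · rcases h1 with h1 | rfl
      · exact (h.adj_w v h1).symm
      · exact h.adj.symm
    · rw [not_or] at h1
      exact (h.adj_r v h1.1 hv h1.2).symm
  have h1 := sum_edges_le_energy (G := G) (fun v : {v // v ≠ w} => v.1)
    (fun v => if v.1 ∈ A ∨ v.1 = r then w else r) hadj (by
      rintro ⟨v, hv⟩ ⟨u, hu⟩ he
      simp only [Sym2.eq_iff] at he
      rcases he with he | he
      · exact Subtype.ext he.1
      · have h2 := he.1
        have h3 := he.2
        by_cases h4 : u ∈ A ∨ u = r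
        · exact absurd (by simpa [h4] using h2) hv
        · rw [if_neg h4] at h2
          rw [if_pos (Or.inr h2)] at h3
          exact absurd h3.symm hu) x
  rw [← Finset.sum_subtype (univ.filter fun v => v ≠ w) (by simp)
    (fun v => (x v - x (if v ∈ A ∨ v = r then w else r)) ^ 2), Finset.sum_filter, h.sum_eq] at h1
  refine le_trans (le_of_eq ?_) h1
  simp only [ne_eq, not_true, if_false, h.adj.ne', not_false_eq_true, if_true, or_true]
  have h2 : ∀ v ∈ A, (if ¬v = w then (x v - x (if v ∈ A ∨ v = r then w else r)) ^ 2 else 0) =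
      (x v - x w) ^ 2 := fun v hv => by
    rw [if_pos (by rintro rfl; exact h.w_notMem hv), if_pos (Or.inl hv)]
  have h3 : ∀ v ∈ outer w r A,
      (if ¬v = w then (x v - x (if v ∈ A ∨ v = r then w else r)) ^ 2 else 0) =
      (x v - x r) ^ 2 := fun v hv => by
    simp only [outer, Finset.mem_filter, mem_univ, true_and] at hv
    rw [if_pos hv.2.1, if_neg (not_or.2 ⟨hv.1, hv.2.2⟩)]
  rw [Finset.sum_congr rfl h2, Finset.sum_congr rfl h3]
  ring

theorem lev_one (h : Dominated G w r A) {y : ℝ} (hy : y < 1) (α β : ℝ)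
    (hq : ∀ s t : ℝ, α * s + β * t = 0 →
      (y + #A * (y / (1 - y))) * s ^ 2 + (y + #(outer w r A) * (y / (1 - y))) * t ^ 2 ≤
        (s - t) ^ 2) : Lev G 1 y := by
  refine ⟨{w}, fun _ => α • ev w + β • ev r, by simp, fun x hx => ?_⟩
  have h1 := hq (x w) (x r) (by simpa [ev_apply] using hx w (by simp))
  refine le_trans ?_ (h.sum_le_energy x)
  have h2 := star_sum_le A x (x w) hy
  have h3 := star_sum_le (outer w r A) x (x r) hy
  rw [dotProduct_self_eq, h.sum_eq]
  linarith

theorem lev_two (h : Dominated G w r A) : Lev G 2 1 := by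
  refine ⟨{w, r}, ev, Finset.card_le_two, fun x hx => ?_⟩
  have h1 : x w = 0 := hx w (by simp)
  have h2 : x r = 0 := hx r (by simp)
  refine le_trans (le_of_eq ?_) (h.sum_le_energy x)
  rw [dotProduct_self_eq, h.sum_eq]
  simp [h1, h2]

omit [DecidableRel G.Adj] in
theorem card_ge (h : Dominated G w r A) {p q : V} (hp : p ∈ A) (hq : q ∈ outer w r A) :
    4 ≤ Fintype.card V := by
  have h1 := h.card_eq
  have h2 := Finset.card_pos.2 ⟨p, hp⟩
  have h3 := Finset.card_pos.2 ⟨q, hq⟩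
  have h1' : Fintype.card V = #A + #(outer w r A) + 2 := by exact_mod_cast h1
  omega

theorem lev_matched (h : Dominated G w r A) {p q : V} (hp : p ∈ A) (hq : q ∈ outer w r A) :
    Lev G (Fintype.card V - 2) 2 := by
  simp only [outer, Finset.mem_filter, mem_univ, true_and] at hq
  have hm : Matched G {w, r} (fun v => if v = w then p else q) := by
    have hpw : p ≠ w := by rintro rfl; exact h.w_notMem hp
    have hpr : p ≠ r := by rintro rfl; exact h.r_notMem hp
    have hpq : p ≠ q := by rintro rfl; exact hq.1 hp
    refine ⟨?_, ?_, ?_⟩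
    · simp [h.adj.ne', h.adj_w p hp, h.adj_r q hq.1 hq.2.1 hq.2.2]
    · simp [Set.InjOn, h.adj.ne', hpq, hpq.symm]
    · simp [h.adj.ne', hpw, hpr, hq.2]
  have := hm.lev
  rwa [Finset.card_pair h.adj.ne] at this

theorem cert (h : Dominated G w r A) (hA : ∃ p, p ∈ A) (hB : ∃ q, q ∈ outer w r A) {y : ℝ}
    (hy0 : 0 ≤ y) (hy1 : y ≤ 1) (hl : Lev G 1 y) {ε : ℝ} (hε0 : 0 ≤ ε) (hε : ε ≤ 1) :
    Cert G (2 - ε) (Fintype.card V * (1 - ε) - (y - 2 * ε)) := by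
  obtain ⟨p, hp⟩ := hA
  obtain ⟨q, hq⟩ := hB
  obtain ⟨k, hk⟩ := Nat.exists_eq_add_of_le (h.card_ge hp hq)
  let z : Unit ⊕ Unit ⊕ Fin k ⊕ Fin 2 → ℝ := Sum.elim (fun _ => 0) (Sum.elim (fun _ => y)
    (Sum.elim (fun _ => 1) (fun _ => 2 - ε)))
  refine (cert_of_lev (G := G) (by linarith) z ?_ ?_).mono (le_of_eq ?_)
  · rintro (i | i | i | i) <;> simp only [z, Sum.elim_inl, Sum.elim_inr] <;>
      constructor <;> linarith
  · intro t ht0 ht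
    have hc : #{i | z i < t} = (if 0 < t then 1 else 0) + ((if y < t then 1 else 0) +
        ((if 1 < t then k else 0) + (if 2 - ε < t then 2 else 0))) := by
      rw [Finset.card_filter, Fintype.sum_sum_type, Fintype.sum_sum_type, Fintype.sum_sum_type]
      simp only [z, Sum.elim_inl, Sum.elim_inr]
      by_cases h1 : y < t <;> by_cases h2 : 1 < t <;> by_cases h3 : 2 - ε < t <;>
        simp [ht0, h1, h2, h3]
    rw [hc, if_pos ht0]
    rcases le_or_gt t y with h1 | h1
    · exact hl.mono (by omega) h1
    rcases le_or_gt t 1 with h2 | h2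
    · exact h.lev_two.mono (by rw [if_pos h1]; omega) h2
    · exact (h.lev_matched hp hq).mono (by rw [if_pos h1, if_pos h2]; omega) (by linarith)
  · rw [Fintype.sum_sum_type, Fintype.sum_sum_type, Fintype.sum_sum_type, hk]
    simp [z]
    ring

/-- The crude bound coming from the antisymmetric functional. -/
theorem cert_crude (h : Dominated G w r A) (hA : ∃ p, p ∈ A) (hB : ∃ q, q ∈ outer w r A)
    {ε : ℝ} (hε0 : 0 ≤ ε) (hε : ε ≤ 1) :
    Cert G (2 - ε) (Fintype.card V * (1 - ε) - (4 / (Fintype.card V + 4) - 2 * ε)) := by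
  have h4 : (4 : ℝ) ≤ Fintype.card V := by
    obtain ⟨p, hp⟩ := hA
    obtain ⟨q, hq⟩ := hB
    exact_mod_cast h.card_ge hp hq
  have hc := h.card_eq
  set m : ℝ := (Fintype.card V : ℝ)
  have hy : 4 / (m + 4) ≤ 1 / 2 := by rw [div_le_div_iff₀] <;> linarith
  have he : 1 - 4 / (m + 4) = m / (m + 4) := by field_simp; ring
  refine h.cert hA hB (by positivity) (by linarith)
    (h.lev_one (by linarith) 1 1 fun s t hst => ?_) hε0 hε
  obtain rfl : t = -s := by linarith
  have h2 : 4 / (m + 4) / (1 - 4 / (m + 4)) = 4 / m := by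
    rw [he]; field_simp
  rw [h2]
  have h3 : 2 * (4 / (m + 4)) + (#A + #(outer w r A) : ℝ) * (4 / m) ≤ 4 := by
    rw [show (#A + #(outer w r A) : ℝ) = m - 2 by linarith]
    have : 4 - (2 * (4 / (m + 4)) + (m - 2) * (4 / m)) = 32 / (m * (m + 4)) := by
      field_simp; ring
    have : 0 ≤ 32 / (m * (m + 4)) := by positivity
    linarith
  nlinarith [sq_nonneg s, mul_le_mul_of_nonneg_right h3 (sq_nonneg s)]

end Dominated

end DoubleStars

section Trees

variable {V : Type} [Fintype V] [DecidableEq V] {G : SimpleGraph V} [DecidableRel G.Adj]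

/-- The saving of a double star on `m` vertices. -/
theorem cert_or_saving {m : ℕ} (hm : Fintype.card V = m) (hG : G.IsTree) {ε : ℝ} (hε0 : 0 ≤ ε)
    (hε : ε ≤ 1 / 3) (hH : ¬ IsDoubleStar G → Cert G (2 - ε) (m * (1 - ε))) :
    ∃ δ : ℝ, Cert G (2 - ε) (m * (1 - ε) - δ) ∧ (δ = 0 ∨ δ = 4 / (m + 4) - 2 * ε) := by
  by_cases hd : IsDoubleStar G
  · obtain ⟨w, r, A, h, hA, hB⟩ := hd.dominated (no_triangle hG)
    refine ⟨_, ?_, Or.inr rfl⟩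
    rw [← hm]
    exact h.cert_crude hA hB hε0 (by linarith)
  · exact ⟨0, by simpa using hH hd, Or.inl rfl⟩

theorem saving_nonneg {m k ε δ δ' : ℝ} (hm : 4 ≤ m) (hk : 4 ≤ k) (hε : ε * (m + k) ≤ 2)
    (hδ : δ = 0 ∨ δ = 4 / (m + 4) - 2 * ε) (hδ' : δ' = 0 ∨ δ' = 4 / (k + 4) - 2 * ε) :
    0 ≤ δ + δ' := by
  have hε' : ε ≤ 2 / (m + k) := by rwa [le_div_iff₀ (by linarith)]
  have h1 : 4 / (m + k) ≤ 4 / (m + 4) := by gcongr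
  have h2 : 4 / (m + k) ≤ 4 / (k + 4) := by rw [add_comm m k]; gcongr
  have h3 : 4 / (m + k) = 2 * (2 / (m + k)) := by ring
  rcases hδ with rfl | rfl <;> rcases hδ' with rfl | rfl
  · simp
  · linarith
  · linarith
  · have h4 : 8 / (m + k) ≤ 4 / (m + 4) + 4 / (k + 4) := by
      rw [div_add_div _ _ (by positivity) (by positivity), div_le_div_iff₀ (by positivity)
        (by positivity)]
      nlinarith [mul_nonneg (sub_nonneg.2 hm) (sub_nonneg.2 hk), sq_nonneg (m - k)]
    have h5 : 8 / (m + k) = 4 * (2 / (m + k)) := by ring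
    linarith

theorem cert_of_isTree (n : ℕ) (hn : Fintype.card V = n) (hG : G.IsTree) (hs : ¬ IsStar G)
    (hd : ¬ IsDoubleStar G) {ε : ℝ} (hε0 : 0 ≤ ε) (hε : ε ≤ 1 / 3) (hεn : ε * n ≤ 2) :
    Cert G (2 - ε) (n * (1 - ε)) := by
  classical
  induction n using Nat.strong_induction_on generalizing V with
  | _ n ih =>
  by_cases hcut : ∀ w u, G.Adj w u → IsStar (G.induce (side G w u)) ∨
      IsStar (G.induce (side G u w))
  · obtain ⟨w, hw⟩ := exists_root hG hcut
    obtain ⟨b, r, hsp⟩ := exists_spider hG hw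
    rw [← hn] at hεn ⊢
    exact hsp.cert (no_triangle hG) hs hd hε0 hε hεn
  · push Not at hcut
    obtain ⟨w, u, hwu, h1, h2⟩ := hcut
    rw [← side_compl hG hwu] at h2
    have ht1 := side_isTree hG hwu
    have ht2 := side_isTree hG hwu.symm
    rw [← side_compl hG hwu] at ht2
    set S := side G w u
    have hc : Fintype.card S + Fintype.card ↥Sᶜ = n := by
      rw [← hn, Fintype.card_compl_set, Nat.add_sub_cancel' (set_fintype_card_le_univ S)]
    have h4 := four_le_card ht1 h1
    have h4' := four_le_card ht2 h2
    have hm : (4 : ℝ) ≤ Fintype.card S := by exact_mod_cast h4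
    have hm' : (4 : ℝ) ≤ Fintype.card ↥Sᶜ := by exact_mod_cast h4'
    have hc' : (Fintype.card S + Fintype.card ↥Sᶜ : ℝ) = n := by exact_mod_cast hc
    rw [← hc'] at hεn ⊢
    obtain ⟨δ, hδ, hδ'⟩ := cert_or_saving rfl ht1 hε0 hε fun hd1 =>
      ih _ (by omega) rfl ht1 h1 hd1 (by nlinarith)
    obtain ⟨η, hη, hη'⟩ := cert_or_saving rfl ht2 hε0 hε fun hd2 =>
      ih _ (by omega) rfl ht2 h2 hd2 (by nlinarith)
    have h5 := saving_nonneg hm hm' hεn hδ' hη'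
    exact (Cert.glue hδ hη).mono (by linarith)

end Trees

section ExactDoubleStars

variable {V : Type} [Fintype V] [DecidableEq V] {G : SimpleGraph V} [DecidableRel G.Adj]

/-- `G` consists of the edges `wr`, `wv` for `v ∈ A`, and `rv` for all other `v`. -/
structure DoubleStarAt (G : SimpleGraph V) (w r : V) (A : Finset V) : Prop where
  ne : w ≠ r
  w_notMem : w ∉ A
  r_notMem : r ∉ A
  adj_iff : ∀ u v, G.Adj u v ↔ (u = w ∧ (v = r ∨ v ∈ A)) ∨ (v = w ∧ (u = r ∨ u ∈ A)) ∨
    (u = r ∧ v ∈ outer w r A) ∨ (v = r ∧ u ∈ outer w r A)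

omit [DecidableRel G.Adj] in
theorem mem_outer {w r v : V} {A : Finset V} : v ∈ outer w r A ↔ v ∉ A ∧ v ≠ w ∧ v ≠ r := by
  simp [outer]

omit [DecidableRel G.Adj] in
theorem Dominated.doubleStarAt {w r : V} {A : Finset V} (h : Dominated G w r A)
    (hG : G.IsTree) : DoubleStarAt G w r A := by
  refine ⟨h.adj.ne, h.w_notMem, h.r_notMem, fun u v => ⟨fun huv => ?_, ?_⟩⟩
  · have htri := no_triangle hG
    have hR : ∀ u, u ∈ outer w r A → G.Adj r u := fun u hu => by
      rw [mem_outer] at hu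
      exact h.adj_r u hu.1 hu.2.1 hu.2.2
    have hW' : ∀ u, u ∈ outer w r A → ¬ G.Adj w u := fun u hu => htri w r u h.adj (hR u hu)
    have hR' : ∀ u, u ∈ A → ¬ G.Adj r u := fun u hu => htri r w u h.adj.symm (h.adj_w u hu)
    have hN : ∀ u v, u ∈ A → v ∈ outer w r A → ¬ G.Adj v u := fun u v hu hv huv => by
      have h1 : G.dist v w ≠ 0 := by
        rw [Ne, hG.connected.dist_eq_zero_iff]
        exact (mem_outer.1 hv).2.1
      have h2 : G.dist v w ≠ 1 := fun h => hW' v hv (SimpleGraph.dist_eq_one_iff_adj.1 h).symm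
      refine h.r_notMem ((parent_unique hG huv (hR v hv).symm (w := w) ?_ ?_) ▸ hu)
      · rw [SimpleGraph.dist_eq_one_iff_adj.2 (h.adj_w u hu).symm]; omega
      · rw [SimpleGraph.dist_eq_one_iff_adj.2 h.adj.symm]; omega
    have hcl : ∀ u, u = w ∨ u = r ∨ u ∈ A ∨ u ∈ outer w r A := fun u => by
      rw [mem_outer]; tauto
    rcases hcl u with rfl | rfl | hu | hu <;> rcases hcl v with rfl | rfl | hv | hv
    · exact absurd rfl huv.ne
    · exact Or.inl ⟨rfl, Or.inl rfl⟩
    · exact Or.inl ⟨rfl, Or.inr hv⟩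
    · exact absurd huv (hW' _ hv)
    · exact Or.inr (Or.inl ⟨rfl, Or.inl rfl⟩)
    · exact absurd rfl huv.ne
    · exact absurd huv (hR' _ hv)
    · exact Or.inr (Or.inr (Or.inl ⟨rfl, hv⟩))
    · exact Or.inr (Or.inl ⟨rfl, Or.inr hu⟩)
    · exact absurd huv.symm (hR' _ hu)
    · exact absurd (h.adj_w v hv) (htri w u v (h.adj_w u hu) huv)
    · exact absurd huv.symm (hN _ _ hu hv)
    · exact absurd huv.symm (hW' _ hu)
    · exact Or.inr (Or.inr (Or.inr ⟨rfl, hu⟩))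
    · exact absurd huv (hN _ _ hv hu)
    · exact absurd (hR v hv) (htri r u v (hR u hu) huv)
  · rintro (⟨rfl, rfl | h1⟩ | ⟨rfl, rfl | h1⟩ | ⟨rfl, h1⟩ | ⟨rfl, h1⟩)
    · exact h.adj
    · exact h.adj_w v h1
    · exact h.adj.symm
    · exact (h.adj_w u h1).symm
    · rw [mem_outer] at h1
      exact h.adj_r v h1.1 h1.2.1 h1.2.2
    · rw [mem_outer] at h1
      exact (h.adj_r u h1.1 h1.2.1 h1.2.2).symm

namespace DoubleStarAt

variable {w r : V} {A : Finset V}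

omit [DecidableRel G.Adj] in
theorem dominated (h : DoubleStarAt G w r A) : Dominated G w r A where
  adj := by simp [h.adj_iff]
  w_notMem := h.w_notMem
  r_notMem := h.r_notMem
  adj_w v hv := by simp [h.adj_iff, hv]
  adj_r v h1 h2 h3 := by simp [h.adj_iff, mem_outer, h1, h2, h3]

theorem neighborFinset_w (h : DoubleStarAt G w r A) : G.neighborFinset w = insert r A := by
  ext v
  have := h.w_notMem
  simp [h.adj_iff, mem_outer, h.ne, this]

theorem neighborFinset_r (h : DoubleStarAt G w r A) :
    G.neighborFinset r = insert w (outer w r A) := by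
  ext v
  have := h.r_notMem
  have := h.ne
  simp [h.adj_iff, mem_outer, h.ne.symm, h.r_notMem]

theorem neighborFinset_mem (h : DoubleStarAt G w r A) {v : V} (hv : v ∈ A) :
    G.neighborFinset v = {w} := by
  ext u
  have h1 : v ≠ w := by rintro rfl; exact h.w_notMem hv
  have h2 : v ≠ r := by rintro rfl; exact h.r_notMem hv
  simp [h.adj_iff, mem_outer, h1, h2, hv]

theorem neighborFinset_outer (h : DoubleStarAt G w r A) {v : V} (hv : v ∈ outer w r A) :
    G.neighborFinset v = {r} := by
  ext u
  have h0 := hv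
  rw [mem_outer] at hv
  simp [h.adj_iff, hv, h0]

theorem lap_w (h : DoubleStarAt G w r A) (x : V → ℝ) :
    (G.lapMatrix ℝ *ᵥ x) w = (#A + 1) * x w - (x r + ∑ v ∈ A, x v) := by
  rw [SimpleGraph.lapMatrix_mulVec_apply, ← SimpleGraph.card_neighborFinset_eq_degree,
    h.neighborFinset_w, Finset.card_insert_of_notMem h.r_notMem,
    Finset.sum_insert h.r_notMem]
  push_cast
  ring

theorem w_notMem_outer : w ∉ outer w r A := by simp [mem_outer]

theorem lap_r (h : DoubleStarAt G w r A) (x : V → ℝ) :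
    (G.lapMatrix ℝ *ᵥ x) r =
      (#(outer w r A) + 1) * x r - (x w + ∑ v ∈ outer w r A, x v) := by
  rw [SimpleGraph.lapMatrix_mulVec_apply, ← SimpleGraph.card_neighborFinset_eq_degree,
    h.neighborFinset_r, Finset.card_insert_of_notMem w_notMem_outer,
    Finset.sum_insert w_notMem_outer]
  push_cast
  ring

theorem lap_mem (h : DoubleStarAt G w r A) (x : V → ℝ) {v : V} (hv : v ∈ A) :
    (G.lapMatrix ℝ *ᵥ x) v = x v - x w := by
  rw [SimpleGraph.lapMatrix_mulVec_apply, ← SimpleGraph.card_neighborFinset_eq_degree,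
    h.neighborFinset_mem hv]
  simp

theorem lap_outer (h : DoubleStarAt G w r A) (x : V → ℝ) {v : V} (hv : v ∈ outer w r A) :
    (G.lapMatrix ℝ *ᵥ x) v = x v - x r := by
  rw [SimpleGraph.lapMatrix_mulVec_apply, ← SimpleGraph.card_neighborFinset_eq_degree,
    h.neighborFinset_outer hv]
  simp

theorem avgDeg_eq (h : DoubleStarAt G w r A) : avgDeg G = 2 - 2 / Fintype.card V := by
  have h1 := G.sum_degrees_eq_twice_card_edges
  have h2 : ∑ v, (G.degree v : ℝ) = 2 * #G.edgeFinset := by exact_mod_cast h1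
  have hc := h.dominated.card_eq
  have h3 : ∑ v ∈ A, (G.degree v : ℝ) = #A := by
    rw [Finset.card_eq_sum_ones, Nat.cast_sum]
    refine Finset.sum_congr rfl fun v hv => ?_
    rw [← SimpleGraph.card_neighborFinset_eq_degree, h.neighborFinset_mem hv]
    simp
  have h4 : ∑ v ∈ outer w r A, (G.degree v : ℝ) = #(outer w r A) := by
    rw [Finset.card_eq_sum_ones, Nat.cast_sum]
    refine Finset.sum_congr rfl fun v hv => ?_
    rw [← SimpleGraph.card_neighborFinset_eq_degree, h.neighborFinset_outer hv]
    simp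
  rw [h.dominated.sum_eq, h3, h4, ← SimpleGraph.card_neighborFinset_eq_degree,
    ← SimpleGraph.card_neighborFinset_eq_degree, h.neighborFinset_w, h.neighborFinset_r,
    Finset.card_insert_of_notMem h.r_notMem, Finset.card_insert_of_notMem w_notMem_outer] at h2
  push_cast at h2
  rw [avgDeg, ← h2, hc]
  have : (#A + #(outer w r A) + 2 : ℝ) ≠ 0 := by positivity
  field_simp
  ring

end DoubleStarAt

end ExactDoubleStars

section DoubleStarEnergy

variable {V : Type} [Fintype V] [DecidableEq V] {G : SimpleGraph V} [DecidableRel G.Adj]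

omit [Fintype V] [DecidableEq V] in
theorem linearIndependent_of_orthonormal [Fintype V] {ι : Type*} [Fintype ι] [DecidableEq ι]
    {v : ι → V → ℝ} (ho : ∀ i j, v i ⬝ᵥ v j = if i = j then 1 else 0) :
    LinearIndependent ℝ v := by
  rw [Fintype.linearIndependent_iff]
  intro g hg i
  have := congrArg (v i ⬝ᵥ ·) hg
  simpa [dotProduct_sum, dotProduct_smul, ho] using this

/-- Every eigenvalue appears in a spectral decomposition. -/
theorem exists_eigen_eq {μ : V → ℝ} {v : V → V → ℝ}
    (hL : ∀ i, G.lapMatrix ℝ *ᵥ v i = μ i • v i)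
    (hx : ∀ x : V → ℝ, x = ∑ i, (v i ⬝ᵥ x) • v i) {x : V → ℝ} {y : ℝ} (h0 : x ≠ 0)
    (hy : G.lapMatrix ℝ *ᵥ x = y • x) : ∃ i, μ i = y := by
  by_contra! hne
  refine h0 ?_
  rw [hx x]
  refine Finset.sum_eq_zero fun i _ => ?_
  have h1 : v i ⬝ᵥ (G.lapMatrix ℝ *ᵥ x) = (G.lapMatrix ℝ *ᵥ v i) ⬝ᵥ x := by
    rw [dotProduct_mulVec, ← mulVec_transpose, (G.isSymm_lapMatrix (R := ℝ)).eq]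
  rw [hL, hy, dotProduct_smul, smul_dotProduct, smul_eq_mul, smul_eq_mul] at h1
  have h2 : (y - μ i) * (v i ⬝ᵥ x) = 0 := by linarith
  rw [(mul_eq_zero.1 h2).resolve_left (sub_ne_zero.2 (hne i).symm), zero_smul]

/-- The characteristic polynomial on vectors that are constant on both sets of leaves. -/
def sidePoly (a b y : ℝ) : ℝ :=
  y ^ 3 - (a + b + 4) * y ^ 2 + (a * b + 2 * (a + b) + 5) * y - (a + b + 2)

theorem sidePoly_eq (a b y : ℝ) : y * sidePoly a b y =
    ((1 - y) ^ 2 - a * y) * ((1 - y) ^ 2 - b * y) - (1 - y) ^ 2 := by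
  rw [sidePoly]; ring

namespace DoubleStarAt

variable {w r : V} {A : Finset V}

theorem card_eigen_ne_one (h : DoubleStarAt G w r A) {μ : V → ℝ} {v : V → V → ℝ}
    (hL : ∀ i, G.lapMatrix ℝ *ᵥ v i = μ i • v i)
    (ho : ∀ i j, v i ⬝ᵥ v j = if i = j then 1 else 0) : #{i | μ i ≠ 1} ≤ 4 := by
  let Φ : (Fin 4 → ℝ) →ₗ[ℝ] (V → ℝ) := LinearMap.pi fun u =>
    LinearMap.proj (if u = w then 0 else if u = r then 1 else if u ∈ A then 2 else 3)
  have hΦ : ∀ c u, Φ c u = c (if u = w then 0 else if u = r then 1 else if u ∈ A then 2 else 3) :=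
    fun _ _ => rfl
  let I : Finset V := {i | μ i ≠ 1}
  let c : I → Fin 4 → ℝ := fun i => ![v i w, v i r, (v i w) / (1 - μ i), (v i r) / (1 - μ i)]
  have hc : ∀ i, Φ (c i) = v i := fun i => by
    have hi : 1 - μ i ≠ 0 := by
      have := (Finset.mem_filter.1 i.2).2
      exact sub_ne_zero.2 this.symm
    ext u
    have hu : (G.lapMatrix ℝ *ᵥ v i) u = μ i * v i u := by rw [hL]; rfl
    rw [hΦ]
    split_ifs with h1 h2 h3
    · subst h1; rfl
    · subst h2; rfl
    · rw [h.lap_mem _ h3] at hu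
      change v i w / (1 - μ i) = _
      rw [div_eq_iff hi]; linarith
    · rw [h.lap_outer _ (mem_outer.2 ⟨h3, h1, h2⟩)] at hu
      change v i r / (1 - μ i) = _
      rw [div_eq_iff hi]; linarith
  have hli : LinearIndependent ℝ (fun i : I => v i) :=
    linearIndependent_of_orthonormal fun i j => by
      rw [ho]; exact if_congr Subtype.ext_iff.symm rfl rfl
  have hli' : LinearIndependent ℝ c := by
    refine LinearIndependent.of_comp Φ ?_
    rwa [show Φ ∘ c = fun i : I => v i from funext hc]
  have := hli'.fintype_card_le_finrank
  simpa using this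

/-- The Laplacian energy of a double star. -/
theorem LE_eq (h : DoubleStarAt G w r A) (hA : ∃ p, p ∈ A) (hB : ∃ q, q ∈ outer w r A) {y : ℝ}
    (hy0 : 0 < y) (hy1 : y < 1) (hy : sidePoly #A #(outer w r A) y = 0) :
    LE G = 2 * (Fintype.card V - 2 + 4 / Fintype.card V - y) := by
  have hc := h.dominated.card_eq
  have h4 : 4 ≤ Fintype.card V := by
    obtain ⟨p, hp⟩ := hA
    obtain ⟨q, hq⟩ := hB
    exact h.dominated.card_ge hp hq
  have h4' : (4 : ℝ) ≤ Fintype.card V := by exact_mod_cast h4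
  have : Nonempty V := ⟨w⟩
  have hn : (Fintype.card V : ℝ) ≠ 0 := by positivity
  have hpoly := sidePoly_eq #A #(outer w r A) y
  rw [hy, mul_zero] at hpoly
  have hy' : 1 - y ≠ 0 := by linarith
  apply le_antisymm
  · have hl : Lev G 1 y := by
      refine h.dominated.lev_one hy1 (1 - y - #A * (y / (1 - y))) (-1) fun s t hst => ?_
      obtain rfl : t = (1 - y - #A * (y / (1 - y))) * s := by linarith
      have h1 : (1 - y - #A * (y / (1 - y))) * (1 - y - #(outer w r A) * (y / (1 - y))) = 1 := by
        field_simp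
        linarith
      set P := (1 - y - #A * (y / (1 - y)))
      set Q := (1 - y - #(outer w r A) * (y / (1 - y)))
      have h2 : y + #A * (y / (1 - y)) = 1 - P := by ring
      have h3 : y + #(outer w r A) * (y / (1 - y)) = 1 - Q := by ring
      rw [h2, h3]
      have : (1 - Q) * (P * s) ^ 2 = (P ^ 2 - P * (P * Q)) * s ^ 2 := by ring
      rw [this, h1]
      apply le_of_eq
      ring
    have hε : (2 : ℝ) / Fintype.card V ≤ 1 := by
      rw [div_le_one (by positivity)]; linarith
    have := h.dominated.cert hA hB hy0.le hy1.le hl (ε := 2 / Fintype.card V) (by positivity) hε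
    rw [← h.avgDeg_eq] at this
    refine this.LE_le.trans (le_of_eq ?_)
    field_simp
    ring
  · obtain ⟨μ, v, hs, hL, ho, hx⟩ := exists_lap_eigenbasis G
    rw [LapPaper.LE_eq hs, h.avgDeg_eq]
    obtain ⟨i, hi⟩ := exists_eigen_eq hL hx (x := fun _ => 1) (y := 0)
      (fun h0 => one_ne_zero (congrFun h0 w)) (by
        rw [zero_smul]; exact G.lapMatrix_mulVec_const_eq_zero)
    let x : V → ℝ := fun u =>
      if u = w then (1 - y) * (1 - y)
      else if u = r then ((1 - y) ^ 2 - #A * y) * (1 - y)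
      else if u ∈ A then (1 - y) else ((1 - y) ^ 2 - #A * y)
    have hxw : x w = (1 - y) * (1 - y) := by simp [x]
    have hxr : x r = ((1 - y) ^ 2 - #A * y) * (1 - y) := by simp [x, h.ne.symm]
    have hxA : ∀ u ∈ A, x u = 1 - y := fun u hu => by
      have h1 : u ≠ w := by rintro rfl; exact h.w_notMem hu
      have h2 : u ≠ r := by rintro rfl; exact h.r_notMem hu
      simp [x, h1, h2, hu]
    have hxB : ∀ u ∈ outer w r A, x u = (1 - y) ^ 2 - #A * y := fun u hu => by
      rw [mem_outer] at hu
      simp [x, hu]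
    obtain ⟨j, hj⟩ := exists_eigen_eq hL hx (x := x) (y := y)
      (fun h0 => by
        have := congrFun h0 w
        rw [hxw] at this
        exact mul_ne_zero hy' hy' this) (by
        ext u
        rw [Pi.smul_apply, smul_eq_mul]
        by_cases h1 : u = w
        · subst h1
          rw [h.lap_w, Finset.sum_congr rfl hxA, hxw, hxr, Finset.sum_const, nsmul_eq_mul]
          ring
        by_cases h2 : u = r
        · subst h2
          rw [h.lap_r, Finset.sum_congr rfl hxB, hxw, hxr, Finset.sum_const, nsmul_eq_mul]
          linear_combination -hpoly
        by_cases h3 : u ∈ A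
        · rw [h.lap_mem _ h3, hxA _ h3, hxw]; ring
        · have h4 : u ∈ outer w r A := mem_outer.2 ⟨h3, h1, h2⟩
          rw [h.lap_outer _ h4, hxB _ h4, hxr]; ring)
    have hcard := h.card_eigen_ne_one hL ho
    have hij : i ≠ j := by rintro rfl; linarith
    set c : ℝ := 2 - 2 / Fintype.card V
    have hc1 : 1 ≤ c := by
      have : (2 : ℝ) / Fintype.card V ≤ 1 := by
        rw [div_le_one (by positivity)]; linarith
      linarith
    have hlow : ∀ k, (if μ k = 1 then c - 1 else 0) + (if k = i then c else 0) +
        (if k = j then c - y else 0) ≤ max (c - μ k) 0 := fun k => by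
      by_cases h1 : k = i
      · subst h1
        simp [hi, hij]
      by_cases h2 : k = j
      · subst h2
        simp [hj, h1, hy1.ne]
      by_cases h3 : μ k = 1
      · simp [h1, h2, h3]
      · simp [h1, h2, h3]
    have hsum := Finset.sum_le_sum fun k (_ : k ∈ univ) => hlow k
    rw [Finset.sum_add_distrib, Finset.sum_add_distrib, Finset.sum_ite_eq' univ,
      Finset.sum_ite_eq' univ, if_pos (mem_univ _), if_pos (mem_univ _), ← Finset.sum_filter,
      Finset.sum_const, nsmul_eq_mul] at hsum
    have hcount : Fintype.card V ≤ #{k | μ k = 1} + 4 := by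
      have := Finset.card_filter_add_card_filter_not (s := univ) (fun k => μ k = 1)
      rw [card_univ] at this
      simp only [ne_eq] at hcard
      omega
    have hcount' : (Fintype.card V : ℝ) - 4 ≤ #{k | μ k = 1} := by
      have : (Fintype.card V : ℝ) ≤ #{k | μ k = 1} + 4 := by exact_mod_cast hcount
      linarith
    have h5 : (Fintype.card V - 4) * (c - 1) ≤ #{k | μ k = 1} * (c - 1) :=
      mul_le_mul_of_nonneg_right hcount' (by linarith)
    have h6 : (Fintype.card V - 4) * (c - 1) + c + (c - y) =
        Fintype.card V - 2 + 4 / Fintype.card V - y := by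
      simp only [c]
      field_simp
      ring
    linarith

end DoubleStarAt

end DoubleStarEnergy

section Comparison

theorem sidePoly_lt {a b x y : ℝ} (ha : 0 < a) (hb : 0 < b) (hxy : x < y) (hy : y ≤ 1) :
    sidePoly a b x < sidePoly a b y := by
  have h : sidePoly a b y - sidePoly a b x = (y - x) * (a * b + (a + b + 1) * ((1 - x) + (1 - y)) +
      (1 - x) ^ 2 + (1 - x) * (1 - y) + (1 - y) ^ 2) := by
    rw [sidePoly, sidePoly]; ring
  have hx : 0 ≤ 1 - x := by linarith
  have hy : 0 ≤ 1 - y := by linarith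
  have : 0 < (y - x) * (a * b + (a + b + 1) * ((1 - x) + (1 - y)) +
      (1 - x) ^ 2 + (1 - x) * (1 - y) + (1 - y) ^ 2) := mul_pos (by linarith) (by positivity)
  linarith

theorem exists_sidePoly_root {a b : ℝ} (ha : 0 < a) (hb : 0 < b) :
    ∃ y, 0 < y ∧ y < 1 ∧ sidePoly a b y = 0 := by
  have hcont : ContinuousOn (sidePoly a b) (Set.Icc 0 1) := by
    unfold sidePoly; fun_prop
  have h0 : sidePoly a b 0 < 0 := by rw [sidePoly]; ring_nf; linarith
  have h1 : 0 < sidePoly a b 1 := by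
    have := mul_pos ha hb
    rw [sidePoly]; ring_nf; linarith
  obtain ⟨y, hy, hy0⟩ := intermediate_value_Ioo zero_le_one hcont ⟨h0, h1⟩
  exact ⟨y, hy.1, hy.2, hy0⟩

namespace DoubleStarAt

variable {V : Type} [Fintype V] [DecidableEq V] {G : SimpleGraph V} [DecidableRel G.Adj]
variable {V' : Type} [Fintype V'] [DecidableEq V'] {G' : SimpleGraph V'} [DecidableRel G'.Adj]
variable {w r : V} {A : Finset V} {w' r' : V'} {A' : Finset V'}

theorem LE_lt (h : DoubleStarAt G w r A) (h' : DoubleStarAt G' w' r' A')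
    (hc : Fintype.card V = Fintype.card V') (hA : 0 < #A) (hB : 0 < #(outer w r A))
    (hlt : #A * #(outer w r A) < #A' * #(outer w' r' A')) : LE G < LE G' := by
  have hpos : 0 < #A' * #(outer w' r' A') := by omega
  have hA' : 0 < #A' := pos_of_mul_pos_left hpos (Nat.zero_le _)
  have hB' : 0 < #(outer w' r' A') := pos_of_mul_pos_right hpos (Nat.zero_le _)
  obtain ⟨y, hy0, hy1, hy⟩ := exists_sidePoly_root (Nat.cast_pos.2 hA) (Nat.cast_pos.2 hB)
  obtain ⟨y', hy0', hy1', hy'⟩ := exists_sidePoly_root (Nat.cast_pos.2 hA') (Nat.cast_pos.2 hB')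
  rw [h.LE_eq (Finset.card_pos.1 hA) (Finset.card_pos.1 hB) hy0 hy1 hy,
    h'.LE_eq (Finset.card_pos.1 hA') (Finset.card_pos.1 hB') hy0' hy1' hy', hc]
  have hs := h.dominated.card_eq
  rw [hc, h'.dominated.card_eq] at hs
  have hlt' : (#A * #(outer w r A) : ℝ) < #A' * #(outer w' r' A') := by exact_mod_cast hlt
  have : y' < y := by
    by_contra! hle
    have h1 : sidePoly #A #(outer w r A) y ≤ sidePoly #A #(outer w r A) y' := by
      rcases hle.eq_or_lt with rfl | hlt
      · rfl
      · exact (sidePoly_lt (Nat.cast_pos.2 hA) (Nat.cast_pos.2 hB) hlt hy1'.le).le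
    have h2 : sidePoly #A' #(outer w' r' A') y' - sidePoly #A #(outer w r A) y' =
        (#A' * #(outer w' r' A') - #A * #(outer w r A)) * y' := by
      rw [sidePoly, sidePoly]
      linear_combination (-y' ^ 2 + 2 * y' - 1) * hs
    have h3 := mul_pos (sub_pos.2 hlt') hy0'
    linarith
  linarith

theorem lt_LE (h : DoubleStarAt G w r A) {n : ℕ} (hn : Fintype.card V = n) (hA : 0 < #A)
    (hB : 0 < #(outer w r A)) (hp : 0 < sidePoly #A #(outer w r A) (4 / n)) :
    2 * (n : ℝ) - 4 < LE G := by
  subst hn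
  obtain ⟨y, hy0, hy1, hy⟩ := exists_sidePoly_root (Nat.cast_pos.2 hA) (Nat.cast_pos.2 hB)
  rw [h.LE_eq (Finset.card_pos.1 hA) (Finset.card_pos.1 hB) hy0 hy1 hy]
  have : y < 4 / Fintype.card V := by
    by_contra! hle
    rcases hle.eq_or_lt with he | hlt
    · rw [he, hy] at hp; exact hp.false
    · have := sidePoly_lt (Nat.cast_pos.2 hA) (Nat.cast_pos.2 hB) hlt hy1.le
      linarith
  linarith

omit [DecidableRel G.Adj] in
theorem outer_outer (h : DoubleStarAt G w r A) : outer r w (outer w r A) = A := by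
  ext v
  have h1 : v ∈ A → v ≠ w := by rintro hv rfl; exact h.w_notMem hv
  have h2 : v ∈ A → v ≠ r := by rintro hv rfl; exact h.r_notMem hv
  rw [mem_outer, mem_outer]
  tauto

omit [DecidableRel G.Adj] in
theorem swap (h : DoubleStarAt G w r A) : DoubleStarAt G r w (outer w r A) where
  ne := h.ne.symm
  w_notMem := by simp [mem_outer]
  r_notMem := by simp [mem_outer]
  adj_iff u v := by
    rw [h.outer_outer, h.adj_iff]
    tauto

/-- The role of a vertex in a double star. -/
def color (w r : V) (A : Finset V) (v : V) : Fin 4 :=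
  if v = w then 0 else if v = r then 1 else if v ∈ A then 2 else 3

omit [DecidableRel G.Adj] [Fintype V] in
theorem color_eq_zero {v : V} : color w r A v = 0 ↔ v = w := by
  rw [color]; split_ifs <;> simp_all

omit [DecidableRel G.Adj] in
theorem color_eq_one (h : DoubleStarAt G w r A) {v : V} : color w r A v = 1 ↔ v = r := by
  have := h.ne
  rw [color]; split_ifs <;> simp_all

omit [DecidableRel G.Adj] in
theorem color_eq_two (h : DoubleStarAt G w r A) {v : V} : color w r A v = 2 ↔ v ∈ A := by
  have h1 := h.w_notMem
  have h2 := h.r_notMem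
  rw [color]; split_ifs <;> simp_all

omit [DecidableRel G.Adj] in
theorem color_eq_three {v : V} : color w r A v = 3 ↔ v ∈ outer w r A := by
  rw [mem_outer, color]; split_ifs <;> simp_all

omit [DecidableRel G.Adj] [DecidableRel G'.Adj] in
theorem nonempty_iso (h : DoubleStarAt G w r A) (h' : DoubleStarAt G' w' r' A')
    (hA : #A = #A') (hB : #(outer w r A) = #(outer w' r' A')) : Nonempty (G ≃g G') := by
  have key : ∀ c, Nonempty ({v // color w r A v = c} ≃ {v // color w' r' A' v = c}) := fun c => by
    rw [← Fintype.card_eq, Fintype.card_subtype, Fintype.card_subtype]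
    fin_cases c
    · simp [color_eq_zero, Finset.filter_eq']
    · simp [h.color_eq_one, h'.color_eq_one, Finset.filter_eq']
    · simp [h.color_eq_two, h'.color_eq_two, hA]
    · simp [color_eq_three, hB]
  let e := Equiv.ofFiberEquiv fun c => (key c).some
  have he : ∀ v, color w' r' A' (e v) = color w r A v := Equiv.ofFiberEquiv_map _
  refine ⟨⟨e, fun {u v} => ?_⟩⟩
  rw [h.adj_iff, h'.adj_iff]
  simp only [← h.color_eq_one, ← h.color_eq_two, ← color_eq_three (w := w) (r := r),
    ← h'.color_eq_one, ← h'.color_eq_two, ← color_eq_three (w := w') (r := r'),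
    ← color_eq_zero (w := w) (r := r) (A := A), ← color_eq_zero (w := w') (r := r') (A := A'), he]

end DoubleStarAt

theorem doubleStarAt_doubleStar (a b : ℕ) :
    DoubleStarAt (doubleStar a b) 0 1 {v : Fin (a + b + 2) | 2 ≤ v.1 ∧ v.1 < a + 2} := by
  have h0 : ∀ v : Fin (a + b + 2), v = 0 ↔ v.1 = 0 := fun v => by
    rw [Fin.ext_iff, Fin.val_zero]
  have h1 : ∀ v : Fin (a + b + 2), v = 1 ↔ v.1 = 1 := fun v => by
    rw [Fin.ext_iff, Fin.val_one]
  refine ⟨by simp, by simp, by simp, fun u v => ?_⟩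
  have hu := u.2
  have hv := v.2
  simp only [doubleStar, SimpleGraph.fromRel_adj, mem_outer, ne_eq, h0, h1, Fin.ext_iff,
    Finset.mem_filter, mem_univ, true_and]
  omega

theorem card_doubleStar_left (a b : ℕ) :
    #{v : Fin (a + b + 2) | 2 ≤ v.1 ∧ v.1 < a + 2} = a := by
  rw [← Finset.card_map Fin.valEmbedding, show Finset.map _ _ = Finset.Ico 2 (a + 2) from ?_,
    Nat.card_Ico, Nat.add_sub_cancel]
  ext k
  simp only [Finset.mem_map, Finset.mem_filter, mem_univ, true_and, Fin.valEmbedding_apply,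
    Finset.mem_Ico]
  exact ⟨by rintro ⟨v, hv, rfl⟩; exact hv, fun hk => ⟨⟨k, by omega⟩, hk, rfl⟩⟩

theorem card_doubleStar_right (a b : ℕ) :
    #(outer 0 1 {v : Fin (a + b + 2) | 2 ≤ v.1 ∧ v.1 < a + 2}) = b := by
  have := (doubleStarAt_doubleStar a b).dominated.card_eq
  rw [card_doubleStar_left, Fintype.card_fin] at this
  have h : a + b + 2 = a + #(outer 0 1 {v : Fin (a + b + 2) | 2 ≤ v.1 ∧ v.1 < a + 2}) + 2 := by
    exact_mod_cast this
  omega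

theorem IsStar.nonempty_iso {V : Type} [Fintype V] {G : SimpleGraph V} (h : IsStar G)
    (hG : G.IsTree) {n : ℕ} (hn : Fintype.card V = n) : Nonempty (G ≃g starGraph n) := by
  obtain ⟨r, hr⟩ := h
  have hpos : 0 < n := hn ▸ Fintype.card_pos_iff.2 ⟨r⟩
  let e₀ := Fintype.equivFinOfCardEq hn
  let e := e₀.trans (Equiv.swap (e₀ r) ⟨0, hpos⟩)
  have he : e r = ⟨0, hpos⟩ := by simp [e]
  have he' : ∀ v, (e v).1 = 0 ↔ v = r := fun v => by
    rw [← e.injective.eq_iff, he, Fin.ext_iff]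
  refine ⟨⟨e, fun {u v} => ?_⟩⟩
  rw [starGraph, SimpleGraph.fromRel_adj, he', he', e.injective.ne_iff]
  constructor
  · rintro ⟨huv, rfl | rfl⟩
    · exact hr v huv.symm
    · exact (hr u huv).symm
  · refine fun huv => ⟨huv.ne, ?_⟩
    by_contra! hne
    exact no_triangle hG r u v (hr u hne.1) huv (hr v hne.2)

end Comparison

section Ordering

theorem f_even {n : ℕ} (hn : 6 ≤ n) (he : Even n) : (f n - 1) ^ 2 + 3 ≤ n := by
  rw [f, if_pos he, Nat.add_sub_cancel_left]
  have hn' : (6 : ℝ) ≤ n := by exact_mod_cast hn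
  have h1 := Nat.floor_le (Real.sqrt_nonneg ((n : ℝ) - 3))
  have h2 := Real.sq_sqrt (show (0 : ℝ) ≤ n - 3 by linarith)
  have h3 := pow_le_pow_left₀ (Nat.cast_nonneg _) h1 2
  have : ((⌊√((n : ℝ) - 3)⌋₊ ^ 2 + 3 : ℕ) : ℝ) ≤ n := by
    push_cast; linarith
  exact_mod_cast this

theorem f_odd {n : ℕ} (hn : 6 ≤ n) (he : ¬ Even n) : (f n - 1) ^ 2 + (f n - 1) + 3 ≤ n := by
  have hn' : (6 : ℝ) ≤ n := by exact_mod_cast hn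
  have h2 := Real.sq_sqrt (show (0 : ℝ) ≤ n - 3 by linarith)
  have h0 := Real.sqrt_nonneg ((n : ℝ) - 3)
  rw [f, if_neg he]
  split_ifs with hp
  · obtain ⟨p, rfl⟩ := hp
    have hpp : p ≤ p ^ 2 := Nat.le_self_pow two_ne_zero p
    have hp1 : 1 ≤ p := by
      rcases Nat.eq_zero_or_pos p with rfl | h
      · simp at hn
      · exact h
    have hp1' : (1 : ℝ) ≤ p := by exact_mod_cast hp1
    push_cast [Nat.cast_sub hpp] at h2 h0 ⊢
    have h3 : √((p : ℝ) ^ 2 - p + 3 - 3) < p - 1 / 2 := by nlinarith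
    have h4 : ⌊3 / 2 + √((p : ℝ) ^ 2 - p + 3 - 3)⌋₊ ≤ p := by
      rw [← Nat.lt_add_one_iff, Nat.floor_lt (by positivity)]
      push_cast
      linarith
    obtain ⟨q, rfl⟩ := Nat.exists_eq_add_of_le hp1
    have h5 : ⌊3 / 2 + √(((1 + q : ℕ) : ℝ) ^ 2 - ((1 + q : ℕ) : ℝ) + 3 - 3)⌋₊ - 1 ≤ q := by omega
    have h6 : (1 + q) ^ 2 - (1 + q) = q ^ 2 + q := by
      rw [Nat.sub_eq_iff_eq_add hpp]; ring
    rw [h6]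
    gcongr
  · have h1 := Nat.floor_le (show 0 ≤ 1 / 2 + √((n : ℝ) - 3) by positivity)
    rcases Nat.eq_zero_or_pos ⌊1 / 2 + √((n : ℝ) - 3)⌋₊ with h3 | h3
    · rw [h3]; omega
    · obtain ⟨k, hk⟩ := Nat.exists_eq_add_of_le h3
      rw [hk, Nat.succ_eq_add_one, Nat.zero_add, Nat.add_sub_cancel_left]
      rw [hk] at h1
      push_cast at h1
      have h4 : ((k ^ 2 + k + 3 : ℕ) : ℝ) ≤ n := by
        push_cast
        nlinarith [(Nat.cast_nonneg k : (0 : ℝ) ≤ k)]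
      exact_mod_cast h4

theorem sidePoly_pos {a b n : ℝ} (hn : 0 < n) (hs : a + b + 2 = n)
    (h : (a - b) ^ 2 * n ^ 2 < 4 * n ^ 3 - 8 * n ^ 2 - 32 * n + 64) :
    0 < sidePoly a b (4 / n) := by
  have h1 : sidePoly a b (4 / n) =
      (4 * n ^ 3 - 8 * n ^ 2 - 32 * n + 64 - (a - b) ^ 2 * n ^ 2) / n ^ 3 := by
    obtain rfl : a = n - 2 - b := by linarith
    rw [sidePoly]
    field_simp
    ring
  rw [h1]
  exact div_pos (by linarith) (by positivity)

/-- The balanced double stars in the list exceed `2n - 4`. -/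
theorem last_sidePoly_pos {n : ℕ} (hn : 6 ≤ n) : f n - 1 + 1 ≤ (n - 2) / 2 ∧
    0 < sidePoly (((n - 1) / 2 + (f n - 1) : ℕ) : ℝ) (((n - 2) / 2 - (f n - 1) : ℕ) : ℝ)
      (4 / n) := by
  rcases Nat.even_or_odd n with he | ho
  · have hf := f_even hn he
    generalize f n - 1 = k at *
    obtain ⟨m, rfl⟩ := he
    have h1 : k + 1 ≤ m - 1 := by
      by_contra! hlt
      have : k ^ 2 + 3 ≤ k + 1 + (k + 1) := by omega
      have : k ≤ 2 := by nlinarith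
      interval_cases k <;> omega
    refine ⟨by omega, ?_⟩
    obtain ⟨j, rfl⟩ : ∃ j, m = k + 2 + j := ⟨m - (k + 2), by omega⟩
    rw [show (k + 2 + j + (k + 2 + j) - 1) / 2 + k = 2 * k + 1 + j by omega,
      show (k + 2 + j + (k + 2 + j) - 2) / 2 - k = 1 + j by omega]
    have hf' : ((k : ℝ) ^ 2 + 3) ≤ (k + 2 + j + (k + 2 + j) : ℕ) := by exact_mod_cast hf
    have hn' : (6 : ℝ) ≤ (k + 2 + j + (k + 2 + j) : ℕ) := by exact_mod_cast hn
    refine sidePoly_pos (by linarith) (by push_cast; ring) ?_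
    rw [show ((2 * k + 1 + j : ℕ) : ℝ) - (1 + j : ℕ) = 2 * k by push_cast; ring]
    generalize ((k + 2 + j + (k + 2 + j) : ℕ) : ℝ) = N at *
    have h2 := mul_le_mul_of_nonneg_right hf' (sq_nonneg N)
    have h3 : 0 < (N - 4) ^ 2 := pow_pos (by linarith) 2
    linarith
  · have hf := f_odd hn (Nat.not_even_iff_odd.2 ho)
    generalize f n - 1 = k at *
    obtain ⟨m, rfl⟩ := ho
    have h1 : k + 1 ≤ m - 1 := by
      by_contra! hlt
      have : k ^ 2 + k + 3 ≤ 2 * (k + 1) + 1 := by omega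
      have : k ≤ 1 := by nlinarith
      interval_cases k <;> omega
    refine ⟨by omega, ?_⟩
    obtain ⟨j, rfl⟩ : ∃ j, m = k + 2 + j := ⟨m - (k + 2), by omega⟩
    rw [show (2 * (k + 2 + j) + 1 - 1) / 2 + k = 2 * k + 2 + j by omega,
      show (2 * (k + 2 + j) + 1 - 2) / 2 - k = 1 + j by omega]
    have hf' : ((k : ℝ) ^ 2 + k + 3) ≤ (2 * (k + 2 + j) + 1 : ℕ) := by exact_mod_cast hf
    refine sidePoly_pos (by positivity) (by push_cast; ring) ?_
    rw [show ((2 * k + 2 + j : ℕ) : ℝ) - (1 + j : ℕ) = 2 * k + 1 by push_cast; ring]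
    by_cases h7 : k + j = 1
    · have : (k : ℝ) ≤ 1 := by exact_mod_cast (show k ≤ 1 by omega)
      rw [show 2 * (k + 2 + j) + 1 = 7 by omega]
      norm_num
      nlinarith [(Nat.cast_nonneg k : (0 : ℝ) ≤ k)]
    · have hn' : (9 : ℝ) ≤ (2 * (k + 2 + j) + 1 : ℕ) := by
        exact_mod_cast (show 9 ≤ 2 * (k + 2 + j) + 1 by omega)
      generalize ((2 * (k + 2 + j) + 1 : ℕ) : ℝ) = N at *
      have h2 := mul_le_mul_of_nonneg_right hf' (sq_nonneg N)
      nlinarith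

/-- Every tree outside the two families has small energy. -/
theorem LE_le_of_isTree {V : Type} [Fintype V] [DecidableEq V] {G : SimpleGraph V}
    [DecidableRel G.Adj] (hn : 6 ≤ Fintype.card V) (hG : G.IsTree) (hs : ¬ IsStar G)
    (hd : ¬ IsDoubleStar G) : LE G ≤ 2 * Fintype.card V - 4 := by
  have hn' : (6 : ℝ) ≤ Fintype.card V := by exact_mod_cast hn
  have hpos : (Fintype.card V : ℝ) ≠ 0 := by positivity
  have : Nonempty V := hG.connected.nonempty
  have hc := cert_of_isTree _ rfl hG hs hd (ε := 2 / Fintype.card V) (by positivity)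
    (by rw [div_le_div_iff₀] <;> linarith) (by rw [div_mul_cancel₀ _ hpos])
  have ha : avgDeg G = 2 - 2 / Fintype.card V := by
    have := hG.card_edgeFinset
    have h1 : (#G.edgeFinset : ℝ) + 1 = Fintype.card V := by exact_mod_cast this
    rw [avgDeg, ← h1]
    have : (#G.edgeFinset : ℝ) + 1 ≠ 0 := by positivity
    field_simp
    ring
  rw [← ha] at hc
  refine hc.LE_le.trans (le_of_eq ?_)
  field_simp
  ring

theorem LE_doubleStar_lt {V : Type} [Fintype V] [DecidableEq V] {G : SimpleGraph V}
    [DecidableRel G.Adj] {w r : V} {A : Finset V} (h : DoubleStarAt G w r A) {a b : ℕ}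
    (hc : Fintype.card V = a + b + 2) (hA : 0 < #A) (hB : 0 < #(outer w r A))
    (hlt : #A * #(outer w r A) < a * b) : LE G < LE (doubleStar a b) :=
  h.LE_lt (doubleStarAt_doubleStar a b) (by rw [hc, Fintype.card_fin]) hA hB
    (by rwa [card_doubleStar_left, card_doubleStar_right])

theorem add_mul_sub_lt {a b k k' : ℕ} (hab : b ≤ a) (hk : k < k') (hk' : k' ≤ b) :
    (a + k') * (b - k') < (a + k) * (b - k) := by
  obtain ⟨j, rfl⟩ := Nat.exists_eq_add_of_le hk'
  obtain ⟨i, rfl⟩ := Nat.exists_eq_add_of_lt hk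
  rw [Nat.add_sub_cancel_left, show k + i + 1 + j - k = i + 1 + j by omega]
  nlinarith

end Ordering

/-- Among all trees with `n ≥ 6` vertices, the trees with second through
`(f(n)+1)`-st largest Laplacian energy are, respectively, the double stars
`T(⌈(n-2)/2⌉ + k, ⌊(n-2)/2⌋ - k)` for `0 ≤ k ≤ f(n) - 1`: (i) their Laplacian energies
are strictly decreasing in `k`, and (ii) any `n`-vertex tree isomorphic neither to the
star nor to one of these double stars has Laplacian energy strictly smaller than the
smallest of theirs. Here `⌈(n-2)/2⌉ = (n-1)/2` and `⌊(n-2)/2⌋ = (n-2)/2` in ℕ. -/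
theorem trees_with_large_LE_ordering (n : ℕ) (hn : 6 ≤ n) :
    (∀ k k' : ℕ, k < k' → k' ≤ f n - 1 →
      LE (doubleStar ((n - 1) / 2 + k) ((n - 2) / 2 - k)) >
        LE (doubleStar ((n - 1) / 2 + k') ((n - 2) / 2 - k'))) ∧
    (∀ (W : Type) [Fintype W] [DecidableEq W] (T : SimpleGraph W) [DecidableRel T.Adj],
      Fintype.card W = n → T.IsTree →
      IsEmpty (T ≃g starGraph n) →
      (∀ k : ℕ, k ≤ f n - 1 →
        IsEmpty (T ≃g doubleStar ((n - 1) / 2 + k) ((n - 2) / 2 - k))) →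
      LE T < LE (doubleStar ((n - 1) / 2 + (f n - 1)) ((n - 2) / 2 - (f n - 1)))) := by
  obtain ⟨hf, hpos⟩ := last_sidePoly_pos hn
  generalize f n - 1 = m at *
  refine ⟨fun k k' hk hk' => ?_, fun W _ _ T _ hW hT hstar hds => ?_⟩
  · refine LE_doubleStar_lt (doubleStarAt_doubleStar _ _) (by rw [Fintype.card_fin]; omega) ?_ ?_ ?_
    · rw [card_doubleStar_left]; omega
    · rw [card_doubleStar_right]; omega
    · rw [card_doubleStar_left, card_doubleStar_right]
      exact add_mul_sub_lt (by omega) hk (by omega)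
  have hs : ¬ IsStar T := fun h => (h.nonempty_iso hT hW).elim hstar.false
  by_cases hd : IsDoubleStar T
  · obtain ⟨w, r, A, h, hA, hB⟩ := hd.dominated (no_triangle hT)
    have h' := h.doubleStarAt hT
    have hc : Fintype.card W = #A + #(outer w r A) + 2 := by exact_mod_cast h.card_eq
    have hA' := Finset.card_pos.2 hA
    have hB' := Finset.card_pos.2 hB
    obtain ⟨w, r, A, h, hA, hB, hle, hc⟩ : ∃ w r A, DoubleStarAt T w r A ∧ 0 < #A ∧
        0 < #(outer w r A) ∧ #(outer w r A) ≤ #A ∧ n = #A + #(outer w r A) + 2 := by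
      rcases le_total #(outer w r A) #A with hle | hle
      · exact ⟨w, r, A, h', hA', hB', hle, hW ▸ hc⟩
      · refine ⟨r, w, _, h'.swap, hB', ?_⟩
        rw [h'.outer_outer]
        exact ⟨hA', hle, by omega⟩
    obtain ⟨k, hk⟩ := Nat.exists_eq_add_of_le (show (n - 1) / 2 ≤ #A by omega)
    have hk' : #(outer w r A) = (n - 2) / 2 - k := by omega
    rcases le_or_gt k m with hkm | hkm
    · refine ((h.nonempty_iso (doubleStarAt_doubleStar _ _) ?_ ?_).elim (hds k hkm).false).elim
      · rw [hk, card_doubleStar_left]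
      · rw [hk', card_doubleStar_right]
    · refine LE_doubleStar_lt h (by omega) hA hB ?_
      rw [hk, hk']
      exact add_mul_sub_lt (by omega) hkm (by omega)
  · subst hW
    refine (LE_le_of_isTree hn hT hs hd).trans_lt ?_
    have h := (doubleStarAt_doubleStar ((Fintype.card W - 1) / 2 + m)
      ((Fintype.card W - 2) / 2 - m)).lt_LE (n := Fintype.card W) (by rw [Fintype.card_fin]; omega)
    rw [card_doubleStar_left, card_doubleStar_right] at h
    exact h (by omega) (by omega) hpos

end LapPaper
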